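/- If G is an n-vertex planar graph containing no Theta graph on 6 vertices as a subgraph, and G has a vertex v of degree 2 such that G - v has at least 3 blocks, then e(G) < (18/7)n - 48/7. -/

import Mathlib

open SimpleGraph

/-- `H` is a minor of `G`: there is an assignment of disjoint connected branch sets
of `G` to the vertices of `H` realizing all edges of `H`. -/
def HasMinor {V : Type*} {W : Type*} (G : SimpleGraph V) (H : SimpleGraph W) : Prop :=
  ∃ f : V → Option W,
    (∀ w : W, ∃ v, f v = some w) ∧
    (∀ w : W, (G.induce {v | f v = some w}).Preconnected) ∧
    (∀ w₁ w₂ : W, H.Adj w₁ w₂ →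
      ∃ v₁ v₂, f v₁ = some w₁ ∧ f v₂ = some w₂ ∧ G.Adj v₁ v₂)

/-- Planarity, via Wagner's theorem: no `K₅` minor and no `K₃,₃` minor. -/
def IsPlanar {V : Type*} (G : SimpleGraph V) : Prop :=
  ¬ HasMinor G (completeGraph (Fin 5)) ∧
    ¬ HasMinor G (completeBipartiteGraph (Fin 3) (Fin 3))

/-- `G` contains a Theta graph on 6 vertices: a 6-cycle together with a chord
joining two non-consecutive vertices of the cycle. -/
def HasTheta6 {V : Type*} (G : SimpleGraph V) : Prop :=
  ∃ v : Fin 6 → V, Function.Injective v ∧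
    (∀ i : Fin 6, G.Adj (v i) (v (i + 1))) ∧
    ∃ i j : Fin 6, i ≠ j ∧ j ≠ i + 1 ∧ i ≠ j + 1 ∧ G.Adj (v i) (v j)

/-- A set of vertices inducing a connected subgraph which stays connected
(in the weak sense of `Preconnected`) after deleting any one of its vertices. -/
def IsTwoConnSet {V : Type*} (G : SimpleGraph V) (B : Set V) : Prop :=
  B.Nonempty ∧ (G.induce B).Preconnected ∧
    ∀ v ∈ B, (G.induce (B \ {v})).Preconnected

/-- A block of `G`: a maximal subgraph without a cut vertex, described by
its vertex set. -/
def IsBlock {V : Type*} (G : SimpleGraph V) (B : Set V) : Prop :=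
  IsTwoConnSet G B ∧ ∀ C : Set V, IsTwoConnSet G C → B ⊆ C → B = C


open SimpleGraph

namespace T6
section P1
set_option linter.unusedSectionVars false
set_option linter.unusedSimpArgs false
open scoped Classical
open Finset
variable {V : Type*} [Fintype V]

/-- Mod 2 chains. -/
abbrev Ch (V : Type*) := Sym2 V → ZMod 2

/-- boundary of a chain at a vertex -/
noncomputable def bd (c : Ch V) (v : V) : ZMod 2 := ∑ u, c s(v, u)

/-- indicator -/
noncomputable def dl (a v : V) : ZMod 2 := if v = a then 1 else 0

/-- single edge chain -/
noncomputable def sg (a b : V) : Ch V := Pi.single s(a, b) 1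

lemma zz (x : ZMod 2) : x + x = 0 := CharTwo.add_self_eq_zero x

lemma z01 (x : ZMod 2) : x = 0 ∨ x = 1 := by revert x; decide

lemma z1 {x : ZMod 2} (h : x ≠ 0) : x = 1 := by rcases z01 x with h' | h' <;> simp_all

lemma bd_add (c d : Ch V) (v : V) : bd (c + d) v = bd c v + bd d v := by
  simp [bd, Finset.sum_add_distrib]

lemma bd_smul (a : ZMod 2) (c : Ch V) (v : V) : bd (a • c) v = a * bd c v := by
  simp [bd, Finset.mul_sum]

lemma bd_zero (v : V) : bd (0 : Ch V) v = 0 := by simp [bd]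

lemma bd_sum {ι : Type*} (s : Finset ι) (F : ι → Ch V) (v : V) :
    bd (∑ i ∈ s, F i) v = ∑ i ∈ s, bd (F i) v := by
  simp only [bd, Finset.sum_apply]
  rw [Finset.sum_comm]

lemma sg_apply (a b p q : V) : sg a b s(p, q) =
    if (p = a ∧ q = b) ∨ (p = b ∧ q = a) then 1 else 0 := by
  unfold sg
  rw [Pi.single_apply]
  congr 1
  simp [Sym2.eq_iff]

lemma bd_sg {a b : V} (h : a ≠ b) (v : V) : bd (sg a b) v = dl a v + dl b v := by
  unfold bd dl
  simp only [sg_apply]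
  by_cases h1 : v = a
  · subst h1
    simp [h]
  · by_cases h2 : v = b
    · subst h2; simp [h1]
    · simp [h1, h2]

/-- The cycle space of a graph. -/
noncomputable def Z (G : SimpleGraph V) : Submodule (ZMod 2) (Ch V) where
  carrier := {c | (∀ a b, ¬ G.Adj a b → c s(a, b) = 0) ∧ ∀ v, bd c v = 0}
  add_mem' := by
    rintro c d ⟨h1, h2⟩ ⟨h3, h4⟩
    refine ⟨fun a b h => by simp [h1 a b h, h3 a b h], fun v => by simp [bd_add, h2, h4]⟩
  zero_mem' := ⟨fun _ _ _ => rfl, fun v => bd_zero v⟩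
  smul_mem' := by
    rintro a c ⟨h1, h2⟩
    exact ⟨fun p q h => by simp [h1 p q h], fun v => by simp [bd_smul, h2]⟩

lemma mem_Z {G : SimpleGraph V} {c : Ch V} :
    c ∈ Z G ↔ (∀ a b, ¬ G.Adj a b → c s(a, b) = 0) ∧ ∀ v, bd c v = 0 := Iff.rfl

lemma Z_mono {G H : SimpleGraph V} (h : G ≤ H) : Z G ≤ Z H := by
  rintro c ⟨h1, h2⟩
  exact ⟨fun a b hab => h1 a b (fun hk => hab (h hk)), h2⟩

/-- handshake -/
lemma hand (c : Ch V) (hd : ∀ a, c s(a, a) = 0) (R : Finset V) :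
    ∑ v ∈ R, bd c v = ∑ v ∈ R, ∑ u ∈ Rᶜ, c s(v, u) := by
  have h0 : ∑ v ∈ R, ∑ u ∈ R, c s(v, u) = 0 := by
    rw [← Finset.sum_product']
    apply Finset.sum_involution (fun p _ => (p.2, p.1))
    · rintro ⟨a, b⟩ _
      simp only
      rw [Sym2.eq_swap]; exact zz _
    · rintro ⟨a, b⟩ _ h1 h2
      simp only [Prod.mk.injEq] at h2
      apply h1
      simp [h2.1, hd]
    · rintro ⟨a, b⟩ h; simp at h ⊢; tauto
    · rintro ⟨a, b⟩ _; rfl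
  have : ∀ v, bd c v = ∑ u ∈ R, c s(v, u) + ∑ u ∈ Rᶜ, c s(v, u) := by
    intro v; unfold bd; exact (Finset.sum_add_sum_compl R _).symm
  simp only [this, Finset.sum_add_distrib, h0, zero_add]

/-- cut-connectivity of a finite vertex set -/
def Conn (G : SimpleGraph V) (U : Finset V) : Prop :=
  ∀ P ⊆ U, P.Nonempty → (U \ P).Nonempty → ∃ a ∈ P, ∃ b ∈ U \ P, G.Adj a b

lemma Conn.mono {G H : SimpleGraph V} (h : G ≤ H) {U : Finset V} (hU : Conn G U) : Conn H U := by
  intro P hP h1 h2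
  obtain ⟨a, ha, b, hb, hab⟩ := hU P hP h1 h2
  exact ⟨a, ha, b, hb, h hab⟩

lemma Conn.chain {G : SimpleGraph V} {U : Finset V} (h : Conn G U) {a b : V} (ha : a ∈ U)
    (hb : b ∈ U) : ∃ c : Ch V, (∀ p q, c s(p, q) ≠ 0 → G.Adj p q ∧ p ∈ U ∧ q ∈ U) ∧
      ∀ v, bd c v = dl a v + dl b v := by
  let P := U.filter (fun b => ∃ c : Ch V, (∀ p q, c s(p, q) ≠ 0 → G.Adj p q ∧ p ∈ U ∧ q ∈ U) ∧
      ∀ v, bd c v = dl a v + dl b v)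
  by_cases hbP : b ∈ P
  · exact (Finset.mem_filter.1 hbP).2
  exfalso
  have haP : a ∈ P := by
    refine Finset.mem_filter.2 ⟨ha, 0, by simp, fun v => by rw [bd_zero, zz]⟩
  obtain ⟨p, hp, q, hq, hpq⟩ := h P (Finset.filter_subset _ _) ⟨a, haP⟩ ⟨b, by simp [hb, hbP]⟩
  rw [Finset.mem_sdiff] at hq
  apply hq.2
  obtain ⟨hpU, c, hc1, hc2⟩ := Finset.mem_filter.1 hp
  refine Finset.mem_filter.2 ⟨hq.1, c + sg p q, ?_, ?_⟩
  · intro x y hxy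
    by_cases h0 : c s(x, y) = 0
    · simp only [Pi.add_apply, h0, zero_add, sg_apply] at hxy
      split_ifs at hxy with h1
      · rcases h1 with ⟨rfl, rfl⟩ | ⟨rfl, rfl⟩
        · exact ⟨hpq, hpU, hq.1⟩
        · exact ⟨hpq.symm, hq.1, hpU⟩
      · exact absurd rfl hxy
    · exact hc1 x y h0
  · intro v
    rw [bd_add, hc2, bd_sg hpq.ne]
    linear_combination zz (dl p v)

/-- MacLane property -/
def Mac (G : SimpleGraph V) : Prop :=
  ∃ (ι : Type) (_ : Fintype ι) (F : ι → Ch V), (∀ i, F i ∈ Z G) ∧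
    (∀ c ∈ Z G, ∃ a : ι → ZMod 2, c = ∑ i, a i • F i) ∧
    ∀ e, (univ.filter (fun i => F i e ≠ 0)).card ≤ 2

/-- completed face systems -/
structure Sys (G : SimpleGraph V) {ι : Type} [Fintype ι] (F : ι → Ch V) : Prop where
  mem : ∀ i, F i ∈ Z G
  span : ∀ c ∈ Z G, ∃ a : ι → ZMod 2, c = ∑ i, a i • F i
  le2 : ∀ e, (univ.filter (fun i => F i e ≠ 0)).card ≤ 2
  tot : ∑ i, F i = 0

lemma sum_eq_card {ι : Type*} (s : Finset ι) (x : ι → ZMod 2) :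
    ∑ i ∈ s, x i = ((s.filter (fun i => x i ≠ 0)).card : ZMod 2) := by
  rw [← Finset.sum_filter_ne_zero, Finset.card_eq_sum_ones, Nat.cast_sum]
  apply Finset.sum_congr rfl
  intro i hi
  simpa using z1 (Finset.mem_filter.1 hi).2

lemma Sys.even {G : SimpleGraph V} {ι : Type} [Fintype ι] {F : ι → Ch V} (h : Sys G F) (e : Sym2 V) :
    (univ.filter (fun i => F i e ≠ 0)).card = 0 ∨ (univ.filter (fun i => F i e ≠ 0)).card = 2 := by
  have h1 := h.le2 e
  have h2 := congrFun h.tot e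
  rw [Finset.sum_apply, sum_eq_card, Pi.zero_apply, ZMod.natCast_eq_zero_iff] at h2
  omega

lemma Mac.sys {G : SimpleGraph V} (h : Mac G) :
    ∃ (ι : Type) (_ : Fintype ι) (F : ι → Ch V), Sys G F := by
  obtain ⟨ι, _, F, h1, h2, h3⟩ := h
  refine ⟨Option ι, inferInstance, fun o => o.elim (∑ i, F i) F, ?_, ?_, ?_, ?_⟩
  · rintro (_ | i)
    · exact Submodule.sum_mem _ (fun i _ => h1 i)
    · exact h1 i
  · intro c hc
    obtain ⟨a, ha⟩ := h2 c hc
    refine ⟨fun o => o.elim 0 a, ?_⟩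
    simp [Fintype.sum_option, ha]
  · intro e
    have h4 := h3 e
    have h5 : ((∑ i, F i) e) = ((univ.filter (fun i => F i e ≠ 0)).card : ZMod 2) := by
      rw [Finset.sum_apply, sum_eq_card]
    have h6 : (univ.filter (fun o : Option ι => (o.elim (∑ i, F i) F : Ch V) e ≠ 0)).card =
        (if (∑ i, F i) e ≠ 0 then 1 else 0) + (univ.filter (fun i => F i e ≠ 0)).card := by
      simp only [Finset.card_filter, Fintype.sum_option]
      simp only [Option.elim]
      congr!
    rw [h6]
    split_ifs with h7
    · have : (univ.filter (fun i => F i e ≠ 0)).card ≠ 2 := by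
        intro h8; rw [h5, h8] at h7; exact h7 (by decide)
      omega
    · omega
  · rw [Fintype.sum_option]
    ext e
    exact zz _

/-- drop one member of a system -/
lemma Sys.drop {G : SimpleGraph V} {ι : Type} [Fintype ι] {F : ι → Ch V} (h : Sys G F) (i : ι) :
    ∀ c ∈ Z G, ∃ a : ι → ZMod 2, a i = 0 ∧ c = ∑ j, a j • F j := by
  intro c hc
  obtain ⟨a, ha⟩ := h.span c hc
  refine ⟨fun j => a j + a i, zz _, ?_⟩
  simp only [add_smul, Finset.sum_add_distrib, ← Finset.smul_sum, h.tot, smul_zero, add_zero]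
  exact ha

lemma sum_subtype_smul {ι : Type} [Fintype ι] (p : ι → Prop) [Fintype {j // p j}] (a : ι → ZMod 2) (F : ι → Ch V)
    (h : ∀ j, ¬ p j → a j = 0) : ∑ j, a j • F j = ∑ j : {j // p j}, a j • F j := by
  rw [← Finset.sum_filter_add_sum_filter_not univ p]
  rw [Finset.sum_eq_zero (s := univ.filter (fun j => ¬ p j)), add_zero]
  · exact (Finset.sum_subtype (p := p) (univ.filter p) (by simp) (fun j => a j • F j))
  · intro j hj
    simp [h j (Finset.mem_filter.1 hj).2]

lemma card_sub_le {ι : Type} [Fintype ι] (p : ι → Prop) [Fintype {j // p j}] (q : ι → Prop)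
    [DecidablePred q] :
    (univ.filter (fun j : {j // p j} => q j)).card ≤ (univ.filter q).card := by
  apply Finset.card_le_card_of_injOn (fun j => j.1)
  · intro j hj; simpa using hj
  · intro a _ b _ h; exact Subtype.ext h

/-- a family where the given edge appears at most once -/
lemma Mac.once {G : SimpleGraph V} (h : Mac G) (e : Sym2 V) :
    ∃ (ι : Type) (_ : Fintype ι) (F : ι → Ch V), (∀ i, F i ∈ Z G) ∧
    (∀ c ∈ Z G, ∃ a : ι → ZMod 2, c = ∑ i, a i • F i) ∧
    (∀ e, (univ.filter (fun i => F i e ≠ 0)).card ≤ 2) ∧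
    (univ.filter (fun i => F i e ≠ 0)).card ≤ 1 := by
  obtain ⟨ι, _, F, hS⟩ := h.sys
  by_cases hi : ∃ i, F i e ≠ 0
  · obtain ⟨i, hi⟩ := hi
    refine ⟨{j // j ≠ i}, inferInstance, fun j => F j, fun j => hS.mem _, ?_, ?_, ?_⟩
    · intro c hc
      obtain ⟨a, ha, hc⟩ := hS.drop i c hc
      refine ⟨fun j => a j, hc.trans (sum_subtype_smul _ _ _ ?_)⟩
      intro j hj; push Not at hj; rw [hj, ha]
    · intro e'
      exact (card_sub_le _ (fun j => F j e' ≠ 0)).trans (hS.le2 e')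
    · change (univ.filter (fun j : {j // j ≠ i} => F j e ≠ 0)).card ≤ 1
      have h1 : (univ.filter (fun j : {j // j ≠ i} => F j e ≠ 0)).card ≤
          ((univ.filter (fun j => F j e ≠ 0)).erase i).card := by
        apply Finset.card_le_card_of_injOn (fun j => j.1)
        · intro j hj; simpa [j.2] using hj
        · intro a _ b _ h; exact Subtype.ext h
      rw [Finset.card_erase_of_mem (by simpa using hi)] at h1
      have := hS.le2 e
      omega
  · push Not at hi
    exact ⟨ι, inferInstance, F, hS.mem, hS.span, hS.le2, by simp [hi]⟩

/-- deletion of an edge -/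
lemma Mac.delete {G H : SimpleGraph V} (h : Mac G) (a b : V)
    (hH : ∀ p q, H.Adj p q ↔ G.Adj p q ∧ s(p, q) ≠ s(a, b)) : Mac H := by
  obtain ⟨ι, _, F, h1, h2, h3, h4⟩ := h.once s(a, b)
  have hHG : H ≤ G := fun p q hpq => ((hH p q).1 hpq).1
  refine ⟨{j // F j s(a, b) = 0}, inferInstance, fun j => F j, ?_, ?_, ?_⟩
  · rintro ⟨j, hj⟩
    refine ⟨fun p q hpq => ?_, (h1 j).2⟩
    rw [hH] at hpq
    by_cases h5 : G.Adj p q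
    · have : s(p, q) = s(a, b) := by tauto
      simpa [this] using hj
    · exact (h1 j).1 p q h5
  · intro c hc
    obtain ⟨x, hx⟩ := h2 c (Z_mono hHG hc)
    refine ⟨fun j => x j, hx.trans (sum_subtype_smul _ _ _ ?_)⟩
    intro j hj
    have h5 : c s(a, b) = 0 := hc.1 a b (by rw [hH]; simp)
    rw [hx, Finset.sum_apply, Finset.sum_eq_single j] at h5
    · simpa [hj] using h5
    · intro i _ hij
      by_contra h6
      have h7 : F i s(a, b) ≠ 0 := by intro h7; simp [h7] at h6
      have := Finset.card_le_one.1 h4 i (by simpa using h7) j (by simpa using hj)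
      exact hij this
    · simp
  · intro e
    exact (card_sub_le _ (fun j => F j e ≠ 0)).trans (h3 e)

lemma card_sum_filter {ι κ : Type} [Fintype ι] [Fintype κ] (F : ι → Ch V) (G : κ → Ch V) (e : Sym2 V) :
    (univ.filter (fun i : ι ⊕ κ => (Sum.elim F G i : Ch V) e ≠ 0)).card =
    (univ.filter (fun i => F i e ≠ 0)).card + (univ.filter (fun i => G i e ≠ 0)).card := by
  simp only [Finset.card_filter, Fintype.sum_sum_type]
  congr!

/-- gluing two graphs along at most one edge -/
lemma Mac.glue {G G1 G2 : SimpleGraph V} (h1 : Mac G1) (h2 : Mac G2) (hG1 : G1 ≤ G) (hG2 : G2 ≤ G)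
    (e0 : Sym2 V) (hov : ∀ p q, G1.Adj p q → G2.Adj p q → s(p, q) = e0)
    (hs : ∀ c ∈ Z G, ∃ c1 ∈ Z G1, ∃ c2 ∈ Z G2, c = c1 + c2) : Mac G := by
  obtain ⟨ι, _, F, a1, a2, a3, a4⟩ := h1.once e0
  obtain ⟨κ, _, F', b1, b2, b3, b4⟩ := h2.once e0
  refine ⟨ι ⊕ κ, inferInstance, Sum.elim F F', ?_, ?_, ?_⟩
  · rintro (i | i)
    · exact Z_mono hG1 (a1 i)
    · exact Z_mono hG2 (b1 i)
  · intro c hc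
    obtain ⟨c1, hc1, c2, hc2, rfl⟩ := hs c hc
    obtain ⟨x, hx⟩ := a2 c1 hc1
    obtain ⟨y, hy⟩ := b2 c2 hc2
    refine ⟨Sum.elim x y, ?_⟩
    simp [Fintype.sum_sum_type, hx, hy]
  · intro e
    rw [card_sum_filter]
    by_cases he : e = e0
    · subst he; omega
    · induction e with | _ p q =>
      by_cases hp : G1.Adj p q
      · have : ¬ G2.Adj p q := fun h => he (hov p q hp h)
        have h5 : (univ.filter (fun i => F' i s(p, q) ≠ 0)) = ∅ := by
          apply Finset.filter_eq_empty_iff.2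
          intro i _; simp [(b1 i).1 p q this]
        rw [h5]; simpa using a3 _
      · have h5 : (univ.filter (fun i => F i s(p, q) ≠ 0)) = ∅ := by
          apply Finset.filter_eq_empty_iff.2
          intro i _; simp [(a1 i).1 p q hp]
        rw [h5]; simpa using b3 _

end P1
end T6

open SimpleGraph

namespace T6
section P2
set_option linter.unusedSectionVars false
set_option linter.unusedSimpArgs false
open scoped Classical
open Finset
variable {V : Type*} [Fintype V]

lemma conn_of_pre {G : SimpleGraph V} {S : Set V} (h : (G.induce S).Preconnected) {U : Finset V}
    (hU : ∀ v, v ∈ U ↔ v ∈ S) : Conn G U := by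
  intro P hP ⟨a, ha⟩ ⟨b, hb⟩
  by_contra hcon
  push Not at hcon
  rw [Finset.mem_sdiff] at hb
  have key : ∀ (x y : S), (G.induce S).Walk x y → x.1 ∈ P → y.1 ∈ P := by
    intro x y w
    induction w with
    | nil => exact id
    | @cons u v w huv _ ih =>
      intro hu
      apply ih
      by_contra hv
      exact hcon u hu v (by rw [Finset.mem_sdiff]; exact ⟨(hU _).2 v.2, hv⟩) huv
  obtain ⟨w⟩ := h ⟨a, (hU a).1 (hP ha)⟩ ⟨b, (hU b).1 hb.1⟩
  exact hb.2 (key _ _ w ha)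

lemma pre_of_conn {G : SimpleGraph V} {S : Set V} {U : Finset V} (h : Conn G U)
    (hU : ∀ v, v ∈ U ↔ v ∈ S) : (G.induce S).Preconnected := by
  intro a b
  let P := U.filter (fun v => ∃ hv : v ∈ S, (G.induce S).Reachable a ⟨v, hv⟩)
  by_cases hb : b.1 ∈ P
  · obtain ⟨_, h1, h2⟩ := Finset.mem_filter.1 hb
    exact h2
  exfalso
  obtain ⟨p, hp, q, hq, hpq⟩ := h P (Finset.filter_subset _ _)
    ⟨a, Finset.mem_filter.2 ⟨(hU _).2 a.2, a.2, Reachable.refl _⟩⟩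
    ⟨b, Finset.mem_sdiff.2 ⟨(hU _).2 b.2, hb⟩⟩
  rw [Finset.mem_sdiff] at hq
  obtain ⟨_, h1, h2⟩ := Finset.mem_filter.1 hp
  apply hq.2
  refine Finset.mem_filter.2 ⟨hq.1, (hU q).1 hq.1, h2.trans ?_⟩
  exact Adj.reachable (by simpa using hpq)

/-- weak minor: disjoint connected branch sets (possibly empty for isolated vertices) -/
def WM {W : Type*} (G : SimpleGraph V) (H : SimpleGraph W) : Prop :=
  ∃ S : W → Finset V, (∀ a b v, v ∈ S a → v ∈ S b → a = b) ∧ (∀ a, Conn G (S a)) ∧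
    ∀ a b, H.Adj a b → ∃ u ∈ S a, ∃ v ∈ S b, G.Adj u v

lemma WM.of_hasMinor {W : Type*} {G : SimpleGraph V} {H : SimpleGraph W} (h : HasMinor G H) :
    WM G H := by
  obtain ⟨f, _, h2, h3⟩ := h
  refine ⟨fun w => univ.filter (fun v => f v = some w), ?_, ?_, ?_⟩
  · intro a b v h1 h2
    simp at h1 h2
    rw [h1] at h2; exact Option.some_injective _ h2
  · intro a
    exact conn_of_pre (h2 a) (by simp)
  · intro a b hab
    obtain ⟨u, v, hu, hv, huv⟩ := h3 a b hab
    exact ⟨u, by simpa using hu, v, by simpa using hv, huv⟩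

lemma WM.hasMinor {W : Type*} {G : SimpleGraph V} {H : SimpleGraph W} (h : WM G H)
    (hH : ∀ w, ∃ w', H.Adj w w') : HasMinor G H := by
  obtain ⟨S, h1, h2, h3⟩ := h
  let f : V → Option W := fun v => if hv : ∃ w, v ∈ S w then some hv.choose else none
  have hf : ∀ v w, f v = some w ↔ v ∈ S w := by
    intro v w
    constructor
    · intro h
      by_cases hv : ∃ w, v ∈ S w
      · simp only [f, hv, dite_true] at h
        rw [← Option.some_injective _ h]; exact hv.choose_spec
      · simp [f, hv] at h
    · intro h
      have hv : ∃ w, v ∈ S w := ⟨w, h⟩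
      simp only [f, hv, dite_true]
      rw [h1 _ _ v hv.choose_spec h]
  refine ⟨f, ?_, ?_, ?_⟩
  · intro w
    obtain ⟨w', hw⟩ := hH w
    obtain ⟨u, hu, _⟩ := h3 w w' hw
    exact ⟨u, (hf _ _).2 hu⟩
  · intro w
    exact pre_of_conn (h2 w) (by simp [hf])
  · intro a b hab
    obtain ⟨u, hu, v, hv, huv⟩ := h3 a b hab
    exact ⟨u, v, (hf _ _).2 hu, (hf _ _).2 hv, huv⟩

lemma WM.trans {V' W : Type*} [Fintype V'] {G : SimpleGraph V} {G' : SimpleGraph V'}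
    {H : SimpleGraph W} (h : WM G G') (h' : WM G' H) : WM G H := by
  obtain ⟨S, h1, h2, h3⟩ := h
  obtain ⟨T, k1, k2, k3⟩ := h'
  refine ⟨fun w => (T w).biUnion S, ?_, ?_, ?_⟩
  · intro a b v ha hb
    rw [Finset.mem_biUnion] at ha hb
    obtain ⟨x, hx, hvx⟩ := ha
    obtain ⟨y, hy, hvy⟩ := hb
    have := h1 x y v hvx hvy
    subst this
    exact k1 a b x hx hy
  · intro w P hP ⟨a, ha⟩ ⟨b, hb⟩
    by_contra hcon
    push Not at hcon
    have hsub : ∀ x ∈ T w, (∃ v ∈ S x, v ∈ P) → S x ⊆ P := by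
      rintro x hx ⟨v, hv, hvP⟩ u hu
      by_contra huP
      obtain ⟨p, hp, q, hq, hpq⟩ := h2 x ((S x).filter (· ∈ P)) (Finset.filter_subset _ _)
        ⟨v, by simp [hv, hvP]⟩ ⟨u, by simp [hu, huP]⟩
      simp only [Finset.mem_filter, Finset.mem_sdiff, not_and] at hp hq
      refine hcon p hp.2 q ?_ hpq
      rw [Finset.mem_sdiff, Finset.mem_biUnion]
      exact ⟨⟨x, hx, hq.1⟩, hq.2 hq.1⟩
    rw [Finset.mem_sdiff, Finset.mem_biUnion] at hb
    obtain ⟨⟨y, hy, hby⟩, hbP⟩ := hb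
    obtain ⟨x, hx, hax⟩ := Finset.mem_biUnion.1 (hP ha)
    obtain ⟨p, hp, q, hq, hpq⟩ := k2 w ((T w).filter (fun x => ∃ v ∈ S x, v ∈ P))
      (Finset.filter_subset _ _) ⟨x, by simp only [Finset.mem_filter]; exact ⟨hx, a, hax, ha⟩⟩
      ⟨y, by
        simp only [Finset.mem_sdiff, Finset.mem_filter, not_and]
        exact ⟨hy, fun _ h => hbP (hsub y hy h hby)⟩⟩
    simp only [Finset.mem_filter, Finset.mem_sdiff, not_and] at hp hq
    obtain ⟨u, hu, v, hv, huv⟩ := h3 p q hpq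
    refine hcon u (hsub p hp.1 hp.2 hu) v ?_ huv
    rw [Finset.mem_sdiff, Finset.mem_biUnion]
    exact ⟨⟨q, hq.1, hv⟩, fun hvP => hq.2 hq.1 ⟨v, hv, hvP⟩⟩
  · intro a b hab
    obtain ⟨x, hx, y, hy, hxy⟩ := k3 a b hab
    obtain ⟨u, hu, v, hv, huv⟩ := h3 x y hxy
    exact ⟨u, Finset.mem_biUnion.2 ⟨x, hx, hu⟩, v, Finset.mem_biUnion.2 ⟨y, hy, hv⟩, huv⟩

lemma planar_of_wm {V' : Type*} [Fintype V'] {G : SimpleGraph V} {G' : SimpleGraph V'}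
    (h : WM G G') (hp : IsPlanar G) : IsPlanar G' := by
  constructor
  · intro hm
    apply hp.1
    refine (h.trans (WM.of_hasMinor hm)).hasMinor ?_
    intro w
    exact ⟨w + 1, by revert w; decide⟩
  · intro hm
    apply hp.2
    refine (h.trans (WM.of_hasMinor hm)).hasMinor ?_
    rintro (w | w)
    · exact ⟨Sum.inr 0, by simp⟩
    · exact ⟨Sum.inl 0, by simp⟩

lemma conn_singleton (G : SimpleGraph V) (v : V) : Conn G {v} := by
  rintro P hP ⟨a, ha⟩ ⟨b, hb⟩
  have h1 := Finset.mem_singleton.1 (hP ha)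
  rw [Finset.mem_sdiff, Finset.mem_singleton] at hb
  exact absurd ha (by rw [h1, ← hb.1]; exact hb.2)

lemma planar_mono {G H : SimpleGraph V} (h : H ≤ G) (hp : IsPlanar G) : IsPlanar H := by
  refine planar_of_wm ⟨fun v => {v}, ?_, fun v => conn_singleton G v, ?_⟩ hp
  · intro a b v h1 h2; simp at h1 h2; rw [← h1, ← h2]
  · intro a b hab; exact ⟨a, by simp, b, by simp, h hab⟩

/-- union of two connected sets joined by an edge or a common vertex -/
lemma Conn.union {G : SimpleGraph V} {A B : Finset V} (hA : Conn G A) (hB : Conn G B)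
    (h : ∃ a ∈ A, ∃ b ∈ B, G.Adj a b ∨ a = b) : Conn G (A ∪ B) := by
  obtain ⟨a, ha, b, hb, hab⟩ := h
  intro P hP ⟨p, hp⟩ ⟨q, hq⟩
  by_contra hcon
  push Not at hcon
  have gen : ∀ C : Finset V, C ⊆ A ∪ B → Conn G C → (∃ x ∈ C, x ∈ P) → C ⊆ P := by
    rintro C hCU hC ⟨x, hx, hxP⟩ y hy
    by_contra hyP
    obtain ⟨u, hu, v, hv, huv⟩ := hC (C.filter (· ∈ P)) (Finset.filter_subset _ _)
        ⟨x, by simp [hx, hxP]⟩ ⟨y, by simp [hy, hyP]⟩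
    simp only [Finset.mem_filter, Finset.mem_sdiff, not_and] at hu hv
    exact hcon u hu.2 v (Finset.mem_sdiff.2 ⟨hCU hv.1, hv.2 hv.1⟩) huv
  have gA := gen A Finset.subset_union_left hA
  have gB := gen B Finset.subset_union_right hB
  have hiff : a ∈ P ↔ b ∈ P := by
    rcases hab with hab | rfl
    · constructor
      · intro h1; by_contra h2
        exact hcon a h1 b (Finset.mem_sdiff.2 ⟨Finset.mem_union_right _ hb, h2⟩) hab
      · intro h1; by_contra h2
        exact hcon b h1 a (Finset.mem_sdiff.2 ⟨Finset.mem_union_left _ ha, h2⟩) hab.symm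
    · rfl
  rw [Finset.mem_sdiff, Finset.mem_union] at hq
  have hall : A ⊆ P ∧ B ⊆ P := by
    rcases Finset.mem_union.1 (hP hp) with h1 | h1
    · have h2 := gA ⟨p, h1, hp⟩
      exact ⟨h2, gB ⟨b, hb, hiff.1 (h2 ha)⟩⟩
    · have h2 := gB ⟨p, h1, hp⟩
      exact ⟨gA ⟨a, ha, hiff.2 (h2 hb)⟩, h2⟩
  rcases hq.1 with h1 | h1
  · exact hq.2 (hall.1 h1)
  · exact hq.2 (hall.2 h1)

end P2
end T6

open SimpleGraph
namespace T6
section P3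
set_option linter.unusedSectionVars false
set_option linter.unusedSimpArgs false
open scoped Classical
open Finset
variable {V : Type*} [Fintype V]

/-- restriction of a chain to a set of edges -/
noncomputable def rs (K : Set (Sym2 V)) (c : Ch V) : Ch V := fun e => if e ∈ K then c e else 0

lemma rs_add (K : Set (Sym2 V)) (c d : Ch V) : rs K (c + d) = rs K c + rs K d := by
  funext e; by_cases h : e ∈ K <;> simp [rs, h]

lemma rs_smul (K : Set (Sym2 V)) (a : ZMod 2) (c : Ch V) : rs K (a • c) = a • rs K c := by
  funext e; by_cases h : e ∈ K <;> simp [rs, h]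

lemma rs_sum {ι : Type*} (K : Set (Sym2 V)) (s : Finset ι) (F : ι → Ch V) :
    rs K (∑ i ∈ s, F i) = ∑ i ∈ s, rs K (F i) := by
  funext e; by_cases h : e ∈ K <;> simp [rs, h]

/-- pair property at a vertex -/
def PairP (G : SimpleGraph V) (v : V) : Prop := ∀ u w, G.Adj v u → G.Adj v w → u ≠ w →
  ∃ c ∈ Z G, ∀ t, c s(v, t) ≠ 0 ↔ t = u ∨ t = w

lemma pair_of_conn {G : SimpleGraph V} {U : Finset V} {v : V} (hU : Conn G U) (hv : v ∉ U)
    (hN : ∀ u, G.Adj v u → u ∈ U) : PairP G v := by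
  intro u w hu hw huw
  obtain ⟨c, hc, hb⟩ := hU.chain (hN u hu) (hN w hw)
  have hvu := hu.ne
  have hvw := hw.ne
  refine ⟨c + sg v u + sg v w, ⟨?_, ?_⟩, ?_⟩
  · intro p q hpq
    have h1 : c s(p, q) = 0 := by
      by_contra h; exact hpq (hc p q h).1
    simp only [Pi.add_apply, sg_apply, h1]
    rw [if_neg, if_neg]
    · simp
    · rintro (⟨rfl, rfl⟩ | ⟨rfl, rfl⟩)
      · exact hpq hw
      · exact hpq hw.symm
    · rintro (⟨rfl, rfl⟩ | ⟨rfl, rfl⟩)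
      · exact hpq hu
      · exact hpq hu.symm
  · intro t
    rw [bd_add, bd_add, hb, bd_sg hvu, bd_sg hvw]
    generalize dl u t = a; generalize dl v t = b; generalize dl w t = d
    revert a b d; decide
  · intro t
    have h1 : c s(v, t) = 0 := by
      by_contra h; exact hv (hc v t h).2.1
    simp only [Pi.add_apply, sg_apply, h1]
    by_cases h2 : t = u
    · subst h2; simp [hvu, hvw, huw]
    · by_cases h3 : t = w
      · subst h3; simp [hvu, hvw, huw, h2]
      · simp [h2, h3, hvu, hvw]

lemma Z_diag {G : SimpleGraph V} {c : Ch V} (h : c ∈ Z G) (a : V) : c s(a, a) = 0 :=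
  h.1 a a (G.irrefl)

lemma Z_adj {G : SimpleGraph V} {c : Ch V} (h : c ∈ Z G) {a b : V} (hc : c s(a, b) ≠ 0) :
    G.Adj a b := by
  by_contra hk; exact hc (h.1 a b hk)

/-- a set of neighbours met evenly by all faces is trivial -/
lemma star_even {G : SimpleGraph V} {ι : Type} [Fintype ι] {F : ι → Ch V} (h : Sys G F) {v : V}
    (hP : PairP G v) (D : Finset V) (hD : ∀ i, ∑ u ∈ D, F i s(v, u) = 0) :
    (∀ u, G.Adj v u → u ∈ D) ∨ (∀ u, G.Adj v u → u ∉ D) := by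
  by_contra hcon
  push Not at hcon
  obtain ⟨⟨u, hu, huD⟩, w, hw, hwD⟩ := hcon
  obtain ⟨c, hc, hc2⟩ := hP u w hu hw (by rintro rfl; exact huD hwD)
  obtain ⟨a, rfl⟩ := h.span c hc
  have h1 : ∑ t ∈ D, (∑ i, a i • F i) s(v, t) = 0 := by
    simp only [Finset.sum_apply, Pi.smul_apply, smul_eq_mul]
    rw [Finset.sum_comm]
    apply Finset.sum_eq_zero
    intro i _
    rw [← Finset.mul_sum, hD, mul_zero]
  rw [Finset.sum_eq_single w] at h1
  · exact (hc2 w).2 (Or.inr rfl) h1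
  · intro t ht htw
    by_contra h3
    rcases (hc2 t).1 h3 with rfl | rfl
    · exact huD ht
    · exact htw rfl
  · exact fun h => absurd hwD h

/-- relation uniqueness at a vertex -/
lemma star_rel {G : SimpleGraph V} {ι : Type} [Fintype ι] {F : ι → Ch V} (h : Sys G F) {v : V}
    (hP : PairP G v) (R : Finset ι) (hR : ∀ u, ∑ i ∈ R, F i s(v, u) = 0) :
    (∀ i, (∃ u, F i s(v, u) ≠ 0) → i ∈ R) ∨ (∀ i, (∃ u, F i s(v, u) ≠ 0) → i ∉ R) := by
  let D : Finset V := univ.filter (fun u => ∃ i ∈ R, F i s(v, u) ≠ 0)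
  have key : ∀ i u, u ∈ D → F i s(v, u) ≠ 0 → i ∈ R := by
    intro i u hu hi
    by_contra hiR
    obtain ⟨j, hj, hju⟩ := (Finset.mem_filter.1 hu).2
    have h1 := hR u
    rw [sum_eq_card, ZMod.natCast_eq_zero_iff] at h1
    have h2 := h.le2 s(v, u)
    have h3 : insert i (R.filter (fun i => F i s(v, u) ≠ 0)) ⊆
        univ.filter (fun i => F i s(v, u) ≠ 0) := by
      intro k hk
      rw [Finset.mem_insert, Finset.mem_filter] at hk
      rw [Finset.mem_filter]
      rcases hk with rfl | hk
      · exact ⟨mem_univ _, hi⟩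
      · exact ⟨mem_univ _, hk.2⟩
    have h4 := Finset.card_le_card h3
    rw [Finset.card_insert_of_notMem (by simp [hiR])] at h4
    have h5 : 0 < (R.filter (fun i => F i s(v, u) ≠ 0)).card :=
      Finset.card_pos.2 ⟨j, by simp [hj, hju]⟩
    omega
  have hD : ∀ i, ∑ u ∈ D, F i s(v, u) = 0 := by
    intro i
    by_cases hi : i ∈ R
    · have h1 := (h.mem i).2 v
      unfold bd at h1
      rw [← h1]
      apply Finset.sum_subset (subset_univ _)
      intro u _ hu
      by_contra h2
      exact hu (by simp [D]; exact ⟨i, hi, h2⟩)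
    · apply Finset.sum_eq_zero
      intro u hu
      by_contra h2
      exact hi (key i u hu h2)
  rcases star_even h hP D hD with h1 | h1
  · left
    rintro i ⟨u, hu⟩
    exact key i u (h1 u (Z_adj (h.mem i) hu)) hu
  · right
    rintro i ⟨u, hu⟩ hi
    exact h1 u (Z_adj (h.mem i) hu) (by simp [D]; exact ⟨i, hi, hu⟩)

lemma star_two {G : SimpleGraph V} {ι : Type} [Fintype ι] {F : ι → Ch V} (h : Sys G F) {v u w : V}
    (hP : PairP G v) (hu : G.Adj v u) (hw : G.Adj v w) (huw : u ≠ w) :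
    (univ.filter (fun i => F i s(v, u) ≠ 0)).card = 2 := by
  rcases h.even s(v, u) with h1 | h1
  · exfalso
    obtain ⟨c, hc, hc2⟩ := hP u w hu hw huw
    obtain ⟨a, rfl⟩ := h.span c hc
    apply (hc2 u).2 (Or.inl rfl)
    rw [Finset.sum_apply]
    apply Finset.sum_eq_zero
    intro i _
    rw [Finset.card_eq_zero, Finset.filter_eq_empty_iff] at h1
    have := h1 (mem_univ i)
    rw [not_not] at this
    simp [this]
  · exact h1

/-- two-connected graph with support in `U` -/
structure TC (G : SimpleGraph V) (U : Finset V) : Prop where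
  supp : ∀ a b, G.Adj a b → a ∈ U
  conn : Conn G U
  del : ∀ v, Conn G (U.erase v)

lemma TC.pair {G : SimpleGraph V} {U : Finset V} (h : TC G U) (v : V) : PairP G v := by
  apply pair_of_conn (h.del v) (by simp)
  intro u hu
  rw [Finset.mem_erase]
  exact ⟨hu.ne', h.supp u v hu.symm⟩

lemma K1 {G : SimpleGraph V} {U : Finset V} (h : TC G U) (K : Set (Sym2 V))
    (hK : ∀ c ∈ Z G, ∀ v, bd (rs K c) v = 0) :
    (∀ a b, G.Adj a b → s(a, b) ∈ K) ∨ (∀ a b, G.Adj a b → s(a, b) ∉ K) := by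
  have loc : ∀ v u w, G.Adj v u → G.Adj v w → s(v, u) ∈ K → s(v, w) ∈ K := by
    intro v u w hu hw huK
    by_contra hwK
    obtain ⟨c, hc, hc2⟩ := h.pair v u w hu hw (by rintro rfl; exact hwK huK)
    have h1 := hK c hc v
    unfold bd at h1
    rw [Finset.sum_eq_single u] at h1
    · simp only [rs, huK, if_true] at h1
      exact (hc2 u).2 (Or.inl rfl) h1
    · intro t _ ht
      by_cases htK : s(v, t) ∈ K
      · simp only [rs, htK, if_true]
        by_contra h3
        rcases (hc2 t).1 h3 with rfl | rfl
        · exact ht rfl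
        · exact hwK htK
      · simp [rs, htK]
    · intro h; exact absurd (mem_univ _) h
  by_contra hcon
  push Not at hcon
  obtain ⟨⟨a, b, hab, habK⟩, p, q, hpq, hpqK⟩ := hcon
  let P := U.filter (fun v => ∃ u, G.Adj v u ∧ s(v, u) ∈ K)
  obtain ⟨v, hv, w, hw, hvw⟩ := h.conn P (Finset.filter_subset _ _)
    ⟨p, by simp only [P, Finset.mem_filter]; exact ⟨h.supp p q hpq, q, hpq, hpqK⟩⟩
    ⟨a, by
      simp only [P, Finset.mem_sdiff, Finset.mem_filter]
      refine ⟨h.supp a b hab, ?_⟩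
      rintro ⟨_, u, hu, huK⟩
      exact habK (loc a u b hu hab huK)⟩
  simp only [P, Finset.mem_sdiff, Finset.mem_filter] at hv hw
  obtain ⟨_, u, hu, huK⟩ := hv
  exact hw.2 ⟨hw.1, v, hvw.symm, by rw [Sym2.eq_swap]; exact loc v u w hu hvw huK⟩

lemma Sys.closed {G : SimpleGraph V} {ι : Type} [Fintype ι] {F : ι → Ch V} (h : Sys G F)
    (K : Set (Sym2 V)) (hK : ∀ i v, bd (rs K (F i)) v = 0) : ∀ c ∈ Z G, ∀ v, bd (rs K c) v = 0 := by
  intro c hc v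
  obtain ⟨a, rfl⟩ := h.span c hc
  rw [rs_sum, bd_sum]
  apply Finset.sum_eq_zero
  intro i _
  rw [rs_smul, bd_smul, hK, mul_zero]

/-- subset of faces with zero sum -/
lemma Sys.zero_sum {G : SimpleGraph V} {ι : Type} [Fintype ι] {F : ι → Ch V} (h : Sys G F)
    {U : Finset V} (hT : TC G U) (R : Finset ι) (hR : ∀ e, ∀ i ∈ R, ∀ j ∉ R, F i e ≠ 0 → F j e = 0) :
    (∀ i, F i ≠ 0 → i ∈ R) ∨ (∀ i, F i ≠ 0 → i ∉ R) := by
  let K : Set (Sym2 V) := {e | ∃ i ∈ R, F i e ≠ 0}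
  have hK := h.closed K (by
    intro i v
    by_cases hi : i ∈ R
    · have : rs K (F i) = F i := by
        funext e
        by_cases h0 : F i e = 0
        · simp [rs, h0]
        · simp only [rs]; rw [if_pos]; exact ⟨i, hi, h0⟩
      rw [this]; exact (h.mem i).2 v
    · have : rs K (F i) = 0 := by
        funext e
        simp only [rs]
        split_ifs with he
        · obtain ⟨j, hj, hje⟩ := he
          exact hR e j hj i hi hje
        · rfl
      rw [this]; exact bd_zero v)
  have ex : ∀ i, F i ≠ 0 → ∃ a b, F i s(a, b) ≠ 0 := by
    intro i hi
    by_contra hcon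
    push Not at hcon
    apply hi; funext e
    induction e using Sym2.ind with
    | _ a b => exact hcon a b
  rcases K1 hT K hK with h1 | h1
  · left
    intro i hi
    obtain ⟨a, b, hab⟩ := ex i hi
    obtain ⟨j, hj, hje⟩ := h1 a b (Z_adj (h.mem i) hab)
    by_contra hiR
    exact hab (hR _ j hj i hiR hje)
  · right
    intro i hi hiR
    obtain ⟨a, b, hab⟩ := ex i hi
    exact h1 a b (Z_adj (h.mem i) hab) ⟨i, hiR, hab⟩

/-- faces are minimal -/
lemma Sys.minimal {G : SimpleGraph V} {ι : Type} [Fintype ι] {F : ι → Ch V} (h : Sys G F)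
    {U : Finset V} (hT : TC G U) (i : ι) {z1 z2 : Ch V} (hz1 : z1 ∈ Z G) 
    (hF : F i = z1 + z2) (hd : ∀ e, z1 e = 0 ∨ z2 e = 0) : z1 = 0 ∨ z2 = 0 := by
  obtain ⟨a, ha, hz⟩ := h.drop i z1 hz1
  have hz2 : z2 = ∑ j, (if j = i then 0 else (1 + a j)) • F j := by
    have e1 : z2 = F i + z1 := by rw [hF]; funext e; simp only [Pi.add_apply]; 
                                  generalize z1 e = x; generalize z2 e = y; revert x y; decide
    have e2 : F i = ∑ j, (if j = i then 1 else 0 : ZMod 2) • F j := by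
      simp
    have e3 : (0 : Ch V) = ∑ j, (1 : ZMod 2) • F j := by simp [h.tot]
    have e4 : z2 = F i + z1 + 0 := by rw [add_zero]; exact e1
    rw [e4, e3, hz]
    nth_rewrite 1 [e2]
    rw [← Finset.sum_add_distrib, ← Finset.sum_add_distrib]
    apply Finset.sum_congr rfl
    intro j _
    rw [← add_smul, ← add_smul]
    congr 1
    by_cases hj : j = i
    · subst hj; simp [ha]; exact zz 1
    · simp [hj, add_comm]
  have odd : ∀ (b : ι → ZMod 2) e, (∑ j, b j • F j) e = 
      ((univ.filter (fun j => b j ≠ 0 ∧ F j e ≠ 0)).card : ZMod 2) := by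
    intro b e
    rw [Finset.sum_apply, sum_eq_card]
    congr 2
    ext j
    simp
  -- no edge in both kinds of faces
  have nomix : ∀ e j k, a j ≠ 0 → F j e ≠ 0 → a k = 0 → k ≠ i → F k e ≠ 0 → False := by
    intro e j k hj hje hk hki hke
    have hjk : j ≠ k := by rintro rfl; exact hj hk
    have hall : ∀ l, F l e ≠ 0 → l = j ∨ l = k := by
      intro l hl
      by_contra hcon
      push Not at hcon
      have : ({l, j, k} : Finset ι).card ≤ 2 := by
        refine le_trans (Finset.card_le_card ?_) (h.le2 e)
        intro t ht
        simp only [Finset.mem_insert, Finset.mem_singleton] at ht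
        simp only [Finset.mem_filter, mem_univ, true_and]
        rcases ht with rfl | rfl | rfl <;> assumption
      rw [Finset.card_insert_of_notMem (by simp [hcon]), Finset.card_pair hjk] at this
      omega
    have hji : j ≠ i := by rintro rfl; exact hj ha
    rcases hd e with h0 | h0
    · rw [hz, odd] at h0
      have : univ.filter (fun j => a j ≠ 0 ∧ F j e ≠ 0) = {j} := by
        ext l
        simp only [Finset.mem_filter, mem_univ, true_and, Finset.mem_singleton]
        constructor
        · rintro ⟨h1, h2⟩
          rcases hall l h2 with rfl | rfl
          · rfl
          · exact absurd hk h1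
        · rintro rfl; exact ⟨hj, hje⟩
      rw [this] at h0; simp at h0
    · rw [hz2, odd] at h0
      have : univ.filter (fun j => (if j = i then 0 else (1 + a j)) ≠ 0 ∧ F j e ≠ 0) = {k} := by
        ext l
        simp only [Finset.mem_filter, mem_univ, true_and, Finset.mem_singleton]
        constructor
        · rintro ⟨h1, h2⟩
          rcases hall l h2 with rfl | rfl
          · rw [if_neg hji, T6.z1 hj] at h1; exact absurd (by decide) h1
          · rfl
        · rintro rfl; rw [if_neg hki, hk]; exact ⟨by decide, hke⟩
      rw [this] at h0; simp at h0
  let K : Set (Sym2 V) := {e | ∃ j, a j ≠ 0 ∧ F j e ≠ 0}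
  have hiK : rs K (F i) = z1 := by
    funext e
    simp only [rs]
    split_ifs with he
    · obtain ⟨j, hj, hje⟩ := he
      -- z2 e = 0
      have : z2 e = 0 := by
        rw [hz2, odd]
        rw [Finset.card_eq_zero.2, Nat.cast_zero]
        rw [Finset.filter_eq_empty_iff]
        rintro k _ ⟨h1, h2⟩
        by_cases hk : k = i
        · simp [hk] at h1
        · refine nomix e j k hj hje ?_ hk h2
          by_contra h3
          rw [if_neg hk, T6.z1 h3] at h1; exact absurd (by decide) h1
      rw [hF, Pi.add_apply, this, add_zero]
    · rw [hz, odd, Finset.card_eq_zero.2, Nat.cast_zero]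
      rw [Finset.filter_eq_empty_iff]
      intro k _ hk
      exact he ⟨k, hk⟩
  have hK := h.closed K (by
    intro k v
    by_cases hki : k = i
    · subst hki; rw [hiK]; exact hz1.2 v
    by_cases hk : a k = 0
    · have : rs K (F k) = 0 := by
        funext e
        simp only [rs]
        split_ifs with he
        · obtain ⟨j, hj, hje⟩ := he
          by_contra h3
          exact nomix e j k hj hje hk hki h3
        · rfl
      rw [this]; exact bd_zero v
    · have : rs K (F k) = F k := by
        funext e
        by_cases h0 : F k e = 0
        · simp [rs, h0]
        · simp only [rs]; rw [if_pos]; exact ⟨k, hk, h0⟩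
      rw [this]; exact (h.mem k).2 v)
  rcases K1 hT K hK with h1 | h1
  · right
    have : rs K (F i) = F i := by
      funext e
      induction e using Sym2.ind with
      | _ p q =>
        by_cases h0 : F i s(p, q) = 0
        · simp [rs, h0]
        · simp only [rs]; rw [if_pos (h1 p q (Z_adj (h.mem i) h0))]
    rw [hiK] at this
    rw [← this] at hF
    simpa using hF.symm
  · left
    rw [← hiK]
    funext e
    induction e using Sym2.ind with
    | _ p q =>
      simp only [rs, Pi.zero_apply]
      split_ifs with he
      · by_contra h0
        exact h1 p q (Z_adj (h.mem i) h0) he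
      · rfl

/-- cyclic enumeration of a cycle chain -/
structure Cyc (c : Ch V) (m : ℕ) (g : ℕ → V) : Prop where
  three : 3 ≤ m
  inj : ∀ i j, i < m → j < m → g i = g j → i = j
  per : ∀ i, g (i + m) = g i
  eq : c = ∑ j ∈ range m, sg (g j) (g (j + 1))

end P3
end T6

open SimpleGraph
namespace T6
section P3b
set_option linter.unusedSectionVars false
set_option linter.unusedSimpArgs false
open scoped Classical
open Finset
variable {V : Type*} [Fintype V]

lemma sg_app (a b : V) (e : Sym2 V) : sg a b e = if e = s(a, b) then 1 else 0 := by
  unfold sg; rw [Pi.single_apply]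

lemma Cyc.mod {c : Ch V} {m : ℕ} {g : ℕ → V} (h : Cyc c m g) (i : ℕ) : g (i % m) = g i := by
  have : ∀ k i, g (i + k * m) = g i := by
    intro k
    induction k with
    | zero => intro i; simp
    | succ k ih => intro i; rw [Nat.succ_mul, ← add_assoc, h.per, ih]
  have h2 := this (i / m) (i % m)
  rw [mul_comm, Nat.mod_add_div] at h2
  exact h2.symm

lemma Cyc.eq_iff {c : Ch V} {m : ℕ} {g : ℕ → V} (h : Cyc c m g) (i j : ℕ) :
    g i = g j ↔ i % m = j % m := by
  have hm : 0 < m := by have := h.three; omega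
  constructor
  · intro hij
    rw [← h.mod i, ← h.mod j] at hij
    exact h.inj _ _ (Nat.mod_lt _ hm) (Nat.mod_lt _ hm) hij
  · intro hij
    rw [← h.mod i, ← h.mod j, hij]

lemma Cyc.ne_succ {c : Ch V} {m : ℕ} {g : ℕ → V} (h : Cyc c m g) (i : ℕ) : g i ≠ g (i + 1) := by
  intro h1
  rw [h.eq_iff] at h1
  have h2 : i ≡ i + 1 [MOD m] := h1
  have h3 : 0 ≡ 1 [MOD m] := Nat.ModEq.add_left_cancel' i h2
  have := h.three
  rw [Nat.ModEq, Nat.zero_mod, Nat.mod_eq_of_lt (by omega)] at h3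
  omega

lemma Cyc.edge_inj {c : Ch V} {m : ℕ} {g : ℕ → V} (h : Cyc c m g) (i j : ℕ) (hi : i < m) (hj : j < m)
    (he : s(g i, g (i + 1)) = s(g j, g (j + 1))) : i = j := by
  rw [Sym2.eq_iff] at he
  rcases he with he | ⟨h1, h2⟩
  · exact h.inj i j hi hj he.1
  · exfalso
    have hm := h.three
    rw [h.eq_iff] at h1 h2
    have h1' : i ≡ j + 1 [MOD m] := h1
    have h2' : i + 1 ≡ j [MOD m] := h2
    have h3 : i + (1 + 1) ≡ i + 0 [MOD m] := (h2'.add_right 1).trans h1'.symm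
    have h4 := Nat.ModEq.add_left_cancel' i h3
    rw [Nat.ModEq, Nat.zero_mod, Nat.mod_eq_of_lt (by omega)] at h4
    omega

lemma Cyc.apply {c : Ch V} {m : ℕ} {g : ℕ → V} (h : Cyc c m g) (e : Sym2 V) :
    c e ≠ 0 ↔ ∃ j < m, e = s(g j, g (j + 1)) := by
  rw [h.eq, Finset.sum_apply]
  constructor
  · intro h1
    obtain ⟨j, hj, hj2⟩ := Finset.exists_ne_zero_of_sum_ne_zero h1
    rw [sg_app] at hj2
    refine ⟨j, by simpa using hj, ?_⟩
    by_contra h3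
    simp [h3] at hj2
  · rintro ⟨j, hj, rfl⟩
    rw [Finset.sum_eq_single j]
    · simp [sg_app]
    · intro k hk hkj
      rw [sg_app, if_neg]
      intro h3
      exact hkj (h.edge_inj k j (by simpa using hk) hj h3.symm)
    · intro h3; simp at h3; omega

lemma Cyc.edge {c : Ch V} {m : ℕ} {g : ℕ → V} (h : Cyc c m g) (j : ℕ) :
    c s(g j, g (j + 1)) ≠ 0 := by
  rw [h.apply]
  have hm : 0 < m := by have := h.three; omega
  refine ⟨j % m, Nat.mod_lt _ hm, ?_⟩
  rw [h.mod, (h.eq_iff (j + 1) (j % m + 1)).2 (by simp)]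

lemma sum_range_per {M : Type*} [AddCommGroup M] (f : ℕ → M) (m : ℕ) (hf : ∀ i, f (i + m) = f i) (k : ℕ) :
    ∑ j ∈ range m, f (j + k) = ∑ j ∈ range m, f j := by
  induction k with
  | zero => simp
  | succ k ih =>
    rw [← ih]
    have h1 := Finset.sum_range_succ (fun j => f (j + k)) m
    have h2 := Finset.sum_range_succ' (fun j => f (j + k)) m
    rw [h1] at h2
    have h3 : f (m + k) = f (0 + k) := by rw [add_comm, hf]; simp
    rw [h3] at h2
    have := add_right_cancel h2
    rw [this]
    apply Finset.sum_congr rfl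
    intro j _; congr 1; omega

lemma Cyc.shift {c : Ch V} {m : ℕ} {g : ℕ → V} (h : Cyc c m g) (k : ℕ) :
    Cyc c m (fun i => g (i + k)) := by
  refine ⟨h.three, ?_, ?_, ?_⟩
  · intro i j hi hj hij
    rw [h.eq_iff] at hij
    have h1 : i + k ≡ j + k [MOD m] := hij
    have h2 := Nat.ModEq.add_right_cancel' k h1
    rwa [Nat.ModEq, Nat.mod_eq_of_lt hi, Nat.mod_eq_of_lt hj] at h2
  · intro i
    show g (i + m + k) = g (i + k)
    rw [← h.per (i + k)]; congr 1; omega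
  · rw [h.eq, ← sum_range_per (fun j => sg (g j) (g (j + 1))) m _ k]
    · apply Finset.sum_congr rfl
      intro j _
      show sg (g (j + k)) (g (j + k + 1)) = sg (g (j + k)) (g (j + 1 + k))
      congr 2; omega
    · intro i
      rw [h.per, ← h.per (i + 1)]; congr 2; omega

/-- arcs -/
lemma bd_arc (g : ℕ → V) (hg : ∀ i, g i ≠ g (i + 1)) (s t : ℕ) (hst : s ≤ t) (v : V) :
    bd (∑ j ∈ Finset.Ico s t, sg (g j) (g (j + 1))) v = dl (g s) v + dl (g t) v := by
  induction t, hst using Nat.le_induction with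
  | base => simp [bd_zero, zz]
  | succ t ht ih =>
    rw [Finset.sum_Ico_succ_top ht, bd_add, ih, bd_sg (hg t)]
    generalize dl (g s) v = a; generalize dl (g t) v = b; generalize dl (g (t+1)) v = d
    revert a b d; decide

lemma Cyc.vert {c : Ch V} {m : ℕ} {g : ℕ → V} (h : Cyc c m g) {a b : V} (hab : c s(a, b) ≠ 0) :
    ∃ j < m, g j = a := by
  obtain ⟨j, hj, he⟩ := (h.apply _).1 hab
  rw [Sym2.eq_iff] at he
  have hm : 0 < m := by omega
  rcases he with ⟨rfl, _⟩ | ⟨rfl, _⟩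
  · exact ⟨j, hj, rfl⟩
  · exact ⟨(j + 1) % m, Nat.mod_lt _ hm, h.mod _⟩

lemma exists_cyc {G : SimpleGraph V} {c : Ch V} (hc : c ∈ Z G) (h0 : c ≠ 0) :
    ∃ (c1 : Ch V) (m : ℕ) (g : ℕ → V), Cyc c1 m g ∧ ∀ e, c1 e ≠ 0 → c e ≠ 0 := by
  let H : SimpleGraph V := 
    { Adj := fun a b => c s(a, b) ≠ 0
      symm := ⟨fun a b h => by rw [Sym2.eq_swap]; exact h⟩
      loopless := ⟨fun a h => h (Z_diag hc a)⟩ }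
  obtain ⟨a, b, hab⟩ : ∃ a b, c s(a, b) ≠ 0 := by
    by_contra hcon
    push Not at hcon
    apply h0; funext e
    induction e using Sym2.ind with
    | _ a b => exact hcon a b
  have hr : (H.deleteEdges {s(a, b)}).Reachable a b := by
    by_contra hn
    let R : Finset V := univ.filter (fun v => (H.deleteEdges {s(a, b)}).Reachable a v)
    have h1 := hand c (Z_diag hc) R
    rw [Finset.sum_eq_zero (fun v _ => hc.2 v)] at h1
    have haR : a ∈ R := by simp [R]
    have hbR : b ∈ Rᶜ := by simp [R, hn]
    have h2 : ∀ v ∈ R, ∀ u ∈ Rᶜ, c s(v, u) ≠ 0 → v = a ∧ u = b := by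
      intro v hv u hu hvu
      simp only [R, Finset.mem_filter, mem_univ, true_and, Finset.mem_compl] at hv hu
      by_cases he : s(v, u) = s(a, b)
      · rw [Sym2.eq_iff] at he
        rcases he with he | ⟨rfl, rfl⟩
        · exact he
        · exact absurd hv hn
      · exfalso
        apply hu
        refine hv.trans (SimpleGraph.Adj.reachable ?_)
        rw [SimpleGraph.deleteEdges_adj]
        exact ⟨hvu, by simpa using he⟩
    rw [Finset.sum_eq_single_of_mem a haR, Finset.sum_eq_single_of_mem b hbR] at h1
    · exact hab h1.symm
    · intro u hu hub
      by_contra h3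
      exact hub (h2 a haR u hu h3).2
    · intro v hv hva
      apply Finset.sum_eq_zero
      intro u hu
      by_contra h3
      exact hva (h2 v hv u hu h3).1
  obtain ⟨u, p, hp, -⟩ := SimpleGraph.adj_and_reachable_delete_edges_iff_exists_cycle.1 ⟨(show H.Adj a b from hab), hr⟩
  have hlen := hp.three_le_length
  have hm : 0 < p.length := by omega
  let g : ℕ → V := fun i => p.getVert (i % p.length)
  have hC : Cyc (∑ j ∈ range p.length, sg (g j) (g (j + 1))) p.length g := by
    refine ⟨hlen, ?_, ?_, rfl⟩
    · intro i j hi hj hij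
      simp only [g, Nat.mod_eq_of_lt hi, Nat.mod_eq_of_lt hj] at hij
      exact hp.getVert_injOn' (by simp; omega) (by simp; omega) hij
    · intro i; simp [g]
  refine ⟨_, p.length, g, hC, ?_⟩
  intro e he
  obtain ⟨j, hj, rfl⟩ := (hC.apply e).1 he
  have h5 := p.adj_getVert_succ hj
  have h6 : g (j + 1) = p.getVert (j + 1) := by
    simp only [g]
    by_cases h7 : j + 1 = p.length
    · rw [h7, Nat.mod_self]; simp
    · rw [Nat.mod_eq_of_lt (by omega)]
  have h7 : g j = p.getVert j := by simp only [g, Nat.mod_eq_of_lt hj]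
  rw [h6, h7]; exact h5

lemma Cyc.bd_zero {c : Ch V} {m : ℕ} {g : ℕ → V} (h : Cyc c m g) (v : V) : bd c v = 0 := by
  rw [h.eq, ← Nat.Ico_zero_eq_range, bd_arc g h.ne_succ 0 m (by omega)]
  have : g m = g 0 := by simpa using h.per 0
  rw [this]; exact zz _

lemma Sys.cyc {G : SimpleGraph V} {ι : Type} [Fintype ι] {F : ι → Ch V} (h : Sys G F)
    {U : Finset V} (hT : TC G U) (i : ι) (hi : F i ≠ 0) : ∃ m g, Cyc (F i) m g := by
  obtain ⟨c1, m, g, hC, hs⟩ := exists_cyc (h.mem i) hi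
  have hz : c1 ∈ Z G := by
    refine ⟨fun a b hab => ?_, hC.bd_zero⟩
    by_contra h1
    exact hab (Z_adj (h.mem i) (hs _ h1))
  rcases h.minimal hT i hz (z2 := F i + c1) (by
      funext e; simp only [Pi.add_apply]
      generalize F i e = x; generalize c1 e = y; revert x y; decide) (by
      intro e
      by_cases h1 : c1 e = 0
      · left; exact h1
      · right
        rw [Pi.add_apply, T6.z1 h1, T6.z1 (hs e h1)]; decide) with h1 | h1
  · exfalso
    have := hC.edge 0
    rw [h1] at this; exact this rfl
  · have : F i = c1 := by
      funext e
      have := congrFun h1 e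
      simp only [Pi.add_apply, Pi.zero_apply] at this
      revert this
      generalize F i e = x; generalize c1 e = y; revert x y; decide
    rw [this]; exact ⟨m, g, hC⟩

end P3b
end T6

open SimpleGraph
namespace T6
section P4
set_option linter.unusedSectionVars false
set_option linter.unusedSimpArgs false
open scoped Classical
open Finset
variable {V : Type*} [Fintype V]

/-- support -/
noncomputable def sp (G : SimpleGraph V) : Finset V := univ.filter (fun a => ∃ b, G.Adj a b)

lemma mem_sp {G : SimpleGraph V} {a : V} : a ∈ sp G ↔ ∃ b, G.Adj a b := by simp [sp]

lemma planar_link {G H : SimpleGraph V} (hp : IsPlanar G) {a b : V} {X : Finset V}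
    (hX : Conn G X) (haX : a ∈ X) (hbX : b ∉ X) (hx : ∃ x ∈ X, G.Adj x b)
    (h1 : ∀ p q, H.Adj p q → G.Adj p q ∨ s(p, q) = s(a, b))
    (h2 : ∀ p q, H.Adj p q → p ∈ X → p = a) : IsPlanar H := by
  refine planar_of_wm ⟨fun v => if v = a then X else if v ∈ X then ∅ else {v}, ?_, ?_, ?_⟩ hp
  · intro p q v hv hw
    by_cases h3 : p = a <;> by_cases h4 : q = a
    · rw [h3, h4]
    · simp only [h3, h4, if_true, if_false] at hv hw
      split_ifs at hw with h5
      · simp at hw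
      · simp at hw; subst hw; exact absurd hv h5
    · simp only [h3, h4, if_true, if_false] at hv hw
      split_ifs at hv with h5
      · simp at hv
      · simp at hv; subst hv; exact absurd hw h5
    · simp only [h3, h4, if_true, if_false] at hv hw
      split_ifs at hv hw <;> simp at hv hw
      rw [← hv, ← hw]
  · intro p
    dsimp only
    split_ifs
    · exact hX
    · intro P hP h3; obtain ⟨x, hx⟩ := h3; exact absurd (hP hx) (by simp)
    · exact conn_singleton G p
  · have mem : ∀ p q, H.Adj p q → p ∈ (if p = a then X else if p ∈ X then ∅ else {p}) := by
      intro p q hpq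
      split_ifs with h3 h4
      · rw [h3]; exact haX
      · exact absurd (h2 p q hpq h4) h3
      · simp
    intro p q hpq
    rcases h1 p q hpq with h3 | h3
    · exact ⟨p, mem p q hpq, q, mem q p hpq.symm, h3⟩
    · obtain ⟨x, hx, hxb⟩ := hx
      have hb : b ≠ a := by rintro rfl; exact hbX haX
      rw [Sym2.eq_iff] at h3
      rcases h3 with ⟨rfl, rfl⟩ | ⟨rfl, rfl⟩
      · exact ⟨x, by simpa using hx, q, by simp [hb, hbX], hxb⟩
      · exact ⟨p, by simp [hb, hbX], x, by simpa using hx, hxb.symm⟩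

lemma link_of_chain {G : SimpleGraph V} {a b : V} {T : Finset V} (c : Ch V)
    (haT : a ∉ T) (hbT : b ∉ T) (hab : a ≠ b)
    (hc : ∀ p q, c s(p, q) ≠ 0 → G.Adj p q ∧ (p ∈ T ∨ p = a ∨ p = b))
    (hb : ∀ v, v ≠ a → v ≠ b → bd c v = 0) (h0 : bd c a ≠ 0) :
    ∃ X : Finset V, X ⊆ insert a T ∧ a ∈ X ∧ Conn G X ∧ ∃ x ∈ X, G.Adj x b := by
  let fam := (insert a T).powerset.filter (fun X => a ∈ X ∧ Conn G X)
  have hne : fam.Nonempty := ⟨{a}, by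
    simp only [fam, Finset.mem_filter, Finset.mem_powerset]
    exact ⟨by simp, by simp, conn_singleton G a⟩⟩
  obtain ⟨X, hX, hmax⟩ := Finset.exists_max_image fam Finset.card hne
  simp only [fam, Finset.mem_filter, Finset.mem_powerset] at hX hmax
  obtain ⟨hXs, haX, hXc⟩ := hX
  refine ⟨X, hXs, haX, hXc, ?_⟩
  by_contra hcon
  push Not at hcon
  have hd : ∀ v, c s(v, v) = 0 := by
    intro v; by_contra h; exact (hc v v h).1.ne rfl
  have h1 := hand c hd X
  have hbX : b ∉ X := by
    intro h; rcases Finset.mem_insert.1 (hXs h) with h | h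
    · exact hab h.symm
    · exact hbT h
  rw [Finset.sum_eq_single_of_mem a haX] at h1
  · apply h0
    rw [h1]
    apply Finset.sum_eq_zero
    intro v hv
    apply Finset.sum_eq_zero
    intro u hu
    rw [Finset.mem_compl] at hu
    by_contra h2
    have h3 := hc v u h2
    have h4 := hc u v (by rw [Sym2.eq_swap]; exact h2)
    rcases h4.2 with h5 | h5 | h5
    · have h6 : Conn G (X ∪ {u}) := hXc.union (conn_singleton G u) ⟨v, hv, u, by simp, Or.inl h3.1⟩
      have h7 := hmax (X ∪ {u}) ⟨by
        intro t ht
        simp only [Finset.mem_union, Finset.mem_singleton] at ht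
        rcases ht with ht | rfl
        · exact hXs ht
        · exact Finset.mem_insert_of_mem h5, by simp [haX], h6⟩
      have : (X ∪ {u}).card = X.card + 1 := by
        rw [Finset.card_union_of_disjoint (by simpa using hu)]; simp
      omega
    · exact hu (h5 ▸ haX)
    · exact hcon v hv (h5 ▸ h3.1)
  · intro v hv hva
    exact hb v hva (by rintro rfl; exact hbX hv)

/-- reduction over a 2-separation -/
lemma mac_sep {G : SimpleGraph V} (hp : IsPlanar G)
    (ih : ∀ H : SimpleGraph V, IsPlanar H → (sp H).card < (sp G).card → Mac H)
    {a b : V} (hab : a ≠ b) {P Q : Finset V} (hP : P.Nonempty) (hQ : Q.Nonempty)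
    (hPs : P ⊆ sp G) (hQs : Q ⊆ sp G) (hPQ : Disjoint P Q)
    (haP : a ∉ P) (hbP : b ∉ P) (haQ : a ∉ Q) (hbQ : b ∉ Q)
    (hcov : ∀ v ∈ sp G, v ∈ P ∨ v ∈ Q ∨ v = a ∨ v = b)
    (hno : ∀ p ∈ P, ∀ q ∈ Q, ¬ G.Adj p q) : Mac G := by
  have hdis : ∀ v, v ∈ P → v ∉ Q := fun v h1 h2 => Finset.disjoint_left.1 hPQ h1 h2
  let K : Set (Sym2 V) := {e | ∃ v ∈ P, v ∈ e}
  have hK : ∀ p q, s(p, q) ∈ K ↔ p ∈ P ∨ q ∈ P := by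
    intro p q
    constructor
    · rintro ⟨v, hv, hv2⟩
      rcases Sym2.mem_iff.1 hv2 with rfl | rfl
      · exact Or.inl hv
      · exact Or.inr hv
    · rintro (h | h)
      · exact ⟨p, h, by simp⟩
      · exact ⟨q, h, by simp⟩
  have card_lt : ∀ H : SimpleGraph V, (∀ p q, H.Adj p q → p ∈ sp G) → (∃ v ∈ sp G, ∀ q, ¬ H.Adj v q) →
      (sp H).card < (sp G).card := by
    rintro H h1 ⟨v, hv, hv2⟩
    apply Finset.card_lt_card
    refine ⟨fun p hp => ?_, fun h => ?_⟩
    · obtain ⟨q, hq⟩ := mem_sp.1 hp; exact h1 p q hq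
    · obtain ⟨q, hq⟩ := mem_sp.1 (h hv); exact hv2 q hq
  -- boundary of restrictions away from a, b
  have hbd : ∀ (c : Ch V), (∀ p q, c s(p, q) ≠ 0 → G.Adj p q ∨ s(p, q) = s(a, b)) → (∀ v, bd c v = 0) →
      ∀ v, v ≠ a → v ≠ b → bd (rs K c) v = 0 := by
    intro c hc1 hc2 v hva hvb
    by_cases hv : v ∈ P
    · rw [← hc2 v]
      unfold bd
      apply Finset.sum_congr rfl
      intro u _
      simp only [rs]; rw [if_pos ((hK v u).2 (Or.inl hv))]
    · apply Finset.sum_eq_zero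
      intro u _
      simp only [rs]
      split_ifs with h1
      · rcases (hK v u).1 h1 with h2 | h2
        · exact absurd h2 hv
        · by_contra h3
          rcases hc1 v u h3 with h4 | h4
          · rcases hcov v (mem_sp.2 ⟨u, h4⟩) with h5 | h5 | h5 | h5
            · exact hv h5
            · exact hno u h2 v h5 h4.symm
            · exact hva h5
            · exact hvb h5
          · rw [Sym2.eq_iff] at h4
            rcases h4 with h4 | h4
            · exact hva h4.1
            · exact hvb h4.1
      · rfl
  have hsame : ∀ (c : Ch V), (∀ p q, c s(p, q) ≠ 0 → G.Adj p q ∨ s(p, q) = s(a, b)) → (∀ v, bd c v = 0) →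
      bd (rs K c) a = bd (rs K c) b := by
    intro c hc1 hc2
    have h1 := hand (rs K c) (by
      intro v
      by_contra h3
      have h4 : c s(v, v) ≠ 0 := by intro h5; simp [rs, h5] at h3
      rcases hc1 v v h4 with h5 | h5
      · exact h5.ne rfl
      · rw [Sym2.eq_iff] at h5
        rcases h5 with h5 | h5
        · exact hab (h5.1 ▸ h5.2)
        · exact hab (h5.1 ▸ h5.2.symm)) univ
    simp only [Finset.compl_univ, Finset.sum_empty, Finset.sum_const_zero] at h1
    have h2 : ∑ v, bd (rs K c) v = bd (rs K c) a + bd (rs K c) b := by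
      rw [← Finset.sum_pair hab]
      symm
      apply Finset.sum_subset (subset_univ _)
      intro v _ hv
      simp at hv
      exact hbd c hc1 hc2 v hv.1 hv.2
    rw [h2] at h1
    exact CharTwo.add_eq_zero.1 h1
  obtain ⟨p0, hp0⟩ := hP
  obtain ⟨q0, hq0⟩ := hQ
  by_cases hcase : ∀ c ∈ Z G, bd (rs K c) a = 0
  · -- easy gluing
    let G1 : SimpleGraph V := 
      { Adj := fun p q => G.Adj p q ∧ (p ∈ P ∨ q ∈ P)
        symm := ⟨fun p q h => ⟨h.1.symm, h.2.symm⟩⟩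
        loopless := ⟨fun p h => h.1.ne rfl⟩ }
    let G2 : SimpleGraph V := 
      { Adj := fun p q => G.Adj p q ∧ ¬ (p ∈ P ∨ q ∈ P)
        symm := ⟨fun p q h => ⟨h.1.symm, fun h2 => h.2 h2.symm⟩⟩
        loopless := ⟨fun p h => h.1.ne rfl⟩ }
    have l1 : G1 ≤ G := fun p q h => h.1
    have l2 : G2 ≤ G := fun p q h => h.1
    refine Mac.glue (G1 := G1) (G2 := G2) (ih G1 (planar_mono l1 hp) (card_lt G1 ?_ ?_))
      (ih G2 (planar_mono l2 hp) (card_lt G2 ?_ ?_)) l1 l2 s(a, b) ?_ ?_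
    · intro p q h; exact mem_sp.2 ⟨q, h.1⟩
    · refine ⟨q0, hQs hq0, ?_⟩
      rintro q ⟨h1, h2 | h2⟩
      · exact hdis _ h2 hq0
      · exact hno q h2 q0 hq0 h1.symm
    · intro p q h; exact mem_sp.2 ⟨q, h.1⟩
    · exact ⟨p0, hPs hp0, fun q h => h.2 (Or.inl hp0)⟩
    · intro p q h1 h2; exact absurd h1.2 h2.2
    · intro c hc
      have hc1 : ∀ p q, c s(p, q) ≠ 0 → G.Adj p q ∨ s(p, q) = s(a, b) := 
        fun p q h => Or.inl (Z_adj hc h)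
      have hr : ∀ v, bd (rs K c) v = 0 := by
        intro v
        by_cases hva : v = a
        · rw [hva]; exact hcase c hc
        · by_cases hvb : v = b
          · rw [hvb, ← hsame c hc1 hc.2]; exact hcase c hc
          · exact hbd c hc1 hc.2 v hva hvb
      refine ⟨rs K c, ⟨?_, hr⟩, c + rs K c, ⟨?_, ?_⟩, ?_⟩
      · intro p q hpq
        simp only [rs]
        split_ifs with h1
        · by_contra h2
          exact hpq ⟨Z_adj hc h2, (hK p q).1 h1⟩
        · rfl
      · intro p q hpq
        simp only [rs, Pi.add_apply]
        split_ifs with h1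
        · exact zz _
        · by_contra h2
          rw [add_zero] at h2
          exact hpq ⟨Z_adj hc h2, fun h3 => h1 ((hK p q).2 h3)⟩
      · intro v; rw [bd_add, hr, hc.2, add_zero]
      · funext e; simp only [Pi.add_apply]
        generalize c e = x; generalize rs K c e = y; revert x y; decide
  · push Not at hcase
    obtain ⟨c, hc, hca⟩ := hcase
    have hc1 : ∀ p q, c s(p, q) ≠ 0 → G.Adj p q ∨ s(p, q) = s(a, b) := 
        fun p q h => Or.inl (Z_adj hc h)
    -- link in P
    obtain ⟨X, hXs, haX, hXc, hxb⟩ := link_of_chain (G := G) (T := P) (rs K c) haP hbP hab (by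
      intro p q h
      have h1 : s(p, q) ∈ K := by by_contra h2; simp [rs, h2] at h
      have h2 : c s(p, q) ≠ 0 := by intro h2; simp [rs, h2] at h
      have h3 := Z_adj hc h2
      refine ⟨h3, ?_⟩
      rcases hcov p (mem_sp.2 ⟨q, h3⟩) with h4 | h4 | h4
      · exact Or.inl h4
      · rcases (hK p q).1 h1 with h5 | h5
        · exact Or.inl h5
        · exact absurd h3.symm (hno q h5 p h4)
      · exact Or.inr h4) (hbd c hc1 hc.2) hca
    obtain ⟨Y, hYs, haY, hYc, hyb⟩ := link_of_chain (G := G) (T := Q) (c + rs K c) haQ hbQ hab (by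
      intro p q h
      have h1 : s(p, q) ∉ K := by intro h2; simp [rs, h2] at h; exact h (zz _)
      have h2 : c s(p, q) ≠ 0 := by intro h2; simp [rs, h2] at h
      have h3 := Z_adj hc h2
      refine ⟨h3, ?_⟩
      rcases hcov p (mem_sp.2 ⟨q, h3⟩) with h4 | h4 | h4
      · exact absurd ((hK p q).2 (Or.inl h4)) h1
      · exact Or.inl h4
      · exact Or.inr h4) (by
      intro v hva hvb
      rw [bd_add, hc.2, hbd c hc1 hc.2 v hva hvb, add_zero]) (by rw [bd_add, hc.2, zero_add]; exact hca)
    have hbX : b ∉ X := by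
      intro h; rcases Finset.mem_insert.1 (hXs h) with h | h
      · exact hab h.symm
      · exact hbP h
    have hbY : b ∉ Y := by
      intro h; rcases Finset.mem_insert.1 (hYs h) with h | h
      · exact hab h.symm
      · exact hbQ h
    have ab_sp : a ∈ sp G ∧ b ∈ sp G := by
      obtain ⟨x, _, hx⟩ := hxb
      refine ⟨?_, mem_sp.2 ⟨x, hx.symm⟩⟩
      by_contra ha
      apply hca
      apply Finset.sum_eq_zero
      intro u _
      by_contra h2
      have h3 : c s(a, u) ≠ 0 := by intro h2'; simp [rs, h2'] at h2
      exact ha (mem_sp.2 ⟨u, Z_adj hc h3⟩)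
    let G1 : SimpleGraph V := 
      { Adj := fun p q => (G.Adj p q ∧ (p ∈ P ∨ q ∈ P)) ∨ s(p, q) = s(a, b)
        symm := ⟨fun p q h => by
          rcases h with h | h
          · exact Or.inl ⟨h.1.symm, h.2.symm⟩
          · exact Or.inr (by rw [Sym2.eq_swap]; exact h)⟩
        loopless := ⟨fun p h => by
          rcases h with h | h
          · exact h.1.ne rfl
          · rw [Sym2.eq_iff] at h
            rcases h with h | h
            · exact hab (h.1 ▸ h.2)
            · exact hab (h.1 ▸ h.2.symm)⟩ }
    let G2 : SimpleGraph V := 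
      { Adj := fun p q => (G.Adj p q ∧ ¬ (p ∈ P ∨ q ∈ P)) ∨ s(p, q) = s(a, b)
        symm := ⟨fun p q h => by
          rcases h with h | h
          · exact Or.inl ⟨h.1.symm, fun h2 => h.2 h2.symm⟩
          · exact Or.inr (by rw [Sym2.eq_swap]; exact h)⟩
        loopless := ⟨fun p h => by
          rcases h with h | h
          · exact h.1.ne rfl
          · rw [Sym2.eq_iff] at h
            rcases h with h | h
            · exact hab (h.1 ▸ h.2)
            · exact hab (h.1 ▸ h.2.symm)⟩ }
    let GG : SimpleGraph V := G1 ⊔ G2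
    have hGG : ∀ p q, GG.Adj p q ↔ G.Adj p q ∨ s(p, q) = s(a, b) := by
      intro p q
      show ((G.Adj p q ∧ (p ∈ P ∨ q ∈ P)) ∨ s(p, q) = s(a, b)) ∨ 
        ((G.Adj p q ∧ ¬ (p ∈ P ∨ q ∈ P)) ∨ s(p, q) = s(a, b)) ↔ _
      tauto
    have hsp : ∀ p q, s(p, q) = s(a, b) → p = a ∨ p = b := by
      intro p q h
      rw [Sym2.eq_iff] at h
      tauto
    have hmac : Mac GG := by
      refine Mac.glue (G1 := G1) (G2 := G2) (ih G1 ?_ (card_lt G1 ?_ ?_))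
        (ih G2 ?_ (card_lt G2 ?_ ?_)) le_sup_left le_sup_right s(a, b) ?_ ?_
      · refine planar_link hp hYc haY hbY hyb ?_ ?_
        · rintro p q (h | h)
          · exact Or.inl h.1
          · exact Or.inr h
        · rintro p q hpq hpY
          rcases Finset.mem_insert.1 (hYs hpY) with h | h
          · exact h
          · exfalso
            rcases hpq with ⟨h1, h2 | h2⟩ | h1
            · exact hdis _ h2 h
            · exact hno q h2 p h h1.symm
            · rcases hsp p q h1 with rfl | rfl
              · exact haQ h
              · exact hbQ h
      · rintro p q (h | h)
        · exact mem_sp.2 ⟨q, h.1⟩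
        · rcases hsp p q h with rfl | rfl
          · exact ab_sp.1
          · exact ab_sp.2
      · refine ⟨q0, hQs hq0, ?_⟩
        rintro q (⟨h1, h2 | h2⟩ | h)
        · exact hdis _ h2 hq0
        · exact hno q h2 q0 hq0 h1.symm
        · rcases hsp _ q h with rfl | rfl
          · exact haQ hq0
          · exact hbQ hq0
      · refine planar_link hp hXc haX hbX hxb ?_ ?_
        · rintro p q (h | h)
          · exact Or.inl h.1
          · exact Or.inr h
        · rintro p q hpq hpX
          rcases Finset.mem_insert.1 (hXs hpX) with h | h
          · exact h
          · exfalso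
            rcases hpq with ⟨h1, h2⟩ | h1
            · exact h2 (Or.inl h)
            · rcases hsp p q h1 with rfl | rfl
              · exact haP h
              · exact hbP h
      · rintro p q (h | h)
        · exact mem_sp.2 ⟨q, h.1⟩
        · rcases hsp p q h with rfl | rfl
          · exact ab_sp.1
          · exact ab_sp.2
      · refine ⟨p0, hPs hp0, ?_⟩
        rintro q (⟨h1, h2⟩ | h)
        · exact h2 (Or.inl hp0)
        · rcases hsp _ q h with rfl | rfl
          · exact haP hp0
          · exact hbP hp0
      · rintro p q (h1 | h1) (h2 | h2)
        · exact absurd h1.2 h2.2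
        · exact h2
        · exact h1
        · exact h1
      · intro d hd
        have hd1 : ∀ p q, d s(p, q) ≠ 0 → G.Adj p q ∨ s(p, q) = s(a, b) := 
          fun p q h => (hGG p q).1 (Z_adj hd h)
        have e1 : ∀ v, bd (rs K d + bd (rs K d) a • sg a b) v = 0 := by
          intro v
          rw [bd_add, bd_smul, bd_sg hab]
          by_cases hva : v = a
          · subst hva; simp [dl, hab]; exact zz _
          · by_cases hvb : v = b
            · subst hvb; simp [dl, hva]; rw [hsame d hd1 hd.2]; exact zz _
            · simp [dl, hva, hvb, hbd d hd1 hd.2 v hva hvb]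
        have e2 : ∀ p q, s(p, q) ≠ s(a, b) → sg a b s(p, q) = 0 := by
          intro p q h; rw [sg_app, if_neg h]
        refine ⟨rs K d + bd (rs K d) a • sg a b, ⟨?_, e1⟩, d + (rs K d + bd (rs K d) a • sg a b), ⟨?_, ?_⟩, ?_⟩
        · intro p q hpq
          have h0 : s(p, q) ≠ s(a, b) := fun h => hpq (Or.inr h)
          simp only [Pi.add_apply, Pi.smul_apply, e2 p q h0, smul_zero, add_zero]
          simp only [rs]
          split_ifs with h1
          · by_contra h2
            rcases hd1 p q h2 with h3 | h3
            · exact hpq (Or.inl ⟨h3, (hK p q).1 h1⟩)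
            · exact h0 h3
          · rfl
        · intro p q hpq
          have h0 : s(p, q) ≠ s(a, b) := fun h => hpq (Or.inr h)
          simp only [Pi.add_apply, Pi.smul_apply, e2 p q h0, smul_zero, add_zero]
          simp only [rs]
          split_ifs with h1
          · exact zz _
          · by_contra h2
            rw [add_zero] at h2
            rcases hd1 p q h2 with h3 | h3
            · exact hpq (Or.inl ⟨h3, fun h4 => h1 ((hK p q).2 h4)⟩)
            · exact h0 h3
        · intro v; rw [bd_add, e1, hd.2, add_zero]
        · funext e; simp only [Pi.add_apply]
          generalize d e = x; generalize rs K d e = y; generalize (bd (rs K d) a • sg a b) e = w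
          revert x y w; decide
    by_cases hGab : G.Adj a b
    · have : GG = G := by
        ext p q
        rw [hGG]
        constructor
        · rintro (h | h)
          · exact h
          · rw [Sym2.eq_iff] at h
            rcases h with ⟨rfl, rfl⟩ | ⟨rfl, rfl⟩
            · exact hGab
            · exact hGab.symm
        · exact Or.inl
      rw [← this]; exact hmac
    · refine hmac.delete a b ?_
      intro p q
      rw [hGG]
      constructor
      · intro h
        refine ⟨Or.inl h, ?_⟩
        intro h2
        rw [Sym2.eq_iff] at h2
        rcases h2 with ⟨rfl, rfl⟩ | ⟨rfl, rfl⟩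
        · exact hGab h
        · exact hGab h.symm
      · rintro ⟨h | h, h2⟩
        · exact h
        · exact absurd h h2

end P4
end T6

open SimpleGraph
namespace T6
section P5
set_option linter.unusedSectionVars false
set_option linter.unusedSimpArgs false
open scoped Classical
open Finset
variable {V : Type*} [Fintype V]

lemma za (a b c : ZMod 2) : a = b + c + (a + c + b) := by revert a b c; decide

/-- family with a distinguished member `T` and unused edges `N` -/
def St (H : SimpleGraph V) (T : Ch V) (N : Set (Sym2 V)) : Prop :=
  ∃ (ι : Type) (_ : Fintype ι) (F : ι → Ch V), (∀ i, F i ∈ Z H) ∧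
    (∀ c ∈ Z H, ∃ a : ι → ZMod 2, c = ∑ i, a i • F i) ∧
    (∀ e, (univ.filter (fun i => F i e ≠ 0)).card ≤ 2) ∧ (∃ i, F i = T) ∧
    ∀ i, ∀ e ∈ N, F i e = 0

lemma St.mac {H : SimpleGraph V} {T : Ch V} {N : Set (Sym2 V)} (h : St H T N) : Mac H := by
  obtain ⟨ι, i1, F, h1, h2, h3, _⟩ := h
  exact ⟨ι, i1, F, h1, h2, h3⟩

lemma St.pendant {H H' : SimpleGraph V} {T : Ch V} {N : Set (Sym2 V)} (h : St H T N) {a b : V}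
    (hab : a ≠ b) (hb : ∀ v, ¬ H.Adj b v)
    (hH' : ∀ p q, H'.Adj p q ↔ H.Adj p q ∨ s(p, q) = s(a, b)) : St H' T (insert s(a, b) N) := by
  obtain ⟨ι, i1, F, h1, h2, h3, h4, h5⟩ := h
  have hle : H ≤ H' := fun p q h => (hH' p q).2 (Or.inl h)
  refine ⟨ι, i1, F, fun i => Z_mono hle (h1 i), ?_, h3, h4, ?_⟩
  · intro c hc
    apply h2
    refine ⟨?_, hc.2⟩
    have hca : c s(a, b) = 0 := by
      have h6 := hc.2 b
      unfold bd at h6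
      rw [Finset.sum_eq_single a] at h6
      · rw [Sym2.eq_swap]; exact h6
      · intro u _ hu
        by_contra h7
        rcases (hH' b u).1 (Z_adj hc h7) with h8 | h8
        · exact hb u h8
        · rw [Sym2.eq_iff] at h8
          rcases h8 with h8 | h8
          · exact hab h8.1.symm
          · exact hu h8.2
      · intro h; exact absurd (mem_univ _) h
    intro p q hpq
    by_contra h7
    rcases (hH' p q).1 (Z_adj hc h7) with h8 | h8
    · exact hpq h8
    · rw [h8] at h7; exact h7 hca
  · rintro i e (rfl | he)
    · by_contra h7
      exact hb a (Z_adj (h1 i) h7).symm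
    · exact h5 i e he

lemma St.addEdge {H H' : SimpleGraph V} {T : Ch V} {N : Set (Sym2 V)} (h : St H T N) {a b : V}
    (hab : a ≠ b) (hnab : ¬ H.Adj a b)
    (hH' : ∀ p q, H'.Adj p q ↔ H.Adj p q ∨ s(p, q) = s(a, b)) (P : Ch V)
    (hP : ∀ p q, P s(p, q) ≠ 0 → H.Adj p q) (hbd : ∀ v, bd P v = dl a v + dl b v)
    (hPT : ∀ e, P e ≠ 0 → T e ≠ 0 ∨ e ∈ N) : St H' (T + P + sg a b) ∅ := by
  obtain ⟨ι, i1, F, h1, h2, h3, ⟨i, hi⟩, h5⟩ := h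
  have hle : H ≤ H' := fun p q h => (hH' p q).2 (Or.inl h)
  have hQ : P + sg a b ∈ Z H' := by
    refine ⟨fun p q hpq => ?_, fun v => ?_⟩
    · rw [hH'] at hpq
      push Not at hpq
      rw [Pi.add_apply, sg_app, if_neg hpq.2, add_zero]
      by_contra h6
      exact hpq.1 (hP p q h6)
    · rw [bd_add, hbd, bd_sg hab]
      exact zz _
  have hFab : ∀ j, F j s(a, b) = 0 := fun j => (h1 j).1 a b hnab
  have hPab : P s(a, b) = 0 := by by_contra h6; exact hnab (hP a b h6)
  refine ⟨Option ι, inferInstance, fun o => o.elim (P + sg a b) 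
    (fun j => if j = i then F i + (P + sg a b) else F j), ?_, ?_, ?_, ?_, by simp⟩
  · rintro (_ | j)
    · exact hQ
    · show (if j = i then F i + (P + sg a b) else F j) ∈ Z H'
      split_ifs
      · exact Submodule.add_mem _ (Z_mono hle (h1 i)) hQ
      · exact Z_mono hle (h1 j)
  · intro c hc
    have hc' : c + c s(a, b) • (P + sg a b) ∈ Z H := by
      refine ⟨?_, fun v => ?_⟩
      · intro p q hpq
        by_cases he : s(p, q) = s(a, b)
        · rw [he]; simp [hPab, sg_app, zz]
        · have h6 : ¬ H'.Adj p q := by rw [hH']; tauto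
          have h7 : P s(p, q) = 0 := by by_contra h8; exact hpq (hP p q h8)
          simp [hc.1 p q h6, h7, sg_app, he]
      · rw [bd_add, bd_smul, hc.2, hQ.2]; simp
    obtain ⟨x, hx⟩ := h2 _ hc'
    refine ⟨fun o => o.elim (x i + c s(a, b)) x, ?_⟩
    rw [Fintype.sum_option]
    simp only [Option.elim]
    have e1 : ∑ j, x j • (if j = i then F i + (P + sg a b) else F j) = 
        ∑ j, x j • F j + x i • (P + sg a b) := by
      have : ∀ j, x j • (if j = i then F i + (P + sg a b) else F j) = 
        x j • F j + (if j = i then x i • (P + sg a b) else 0) := by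
        intro j
        split_ifs with hj
        · subst hj; rw [smul_add]
        · simp
      rw [Finset.sum_congr rfl (fun j _ => this j), Finset.sum_add_distrib]
      simp
    rw [e1, ← hx, add_smul]
    funext e
    simp only [Pi.add_apply]
    exact za _ _ _
  · intro e
    have cnt : (univ.filter (fun o : Option ι => (o.elim (P + sg a b) 
      (fun j => if j = i then F i + (P + sg a b) else F j) : Ch V) e ≠ 0)).card = 
      (if (P + sg a b) e ≠ 0 then 1 else 0) + 
      (univ.filter (fun j : ι => (if j = i then F i + (P + sg a b) else F j) e ≠ 0)).card := by
      simp only [Finset.card_filter]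
      rw [Fintype.sum_option]
      congr!
    rw [cnt]
    by_cases hQe : (P + sg a b) e = 0
    · rw [if_neg (by simpa using hQe), zero_add]
      refine le_trans (Finset.card_le_card ?_) (h3 e)
      intro j hj
      simp only [Finset.mem_filter, mem_univ, true_and] at hj ⊢
      split_ifs at hj with h6
      · subst h6; rw [Pi.add_apply, hQe, add_zero] at hj; exact hj
      · exact hj
    · rw [if_pos hQe]
      by_cases hFe : F i e = 0
      · -- no face contains e
        have hno : ∀ j, F j e = 0 := by
          by_cases he : e = s(a, b)
          · rw [he]; exact hFab
          · have h6 : P e ≠ 0 := by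
              rw [Pi.add_apply, sg_app, if_neg he, add_zero] at hQe; exact hQe
            rcases hPT e h6 with h7 | h7
            · rw [← hi] at h7; exact absurd hFe h7
            · exact fun j => h5 j e h7
        have : (univ.filter (fun j : ι => (if j = i then F i + (P + sg a b) else F j) e ≠ 0)) ⊆ {i} := by
          intro j hj
          simp only [Finset.mem_filter, mem_univ, true_and] at hj
          split_ifs at hj with h6
          · simp [h6]
          · exact absurd (hno j) hj
        have := Finset.card_le_card this
        simp at this ⊢
        omega
      · have : (univ.filter (fun j : ι => (if j = i then F i + (P + sg a b) else F j) e ≠ 0)) ⊆ 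
            (univ.filter (fun j : ι => F j e ≠ 0)).erase i := by
          intro j hj
          simp only [Finset.mem_filter, mem_univ, true_and, Finset.mem_erase] at hj ⊢
          split_ifs at hj with h6
          · exfalso; apply hj
            rw [Pi.add_apply, z1 hFe, z1 hQe]; decide
          · exact ⟨h6, hj⟩
        have h6 := Finset.card_le_card this
        rw [Finset.card_erase_of_mem (by simp [hFe])] at h6
        have h7 := h3 e
        have h8 : 0 < (univ.filter (fun j : ι => F j e ≠ 0)).card := Finset.card_pos.2 ⟨i, by simp [hFe]⟩
        omega
  · exact ⟨some i, by simp [hi, add_assoc]⟩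

/-- state of the fan construction: hub `h`, current position `s` -/
def Fan (g : ℕ → V) (m : ℕ) (H : SimpleGraph V) (h : V) (s : ℕ) : Prop :=
  ∃ T N R, St H T N ∧ (∀ v, bd R v = dl h v + dl (g s) v) ∧ (∀ p q, R s(p, q) ≠ 0 → H.Adj p q) ∧
    (∀ e, R e ≠ 0 → T e ≠ 0 ∨ e ∈ N) ∧
    ∀ j, s ≤ j → j < m → R s(g j, g (j + 1)) = 0 ∧ T s(g j, g (j + 1)) ≠ 0

lemma Fan.step {c : Ch V} {g : ℕ → V} {m : ℕ} (hC : Cyc c m g) {H H' : SimpleGraph V} {h : V} {s : ℕ}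
    (hF : Fan g m H h s) (hg : ∀ j, H.Adj (g j) (g (j + 1))) (hh : ∀ j, h ≠ g j) {t : ℕ} (hst : s ≤ t)
    (htm : t ≤ m) (hn : ¬ H.Adj h (g t))
    (hH' : ∀ p q, H'.Adj p q ↔ H.Adj p q ∨ s(p, q) = s(h, g t)) : Fan g m H' h t := by
  obtain ⟨T, N, R, hS, hb, hR, hRT, hj⟩ := hF
  set A : Ch V := ∑ j ∈ Finset.Ico s t, sg (g j) (g (j + 1)) with hA
  have hAe : ∀ e, A e ≠ 0 → ∃ j, s ≤ j ∧ j < t ∧ e = s(g j, g (j + 1)) := by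
    intro e he
    rw [hA, Finset.sum_apply] at he
    obtain ⟨j, hj, hj2⟩ := Finset.exists_ne_zero_of_sum_ne_zero he
    rw [Finset.mem_Ico] at hj
    refine ⟨j, hj.1, hj.2, ?_⟩
    by_contra h3
    simp [sg_app, h3] at hj2
  have key := hS.addEdge (H' := H') (hh t) hn hH' (R + A) (by
      intro p q hpq
      by_cases h1 : R s(p, q) = 0
      · have h2 : A s(p, q) ≠ 0 := by intro h3; apply hpq; simp [h1, h3]
        obtain ⟨j, _, _, h3⟩ := hAe _ h2
        rw [Sym2.eq_iff] at h3
        rcases h3 with ⟨rfl, rfl⟩ | ⟨rfl, rfl⟩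
        · exact hg j
        · exact (hg j).symm
      · exact hR p q h1) (by
      intro v
      rw [bd_add, hb, hA, bd_arc g hC.ne_succ s t hst]
      generalize dl (g s) v = x; generalize dl h v = y; generalize dl (g t) v = z
      revert x y z; decide) (by
      intro e he
      by_cases h1 : R e = 0
      · have h2 : A e ≠ 0 := by intro h3; apply he; simp [h1, h3]
        obtain ⟨j, h4, h5, rfl⟩ := hAe _ h2
        exact Or.inl (hj j h4 (by omega)).2
      · exact hRT e h1)
  have hne : ∀ j, s(g j, g (j + 1)) ≠ s(h, g t) := by
    intro j h1
    rw [Sym2.eq_iff] at h1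
    rcases h1 with h1 | h1
    · exact hh _ h1.1.symm
    · exact hh _ h1.2.symm
  refine ⟨_, _, sg h (g t), key, fun v => bd_sg (hh t) v, ?_, ?_, ?_⟩
  · intro p q hpq
    rw [hH']
    right
    by_contra h1
    simp [sg_app, h1] at hpq
  · intro e he
    left
    have h1 : e = s(h, g t) := by by_contra h1; simp [sg_app, h1] at he
    obtain ⟨_, _, F, k1, _, _, ⟨i, rfl⟩, _⟩ := hS
    have h2 : F i e = 0 := by rw [h1]; exact (k1 i).1 _ _ hn
    have h3 : R e = 0 := by by_contra h3; rw [h1] at h3; exact hn (hR _ _ h3)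
    have h4 : A e = 0 := by
      by_contra h4
      obtain ⟨j, _, _, h5⟩ := hAe _ h4
      exact hne j (h5.symm.trans h1)
    rw [Pi.add_apply, Pi.add_apply, Pi.add_apply, h2, h3, h4, sg_app, if_pos h1]
    simp
  · intro j htj hjm
    refine ⟨by rw [sg_app, if_neg (hne j)], ?_⟩
    have h1 := hj j (by omega) hjm
    have h4 : A s(g j, g (j + 1)) = 0 := by
      by_contra h4
      obtain ⟨j', h5, h6, h7⟩ := hAe _ h4
      have := hC.edge_inj j j' hjm (by omega) h7
      omega
    simp [h1.1, h4, sg_app, hne j]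
    exact h1.2

lemma Fan.run {c : Ch V} {g : ℕ → V} {m : ℕ} (hC : Cyc c m g) {H : SimpleGraph V} {h : V} {s : ℕ}
    (hF : Fan g m H h s) (hg : ∀ j, H.Adj (g j) (g (j + 1))) (hh : ∀ j, h ≠ g j) (A : ℕ → Prop)
    {lo : ℕ} (hlo : s ≤ lo) : ∀ u, lo ≤ u → u ≤ m + 1 → 
      (∀ i j, lo ≤ i → i < u → lo ≤ j → j < u → g i = g j → i = j) →
      (∀ j, lo ≤ j → j < u → ¬ H.Adj h (g j)) →
      ∃ H' : SimpleGraph V, (∀ p q, H'.Adj p q ↔ H.Adj p q ∨ ∃ j, lo ≤ j ∧ j < u ∧ A j ∧ s(p, q) = s(h, g j)) ∧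
        ∃ s', s' ≤ max s (u - 1) ∧ Fan g m H' h s' := by
  intro u hu
  induction u, hu using Nat.le_induction with
  | base =>
    intro _ _ _
    refine ⟨H, ?_, s, le_max_left _ _, hF⟩
    intro p q
    constructor
    · exact Or.inl
    · rintro (h1 | ⟨j, h1, h2, _⟩)
      · exact h1
      · omega
  | succ u hu ih =>
    intro hum hinj hnH
    obtain ⟨H1, hH1, s1, hs1, hF1⟩ := ih (by omega) (fun i j a b c d => hinj i j a (by omega) c (by omega))
      (fun j a b => hnH j a (by omega))
    by_cases hA : A u
    · let H2 : SimpleGraph V := 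
        { Adj := fun p q => H1.Adj p q ∨ s(p, q) = s(h, g u)
          symm := ⟨fun p q h => by
            rcases h with h | h
            · exact Or.inl h.symm
            · exact Or.inr (by rw [Sym2.eq_swap]; exact h)⟩
          loopless := ⟨fun p h1 => by
            rcases h1 with h1 | h1
            · exact h1.ne rfl
            · rw [Sym2.eq_iff] at h1
              rcases h1 with h1 | h1
              · exact hh u (h1.1 ▸ h1.2)
              · exact hh u (h1.1 ▸ h1.2.symm)⟩ }
      refine ⟨H2, ?_, u, by omega, ?_⟩
      · intro p q
        show H1.Adj p q ∨ s(p, q) = s(h, g u) ↔ _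
        rw [hH1]
        constructor
        · rintro ((h1 | ⟨j, h1, h2, h3, h4⟩) | h1)
          · exact Or.inl h1
          · exact Or.inr ⟨j, h1, by omega, h3, h4⟩
          · exact Or.inr ⟨u, hu, by omega, hA, h1⟩
        · rintro (h1 | ⟨j, h1, h2, h3, h4⟩)
          · exact Or.inl (Or.inl h1)
          · by_cases hj : j = u
            · subst hj; exact Or.inr h4
            · exact Or.inl (Or.inr ⟨j, h1, by omega, h3, h4⟩)
      · refine hF1.step hC (fun j => (hH1 _ _).2 (Or.inl (hg j))) hh ?_ (by omega) ?_ (fun p q => Iff.rfl)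
        · have : max s (u - 1) ≤ u := by omega
          omega
        · rw [hH1]
          rintro (h1 | ⟨j, h1, h2, h3, h4⟩)
          · exact hnH u hu (by omega) h1
          · rw [Sym2.eq_iff] at h4
            rcases h4 with h4 | h4
            · have := hinj u j hu (by omega) h1 (by omega) h4.2
              omega
            · exact hh _ h4.1
    · refine ⟨H1, ?_, s1, by omega, hF1⟩
      intro p q
      rw [hH1]
      constructor
      · rintro (h1 | ⟨j, h1, h2, h3, h4⟩)
        · exact Or.inl h1
        · exact Or.inr ⟨j, h1, by omega, h3, h4⟩
      · rintro (h1 | ⟨j, h1, h2, h3, h4⟩)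
        · exact Or.inl h1
        · by_cases hj : j = u
          · subst hj; exact absurd h3 hA
          · exact Or.inr ⟨j, h1, by omega, h3, h4⟩

lemma Fan.mac {g : ℕ → V} {m : ℕ} {H : SimpleGraph V} {h : V} {s : ℕ} (hF : Fan g m H h s) : Mac H := by
  obtain ⟨T, N, R, hS, _⟩ := hF
  exact hS.mac

/-- the planar drawing when the attachments do not cross -/
lemma fan_mac {c : Ch V} {g : ℕ → V} {m q : ℕ} (hC : Cyc c m g) {D G : SimpleGraph V} {x y : V}
    (hxy : G.Adj x y) (hSt : St D c ∅)
    (hD : ∀ p q, D.Adj p q ↔ G.Adj p q ∧ p ≠ x ∧ p ≠ y ∧ q ≠ x ∧ q ≠ y)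
    (hq : 0 < q) (hqm : q < m)
    (hx : ∀ u, G.Adj x u → u ≠ y → ∃ j, q ≤ j ∧ j ≤ m ∧ u = g j)
    (hy : ∀ u, G.Adj y u → u ≠ x → ∃ j, j ≤ q ∧ u = g j)
    (hy1 : ∃ u, G.Adj y u ∧ u ≠ x) : Mac G := by
  have hgD : ∀ j, D.Adj (g j) (g (j + 1)) := by
    intro j
    obtain ⟨_, _, F, k1, _, _, ⟨i, hi⟩, _⟩ := hSt
    exact Z_adj (k1 i) (by rw [hi]; exact hC.edge j)
  have hgx : ∀ j, x ≠ g j := fun j => (((hD _ _).1 (hgD j)).2.1).symm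
  have hgy : ∀ j, y ≠ g j := fun j => (((hD _ _).1 (hgD j)).2.2.1).symm
  have hyD : ∀ v, ¬ D.Adj y v := fun v h => ((hD _ _).1 h).2.2.1 rfl
  have hxD : ∀ v, ¬ D.Adj x v := fun v h => ((hD _ _).1 h).2.1 rfl
  have hex : ∃ j, j ≤ q ∧ G.Adj y (g j) := by
    obtain ⟨u, hu, hux⟩ := hy1
    obtain ⟨j, hj, rfl⟩ := hy u hu hux
    exact ⟨j, hj, hu⟩
  obtain ⟨hbq, hbG⟩ := Nat.find_spec hex
  set b := Nat.find hex with hb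
  have hmin : ∀ j, j ≤ q → G.Adj y (g j) → b ≤ j := fun j h1 h2 => Nat.find_min' hex ⟨h1, h2⟩
  let H1 : SimpleGraph V := 
        { Adj := fun p q => D.Adj p q ∨ s(p, q) = s(g b, y)
          symm := ⟨fun p q h => by
            rcases h with h | h
            · exact Or.inl h.symm
            · exact Or.inr (by rw [Sym2.eq_swap]; exact h)⟩
          loopless := ⟨fun p h1 => by
            rcases h1 with h1 | h1
            · exact h1.ne rfl
            · rw [Sym2.eq_iff] at h1
              rcases h1 with h1 | h1
              · exact hgy b (h1.2 ▸ h1.1)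
              · exact hgy b (h1.2.symm ▸ h1.1.symm)⟩ }
  have hH1 : ∀ p q, H1.Adj p q ↔ D.Adj p q ∨ s(p, q) = s(g b, y) := fun p q => Iff.rfl
  have st1 := hSt.pendant (H' := H1) (hgy b).symm hyD hH1
  have fan1 : Fan g m H1 y b := by
    refine ⟨_, _, sg y (g b), st1, fun v => bd_sg (hgy b) v, ?_, ?_, ?_⟩
    · intro p q hpq
      right
      rw [Sym2.eq_swap (a := g b)]
      by_contra h1
      simp [sg_app, h1] at hpq
    · intro e he
      right; left
      rw [Sym2.eq_swap (a := g b)]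
      by_contra h1
      simp [sg_app, h1] at he
    · intro j hj hjm
      refine ⟨?_, hC.edge j⟩
      rw [sg_app, if_neg]
      intro h1
      rw [Sym2.eq_iff] at h1
      rcases h1 with h1 | h1
      · exact hgy _ h1.1.symm
      · exact hgy _ h1.2.symm
  obtain ⟨H2, hH2, s2, hs2, fan2⟩ := fan1.run hC (fun j => Or.inl (hgD j)) hgy (fun j => G.Adj y (g j))
    (lo := b + 1) (by omega) (q + 1) (by omega) (by omega) (by
      intro i j hi hi2 hj hj2 hij
      exact hC.inj i j (by omega) (by omega) hij) (by
      rintro j hj1 hj2 (h1 | h1)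
      · exact hyD _ h1
      · rw [Sym2.eq_iff] at h1
        rcases h1 with h1 | h1
        · exact hgy _ h1.1
        · have := hC.inj j b (by omega) (by omega) h1.2
          omega)
  have hs2q : s2 ≤ q := by omega
  have hxH2 : ∀ v, ¬ H2.Adj x v := by
    intro v hv
    rcases (hH2 x v).1 hv with (h1 | h1) | ⟨j, _, _, _, h1⟩
    · exact hxD _ h1
    · rw [Sym2.eq_iff] at h1
      rcases h1 with h1 | h1
      · exact hgx _ h1.1
      · exact hxy.ne h1.1
    · rw [Sym2.eq_iff] at h1
      rcases h1 with h1 | h1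
      · exact hxy.ne h1.1
      · exact hgx _ h1.1
  let H3 : SimpleGraph V := 
        { Adj := fun p q => H2.Adj p q ∨ s(p, q) = s(y, x)
          symm := ⟨fun p q h => by
            rcases h with h | h
            · exact Or.inl h.symm
            · exact Or.inr (by rw [Sym2.eq_swap]; exact h)⟩
          loopless := ⟨fun p h1 => by
            rcases h1 with h1 | h1
            · exact h1.ne rfl
            · rw [Sym2.eq_iff] at h1
              rcases h1 with h1 | h1
              · exact hxy.ne (h1.2 ▸ h1.1)
              · exact hxy.ne (h1.2.symm ▸ h1.1.symm)⟩ }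
  have hH3 : ∀ p q, H3.Adj p q ↔ H2.Adj p q ∨ s(p, q) = s(y, x) := fun p q => Iff.rfl
  have fan3 : Fan g m H3 x s2 := by
    obtain ⟨T, N, R, hS, hb, hR, hRT, hj⟩ := fan2
    refine ⟨T, _, R + sg x y, hS.pendant (H' := H3) hxy.ne' hxH2 hH3, ?_, ?_, ?_, ?_⟩
    · intro v
      rw [bd_add, hb, bd_sg hxy.ne]
      generalize dl x v = a1; generalize dl y v = a2; generalize dl (g s2) v = a3
      revert a1 a2 a3; decide
    · intro p q hpq
      by_cases h1 : R s(p, q) = 0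
      · right
        rw [Pi.add_apply, h1, zero_add, sg_app] at hpq
        rw [Sym2.eq_swap (a := y)]
        by_contra h2; simp [h2] at hpq
      · exact Or.inl (hR p q h1)
    · intro e he
      by_cases h1 : R e = 0
      · right; left
        rw [Pi.add_apply, h1, zero_add, sg_app] at he
        rw [Sym2.eq_swap (a := y)]
        by_contra h2; simp [h2] at he
      · rcases hRT e h1 with h2 | h2
        · exact Or.inl h2
        · exact Or.inr (Or.inr h2)
    · intro j h1 h2
      refine ⟨?_, (hj j h1 h2).2⟩
      rw [Pi.add_apply, (hj j h1 h2).1, zero_add, sg_app, if_neg]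
      intro h1
      rw [Sym2.eq_iff] at h1
      rcases h1 with h1 | h1
      · exact hgx _ h1.1.symm
      · exact hgx _ h1.2.symm
  have hm0 : g m = g 0 := by simpa using hC.per 0
  obtain ⟨H4, hH4, s4, hs4, fan4⟩ := fan3.run hC (fun j => Or.inl ((hH2 _ _).2 (Or.inl (Or.inl (hgD j))))) hgx 
    (fun j => G.Adj x (g j))
    (lo := q) hs2q (m + 1) (by omega) (by omega) (by
      intro i j hi hi2 hj hj2 hij
      by_cases h1 : i = m <;> by_cases h2 : j = m
      · omega
      · subst h1; rw [hm0] at hij; have := hC.inj 0 j (by omega) (by omega) hij; omega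
      · subst h2; rw [hm0] at hij; have := hC.inj i 0 (by omega) (by omega) hij; omega
      · exact hC.inj i j (by omega) (by omega) hij) (by
      rintro j hj1 hj2 (h1 | h1)
      · exact hxH2 _ h1
      · rw [Sym2.eq_iff] at h1
        rcases h1 with h1 | h1
        · exact hxy.ne h1.1
        · exact hgy _ h1.2.symm)
  have : H4 = G := by
    ext p r
    rw [hH4, hH3, hH2, hH1, hD]
    constructor
    · rintro ((((h1 | h1) | ⟨j, _, _, h2, h1⟩) | h1) | ⟨j, _, _, h2, h1⟩)
      · exact h1.1
      · rw [Sym2.eq_iff] at h1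
        rcases h1 with ⟨rfl, rfl⟩ | ⟨rfl, rfl⟩
        · exact hbG.symm
        · exact hbG
      · rw [Sym2.eq_iff] at h1
        rcases h1 with ⟨rfl, rfl⟩ | ⟨rfl, rfl⟩
        · exact h2
        · exact h2.symm
      · rw [Sym2.eq_iff] at h1
        rcases h1 with ⟨rfl, rfl⟩ | ⟨rfl, rfl⟩
        · exact hxy.symm
        · exact hxy
      · rw [Sym2.eq_iff] at h1
        rcases h1 with ⟨rfl, rfl⟩ | ⟨rfl, rfl⟩
        · exact h2
        · exact h2.symm
    · have main : ∀ p r, G.Adj p r → (p = x ∨ p = y) → 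
        (((G.Adj p r ∧ p ≠ x ∧ p ≠ y ∧ r ≠ x ∧ r ≠ y ∨ s(p, r) = s(g b, y)) ∨
          ∃ j, b + 1 ≤ j ∧ j < q + 1 ∧ G.Adj y (g j) ∧ s(p, r) = s(y, g j)) ∨ s(p, r) = s(y, x)) ∨
          ∃ j, q ≤ j ∧ j < m + 1 ∧ G.Adj x (g j) ∧ s(p, r) = s(x, g j) := by
        rintro p r hpr (rfl | rfl)
        · by_cases hry : r = y
          · subst hry; exact Or.inl (Or.inr Sym2.eq_swap)
          · obtain ⟨j, h1, h2, rfl⟩ := hx r hpr hry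
            exact Or.inr ⟨j, h1, by omega, hpr, rfl⟩
        · by_cases hrx : r = x
          · subst hrx; exact Or.inl (Or.inr rfl)
          · obtain ⟨j, h1, rfl⟩ := hy r hpr hrx
            have := hmin j h1 hpr
            by_cases hjb : j = b
            · rw [hjb]; exact Or.inl (Or.inl (Or.inl (Or.inr Sym2.eq_swap)))
            · exact Or.inl (Or.inl (Or.inr ⟨j, by omega, by omega, hpr, rfl⟩))
      intro hpr
      by_cases h1 : p = x ∨ p = y
      · exact main p r hpr h1
      · by_cases h2 : r = x ∨ r = y
        · have := main r p hpr.symm h2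
          rw [Sym2.eq_swap (a := r) (b := p)] at this
          rcases this with (((h3 | h3) | h3) | h3) | h3
          · rcases h2 with h2 | h2
            · exact absurd h2 h3.2.1
            · exact absurd h2 h3.2.2.1
          · exact Or.inl (Or.inl (Or.inl (Or.inr h3)))
          · exact Or.inl (Or.inl (Or.inr h3))
          · exact Or.inl (Or.inr h3)
          · exact Or.inr h3
        · push Not at h1 h2
          exact Or.inl (Or.inl (Or.inl (Or.inl ⟨hpr, h1.1, h1.2, h2.1, h2.2⟩)))
  rw [← this]
  exact fan4.mac

end P5
end T6

open SimpleGraph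

namespace T6
section P5b
set_option linter.unusedSectionVars false
set_option linter.unusedSimpArgs false
open scoped Classical
open Finset
variable {V : Type*} [Fintype V]

lemma conn_of_erase {G : SimpleGraph V} {U : Finset V} (h3 : 3 ≤ U.card)
    (h : ∀ b ∈ U, Conn G (U.erase b)) : Conn G U := by
  intro P hP ⟨p, hp⟩ ⟨q, hq⟩
  have hqU := (Finset.mem_sdiff.1 hq).1
  have hqP := (Finset.mem_sdiff.1 hq).2
  have : ∃ b ∈ U, b ≠ p ∧ b ≠ q := by
    by_contra hcon
    push Not at hcon
    have : U ⊆ {p, q} := by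
      intro b hb
      by_cases h1 : b = p
      · simp [h1]
      · simp [hcon b hb h1]
    have := Finset.card_le_card this
    have := Finset.card_le_two (a := p) (b := q)
    omega
  obtain ⟨b, hb, hbp, hbq⟩ := this
  obtain ⟨a, ha, c, hc, hac⟩ := h b hb (P.erase b) (Finset.erase_subset_erase b hP)
    ⟨p, Finset.mem_erase.2 ⟨hbp.symm, hp⟩⟩ ⟨q, by simp [hbq.symm, hqU, hqP]⟩
  simp at ha hc
  exact ⟨a, ha.2, c, by simp [hc.1.2, hc.2 hc.1.1], hac⟩

lemma thomassen {G : SimpleGraph V} {S : Finset V} (hS : ∀ a b, G.Adj a b → a ∈ S)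
    (h5 : 5 ≤ S.card) (h3 : ∀ a b, Conn G ((S.erase a).erase b)) :
    ∃ x y, G.Adj x y ∧ ∀ w, Conn G (((S.erase x).erase y).erase w) := by
  by_contra hcon
  push Not at hcon
  let Cand : ℕ → Prop := fun n => ∃ x y w P, P.card = n ∧ G.Adj x y ∧ P ⊆ ((S.erase x).erase y).erase w ∧
    P.Nonempty ∧ ((((S.erase x).erase y).erase w) \ P).Nonempty ∧
      ∀ a ∈ P, ∀ b ∈ (((S.erase x).erase y).erase w) \ P, ¬ G.Adj a b
  have hex : ∀ x y, G.Adj x y → ∃ w P, P ⊆ ((S.erase x).erase y).erase w ∧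
    P.Nonempty ∧ ((((S.erase x).erase y).erase w) \ P).Nonempty ∧
      ∀ a ∈ P, ∀ b ∈ (((S.erase x).erase y).erase w) \ P, ¬ G.Adj a b := by
    intro x y hxy
    obtain ⟨w, hw⟩ := hcon x y hxy
    unfold Conn at hw
    push Not at hw
    obtain ⟨P, k1, k2, k3, k4⟩ := hw
    exact ⟨w, P, k1, k2, k3, k4⟩
  have hc : ∃ n, Cand n := by
    have hne : ∃ x y, G.Adj x y := by
      by_contra hno
      push Not at hno
      obtain ⟨a, ha, b, hb, hab⟩ := Finset.one_lt_card.1 (by omega : 1 < S.card)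
      have h33 := h3 a a
      have h4 : 4 ≤ ((S.erase a).erase a).card := by
        rw [Finset.erase_eq_of_notMem (Finset.notMem_erase a S), Finset.card_erase_of_mem ha]; omega
      obtain ⟨c, hc, d, hd, hcd⟩ := Finset.one_lt_card.1 (by omega : 1 < ((S.erase a).erase a).card)
      obtain ⟨p, _, q, _, hpq⟩ := h33 {c} (by simpa using hc) ⟨c, by simp⟩ ⟨d, by
        rw [Finset.mem_sdiff]; exact ⟨hd, by simpa using hcd.symm⟩⟩
      exact hno p q hpq
    obtain ⟨x, y, hxy⟩ := hne
    obtain ⟨w, P, k1, k2, k3, k4⟩ := hex x y hxy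
    exact ⟨P.card, x, y, w, P, rfl, hxy, k1, k2, k3, k4⟩
  obtain ⟨x, y, w, P, hPn, hxy, hPs, hPne, ⟨q0, hq0⟩, hno⟩ := Nat.find_spec hc
  have hmin : ∀ k, Cand k → P.card ≤ k := by
    intro k hk
    rw [hPn]; exact Nat.find_min' hc hk
  have hPm : ∀ p ∈ P, p ∈ S ∧ p ≠ x ∧ p ≠ y ∧ p ≠ w := by
    intro p hp
    have := hPs hp
    simp at this; tauto
  simp only [Finset.mem_sdiff, Finset.mem_erase] at hq0 hno
  -- neighbour of w in P
  have hv : ∃ v ∈ P, G.Adj v w := by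
    obtain ⟨a, ha, b, hb, hab⟩ := h3 x y P (by
      intro p hp; have := hPm p hp; simp; tauto) hPne ⟨q0, by simp; tauto⟩
    simp only [Finset.mem_sdiff, Finset.mem_erase] at hb
    by_cases hbw : b = w
    · exact ⟨a, ha, hbw ▸ hab⟩
    · exact absurd hab (hno a ha b ⟨⟨hbw, hb.1⟩, hb.2⟩)
  obtain ⟨v, hvP, hvw⟩ := hv
  obtain ⟨t, R0, r1, r2, r3, r4⟩ := hex w v hvw.symm
  -- choose the part avoiding x and y
  have hR : ∃ R R' : Finset V, R.Nonempty ∧ R'.Nonempty ∧ (∀ z, (z ∈ R ∨ z ∈ R') ↔ z ∈ ((S.erase w).erase v).erase t) ∧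
      (∀ z, z ∈ R → z ∉ R') ∧ (∀ a ∈ R, ∀ b ∈ R', ¬ G.Adj a b) ∧ x ∉ R ∧ y ∉ R := by
    by_cases h : x ∉ R0 ∧ y ∉ R0
    · refine ⟨R0, _, r2, r3, ?_, ?_, r4, h.1, h.2⟩
      · intro z
        rw [Finset.mem_sdiff]
        have := @r1 z
        tauto
      · intro z hz; rw [Finset.mem_sdiff]; tauto
    · refine ⟨_, R0, r3, r2, ?_, ?_, fun a ha b hb hab => r4 b hb a ha hab.symm, ?_, ?_⟩
      · intro z
        rw [Finset.mem_sdiff]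
        have := @r1 z
        tauto
      · intro z hz; rw [Finset.mem_sdiff] at hz; tauto
      · intro hx
        have hx' := (Finset.mem_sdiff.1 hx).2
        have hy : y ∈ R0 := by tauto
        exact r4 y hy x hx hxy.symm
      · intro hy
        have hy' := (Finset.mem_sdiff.1 hy).2
        have hx : x ∈ R0 := by tauto
        exact r4 x hx y hy hxy
  obtain ⟨R, R', hRne, ⟨r', hr'⟩, hcov, hdis, hRR, hxR, hyR⟩ := hR
  have hcv : ∀ z, (z ∈ R ∨ z ∈ R') ↔ z ≠ t ∧ z ≠ v ∧ z ≠ w ∧ z ∈ S := by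
    intro z; rw [hcov]; simp
  have hr : ∃ r ∈ R, G.Adj r v := by
    have hr'' := (hcv r').1 (Or.inr hr')
    obtain ⟨a, ha, b, hb, hab⟩ := h3 w t R (by
      intro p hp; have := (hcv p).1 (Or.inl hp); simp; tauto) hRne ⟨r', by
        have := hdis r'
        simp; tauto⟩
    simp only [Finset.mem_sdiff, Finset.mem_erase] at hb
    by_cases hbv : b = v
    · exact ⟨a, ha, hbv ▸ hab⟩
    · have : b ∈ R' := by
        have := (hcv b).2 ⟨hb.1.1, hbv, hb.1.2.1, hb.1.2.2⟩
        tauto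
      exact absurd hab (hRR a ha b this)
  obtain ⟨r, hrR, hrv⟩ := hr
  have hrs := (hcv r).1 (Or.inl hrR)
  have hrP : r ∈ P := by
    by_contra hrP
    apply hno v hvP r ⟨⟨hrs.2.2.1, ?_, ?_, hrs.2.2.2⟩, hrP⟩ hrv.symm
    · rintro rfl; exact hyR hrR
    · rintro rfl; exact hxR hrR
  have hvR : v ∉ R := fun h => ((hcv v).1 (Or.inl h)).2.1 rfl
  have := hmin (R ∩ P).card ⟨w, v, t, R ∩ P, rfl, hvw.symm, ?_, ⟨r, by simp [hrR, hrP]⟩, ⟨r', ?_⟩, ?_⟩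
  · have h1 : R ∩ P ⊂ P := by
      refine ⟨Finset.inter_subset_right, fun h => hvR ?_⟩
      exact (Finset.mem_inter.1 (h hvP)).1
    have := Finset.card_lt_card h1
    omega
  · intro z hz
    have := (hcv z).1 (Or.inl (Finset.mem_inter.1 hz).1)
    simp; tauto
  · have h1 := (hcv r').1 (Or.inr hr')
    have h2 := hdis r'
    simp; tauto
  · intro a ha b hb hab
    rw [Finset.mem_inter] at ha
    simp only [Finset.mem_sdiff, Finset.mem_erase, Finset.mem_inter] at hb
    have h1 := (hcv b).2 (by tauto)
    rcases h1 with h1 | h1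
    · apply hno a ha.2 b ⟨⟨hb.1.2.2.1, ?_, ?_, hb.1.2.2.2⟩, by tauto⟩ hab
      · rintro rfl; exact hyR h1
      · rintro rfl; exact hxR h1
    · exact hRR a ha.1 b h1 hab

end P5b
end T6

open SimpleGraph

namespace T6
section P5c
set_option linter.unusedSectionVars false
set_option linter.unusedSimpArgs false
open scoped Classical
open Finset
variable {V : Type*} [Fintype V]

lemma TC.two_nbr {D : SimpleGraph V} {W : Finset V} (h : TC D W) (h3 : 3 ≤ W.card) {u : V} (hu : u ∈ W) :
    ∃ w1 w2, D.Adj u w1 ∧ D.Adj u w2 ∧ w1 ≠ w2 := by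
  have h1 : ∀ W' : Finset V, Conn D W' → u ∈ W' → 2 ≤ W'.card → ∃ w ∈ W', D.Adj u w := by
    intro W' hc hu' h2
    have : (W' \ {u}).Nonempty := by
      rw [← Finset.card_pos, Finset.card_sdiff_of_subset (by simpa using hu')]; simp; omega
    obtain ⟨a, ha, b, hb, hab⟩ := hc {u} (by simpa using hu') ⟨u, by simp⟩ this
    rw [Finset.mem_singleton] at ha
    exact ⟨b, (Finset.mem_sdiff.1 hb).1, ha ▸ hab⟩
  obtain ⟨w1, hw1, ha1⟩ := h1 W h.conn hu (by omega)
  obtain ⟨w2, hw2, ha2⟩ := h1 (W.erase w1) (h.del w1) (Finset.mem_erase.2 ⟨ha1.ne, hu⟩) (by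
    rw [Finset.card_erase_of_mem hw1]; omega)
  exact ⟨w1, w2, ha1, ha2, ((Finset.mem_erase.1 hw2).1).symm⟩

lemma star_out {G D : SimpleGraph V} {U : Finset V} {x : V} {ι : Type} [Fintype ι] {F : ι → Ch V}
    (hF : Sys G F) (hG : TC G U) (hDT : TC D (U.erase x)) (h3 : 3 ≤ (U.erase x).card)
    (hD : ∀ p q, D.Adj p q ↔ G.Adj p q ∧ p ≠ x ∧ q ≠ x) (hx : ∃ u, G.Adj x u) :
    ∃ c m g, St D c ∅ ∧ Cyc c m g ∧ ∀ u, G.Adj x u → ∃ j < m, g j = u := by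
  let p : ι → Prop := fun j => ∀ u, F j s(x, u) = 0
  let R : Finset ι := univ.filter (fun i => ¬ p i)
  have hR : ∀ i, i ∈ R ↔ ¬ p i := by intro i; simp [R]
  let C : Ch V := ∑ i ∈ R, F i
  have hCx : ∀ u, C s(x, u) = 0 := by
    intro u
    have h1 := congrFun hF.tot s(x, u)
    rw [Finset.sum_apply, ← Finset.sum_filter_add_sum_filter_not univ (fun i => ¬ p i)] at h1
    rw [Finset.sum_eq_zero (s := univ.filter (fun i => ¬ ¬ p i))] at h1
    · simp only [C, Finset.sum_apply]
      simpa using h1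
    · intro i hi
      have := (Finset.mem_filter.1 hi).2
      rw [not_not] at this
      exact this u
  have hDG : D ≤ G := fun a b h => ((hD a b).1 h).1
  have hZ : ∀ c ∈ Z G, (∀ u, c s(x, u) = 0) → c ∈ Z D := by
    intro c hc h0
    refine ⟨fun a b hab => ?_, hc.2⟩
    by_contra hne
    apply hab
    refine (hD a b).2 ⟨Z_adj hc hne, ?_, ?_⟩
    · rintro rfl; exact hne (h0 b)
    · rintro rfl; rw [Sym2.eq_swap] at hne; exact hne (h0 a)
  have hCG : C ∈ Z G := Submodule.sum_mem _ (fun i _ => hF.mem i)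
  let K : Option {j // p j} → Ch V := fun o => o.elim C (fun j => F j.1)
  have hsub : ∀ f : ι → Ch V, ∑ i, f i = ∑ i ∈ R, f i + ∑ j : {j // p j}, f j.1 := by
    intro f
    rw [← Finset.sum_filter_add_sum_filter_not univ (fun i => ¬ p i)]
    congr 1
    exact (Finset.sum_subtype (p := p) (univ.filter (fun j => ¬ ¬ p j)) (by simp) f)
  have hK : Sys D K := by
    refine ⟨?_, ?_, ?_, ?_⟩
    · rintro (_ | j)
      · exact hZ C hCG hCx
      · exact hZ _ (hF.mem j.1) j.2
    · intro c hc
      obtain ⟨a, ha⟩ := hF.span c (Z_mono hDG hc)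
      have hs := star_rel hF (hG.pair x) (univ.filter (fun i => a i ≠ 0)) (by
        intro u
        have h1 : c s(x, u) = 0 := hc.1 _ _ (fun h => ((hD _ _).1 h).2.1 rfl)
        rw [ha, Finset.sum_apply] at h1
        refine Eq.trans ?_ h1
        rw [Finset.sum_filter]
        apply Finset.sum_congr rfl
        intro i _
        split_ifs with h2
        · simp [z1 h2]
        · rw [not_not] at h2; simp [h2])
      have hal : ∃ t : ZMod 2, ∀ i, ¬ p i → a i = t := by
        rcases hs with hs | hs
        · refine ⟨1, fun i hi => ?_⟩
          have := hs i (by simpa [p] using hi)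
          exact z1 (by simpa using this)
        · refine ⟨0, fun i hi => ?_⟩
          have := hs i (by simpa [p] using hi)
          simpa using this
      obtain ⟨t, ht⟩ := hal
      refine ⟨fun o => o.elim t (fun j => a j.1), ?_⟩
      rw [Fintype.sum_option, ha, hsub]
      congr 1
      simp only [Option.elim, K, C, Finset.smul_sum]
      apply Finset.sum_congr rfl
      intro i hi
      rw [ht i ((hR i).1 hi)]
    · intro e
      have h4 := hF.le2 e
      have h5 : (univ.filter (fun o => K o e ≠ 0)).card =
        (if C e ≠ 0 then 1 else 0) + (univ.filter (fun j : {j // p j} => F j.1 e ≠ 0)).card := by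
        rw [Finset.card_filter, Fintype.sum_option, Finset.card_filter]
        congr!
      rw [h5]
      have h6 : (univ.filter (fun j : {j // p j} => F j.1 e ≠ 0)).card + (R.filter (fun i => F i e ≠ 0)).card
          ≤ (univ.filter (fun i => F i e ≠ 0)).card := by
        rw [← Finset.card_map (Function.Embedding.subtype p), ← Finset.card_union_of_disjoint]
        · apply Finset.card_le_card
          intro i hi
          simp at hi ⊢
          rcases hi with hi | hi <;> tauto
        · rw [Finset.disjoint_left]
          intro i hi hi2
          simp at hi
          rw [Finset.mem_filter, hR] at hi2
          exact hi2.1 hi.2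
      split_ifs with h7
      · have : (R.filter (fun i => F i e ≠ 0)).Nonempty := by
          by_contra hne
          rw [Finset.not_nonempty_iff_eq_empty, Finset.filter_eq_empty_iff] at hne
          apply h7
          simp only [C, Finset.sum_apply]
          apply Finset.sum_eq_zero
          intro i hi
          simpa using hne hi
        have := Finset.card_pos.2 this
        omega
      · omega
    · rw [Fintype.sum_option]
      have := hF.tot
      rw [hsub] at this
      exact this
  have hon : ∀ u, G.Adj x u → ∃ t, C s(u, t) ≠ 0 := by
    intro u hu
    by_contra hcon
    push Not at hcon
    have hux : u ≠ x := hu.ne'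
    have huW : u ∈ U.erase x := Finset.mem_erase.2 ⟨hux, hG.supp u x hu.symm⟩
    obtain ⟨w1, w2, ha1, ha2, hne⟩ := hDT.two_nbr h3 huW
    rcases star_rel hF (hG.pair u) R (by intro t; have := hcon t; simpa [C, Finset.sum_apply] using this) with h1 | h1
    · have h2 := star_two hK (hDT.pair u) ha1 ha2 hne
      have : ∃ o, K o s(u, w1) ≠ 0 := by
        have h0 : 0 < (univ.filter (fun i => K i s(u, w1) ≠ 0)).card := by omega
        obtain ⟨o, ho⟩ := Finset.card_pos.1 h0
        exact ⟨o, (Finset.mem_filter.1 ho).2⟩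
      obtain ⟨o, ho⟩ := this
      rcases o with _ | j
      · exact ho (hcon w1)
      · exact (hR _).1 (h1 j.1 ⟨w1, ho⟩) j.2
    · have h2 := star_two hF (hG.pair u) hu.symm (hDG ha1) (by
        rintro rfl; exact ((hD _ _).1 ha1).2.2 rfl)
      have h0 : 0 < (univ.filter (fun i => F i s(u, x) ≠ 0)).card := by omega
      obtain ⟨i, hi⟩ := Finset.card_pos.1 h0
      have hi2 := (Finset.mem_filter.1 hi).2
      apply h1 i ⟨x, hi2⟩
      rw [hR]
      intro hp
      rw [Sym2.eq_swap] at hi2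
      exact hi2 (hp u)
  obtain ⟨u0, hu0⟩ := hx
  obtain ⟨t0, ht0⟩ := hon u0 hu0
  obtain ⟨m, g, hC⟩ := hK.cyc hDT none (fun h => ht0 (by
    have : C = 0 := h
    rw [this]; rfl))
  refine ⟨C, m, g, ⟨_, inferInstance, K, hK.mem, hK.span, hK.le2, ⟨none, rfl⟩, by simp⟩, hC, ?_⟩
  intro u hu
  obtain ⟨t, ht⟩ := hon u hu
  exact hC.vert ht

end P5c
end T6

open SimpleGraph

namespace T6
section P5d
set_option linter.unusedSectionVars false
set_option linter.unusedSimpArgs false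
open scoped Classical
open Finset
variable {V : Type*} [Fintype V]

lemma cyclic_arrange (m : ℕ) (a b : ℕ → Prop) (hm : 0 < m)
    (ha : ∀ i, a (i + m) ↔ a i) (hb : ∀ i, b (i + m) ↔ b i)
    (ham : ∀ i, a (i % m) ↔ a i) (hbm : ∀ i, b (i % m) ↔ b i)
    (ha2 : ∃ i j, i % m ≠ j % m ∧ a i ∧ a j) (hb2 : ∃ i j, i % m ≠ j % m ∧ b i ∧ b j)
    (hx : ∀ i j k l, i < j → j < k → k < l → l < i + m → a i → b j → a k → b l → False)
    (ht : ∀ i j k, i < j → j < k → k < i + m → a i → b i → a j → b j → a k → b k → False) :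
    ∃ r q, 0 < q ∧ q < m ∧ (∀ j < m, a (j + r) → j = 0 ∨ q ≤ j) ∧ (∀ j < m, b (j + r) → j ≤ q) := by
  by_cases hc : ∃ k, b k ∧ ¬ a k
  · obtain ⟨k, hbk, hak⟩ := hc
    rw [← hbm] at hbk
    rw [← ham] at hak
    obtain ⟨b0, hb0⟩ : ∃ b0, b0 = k % m := ⟨_, rfl⟩
    rw [← hb0] at hbk hak
    have hlt : b0 < m := hb0 ▸ Nat.mod_lt _ hm
    let W := (Finset.Ioo b0 (b0 + m)).filter a
    have hW : ∀ j, j ∈ W ↔ (b0 < j ∧ j < b0 + m) ∧ a j := by intro j; simp [W]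
    obtain ⟨i, j, hij, hai, haj⟩ := ha2
    rw [← ham] at hai haj
    have hi := Nat.mod_lt i hm
    have hj := Nat.mod_lt j hm
    generalize i % m = i' at *
    generalize j % m = j' at *
    have rep : ∀ i < m, a i → ∃ i2 ∈ W, i2 = i ∨ i2 = i + m := by
      intro i hi hai
      by_cases h1 : b0 < i
      · exact ⟨i, by rw [hW]; exact ⟨⟨h1, by omega⟩, hai⟩, Or.inl rfl⟩
      · have : i ≠ b0 := by rintro rfl; exact hak hai
        exact ⟨i + m, by rw [hW]; exact ⟨⟨by omega, by omega⟩, (ha i).2 hai⟩, Or.inr rfl⟩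
    obtain ⟨i2, hi2, hi3⟩ := rep i' hi hai
    obtain ⟨j2, hj2, hj3⟩ := rep j' hj haj
    have hne : i2 ≠ j2 := by omega
    obtain ⟨a1, ha1, hmin⟩ := Finset.exists_min_image W id ⟨_, hi2⟩
    obtain ⟨a2, ha2, hmax⟩ := Finset.exists_max_image W id ⟨_, hi2⟩
    simp only [id] at hmin hmax
    have h12 : a1 < a2 := by
      have := hmin _ hi2; have := hmin _ hj2; have := hmax _ hi2; have := hmax _ hj2
      omega
    rw [hW] at ha1 ha2
    refine ⟨a2, a1 + m - a2, by omega, by omega, ?_, ?_⟩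
    · intro j hj haj
      by_contra hcon
      push Not at hcon
      rcases lt_trichotomy (j + a2) (b0 + m) with h | h | h
      · have := hmax (j + a2) ((hW _).2 ⟨by omega, haj⟩)
        omega
      · rw [h, ha] at haj; exact hak haj
      · obtain ⟨t, ht⟩ : ∃ t, j + a2 = t + m := ⟨j + a2 - m, by omega⟩
        rw [ht, ha] at haj
        have := hmin t ((hW _).2 ⟨by omega, haj⟩)
        omega
    · intro j hj hbj
      by_contra hcon
      obtain ⟨t, ht⟩ : ∃ t, j + a2 = t + m := ⟨j + a2 - m, by omega⟩
      rw [ht, hb] at hbj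
      exact hx a1 t a2 (b0 + m) (by omega) (by omega) (by omega) (by omega) ha1.2 hbj ha2.2 ((hb _).2 hbk)
  · push Not at hc
    obtain ⟨i, j, hij, hbi, hbj⟩ := hb2
    rw [← hbm] at hbi hbj
    have hi := Nat.mod_lt i hm
    have hj := Nat.mod_lt j hm
    generalize i % m = i' at *
    generalize j % m = j' at *
    have : ∃ b1 b2, b1 < b2 ∧ b2 < b1 + m ∧ b b1 ∧ b b2 := by
      rcases lt_or_gt_of_ne hij with h | h
      · exact ⟨i', j', h, by omega, hbi, hbj⟩
      · exact ⟨j', i', h, by omega, hbj, hbi⟩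
    obtain ⟨b1, b2, h12, h21, hb1, hb2⟩ := this
    by_cases hs : ∃ s, b1 < s ∧ s < b2 ∧ a s
    · obtain ⟨s, hs1, hs2, hs3⟩ := hs
      have hB1 := (hb b1).2 hb1
      have hB2 := (hb b2).2 hb2
      refine ⟨b2, b1 + m - b2, by omega, by omega, ?_, ?_⟩
      · intro j hj haj
        by_contra hcon
        push Not at hcon
        exact hx s b2 (j + b2) (b1 + m) hs2 (by omega) (by omega) (by omega) hs3 hb2 haj hB1
      · intro j hj hbj
        by_contra hcon
        exact ht b2 (b1 + m) (j + b2) (by omega) (by omega) (by omega) (hc _ hb2) hb2 (hc _ hB1) hB1 (hc _ hbj) hbj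
    · push Not at hs
      refine ⟨b1, b2 - b1, by omega, by omega, ?_, ?_⟩
      · intro j hj haj
        by_contra hcon
        push Not at hcon
        exact hs (j + b1) (by omega) (by omega) haj
      · intro j hj hbj
        by_contra hcon
        exact ht b1 b2 (j + b1) (by omega) (by omega) (by omega) (hc _ hb1) hb1 (hc _ hb2) hb2 (hc _ hbj) hbj

lemma Cyc.inj_win {c : Ch V} {m : ℕ} {g : ℕ → V} (h : Cyc c m g) (s i j : ℕ) (h1 : s ≤ i) (h2 : i < s + m)
    (h3 : s ≤ j) (h4 : j < s + m) (hij : g i = g j) : i = j := by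
  have := (h.shift s).inj (i - s) (j - s) (by omega) (by omega) (by
    show g (i - s + s) = g (j - s + s)
    rw [show i - s + s = i by omega, show j - s + s = j by omega]; exact hij)
  omega

/-- vertex set of an arc -/
noncomputable def arc (g : ℕ → V) (s t : ℕ) : Finset V := (Finset.Ico s t).image g

lemma mem_arc (g : ℕ → V) (s t : ℕ) (v : V) : v ∈ arc g s t ↔ ∃ i, s ≤ i ∧ i < t ∧ g i = v := by
  simp [arc, and_assoc]

lemma arc_conn {G : SimpleGraph V} {g : ℕ → V} (hg : ∀ j, G.Adj (g j) (g (j + 1))) (s t : ℕ) (h : s < t) :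
    Conn G (arc g s t) := by
  induction t, h using Nat.le_induction with
  | base =>
    have : arc g s (s + 1) = {g s} := by simp [arc]
    rw [show s.succ = s + 1 from rfl, this]; exact conn_singleton _ _
  | succ t ht ih =>
    have h1 : arc g s (t + 1) = arc g s t ∪ {g t} := by
      ext v
      simp only [Finset.mem_union, mem_arc, Finset.mem_singleton]
      constructor
      · rintro ⟨i, h1, h2, rfl⟩
        by_cases h3 : i = t
        · right; rw [h3]
        · left; exact ⟨i, h1, by omega, rfl⟩
      · rintro (⟨i, h1, h2, rfl⟩ | rfl)
        · exact ⟨i, h1, by omega, rfl⟩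
        · exact ⟨t, by omega, by omega, rfl⟩
    rw [h1]
    refine ih.union (conn_singleton _ _) ⟨g (t - 1), ?_, g t, by simp, Or.inl ?_⟩
    · rw [mem_arc]; exact ⟨t - 1, by omega, by omega, rfl⟩
    · have := hg (t - 1)
      rwa [show t - 1 + 1 = t by omega] at this

lemma arc_adj {G : SimpleGraph V} {g : ℕ → V} (hg : ∀ j, G.Adj (g j) (g (j + 1))) (s t u : ℕ) (h : s < t) (h2 : t < u) :
    ∃ p ∈ arc g s t, ∃ q ∈ arc g t u, G.Adj p q := by
  refine ⟨g (t - 1), (mem_arc _ _ _ _).2 ⟨t - 1, by omega, by omega, rfl⟩, g t,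
    (mem_arc _ _ _ _).2 ⟨t, by omega, by omega, rfl⟩, ?_⟩
  have := hg (t - 1)
  rwa [show t - 1 + 1 = t by omega] at this

lemma no_cross {G : SimpleGraph V} (hp : IsPlanar G) {c : Ch V} {m : ℕ} {g : ℕ → V} (hC : Cyc c m g)
    (hg : ∀ j, G.Adj (g j) (g (j + 1))) {x y : V} (hx : ∀ j, x ≠ g j) (hy : ∀ j, y ≠ g j)
    (hxy : G.Adj x y) (i j k l : ℕ) (hij : i < j) (hjk : j < k) (hkl : k < l) (hl : l < i + m)
    (h1 : G.Adj x (g i)) (h2 : G.Adj y (g j)) (h3 : G.Adj x (g k)) (h4 : G.Adj y (g l)) : False := by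
  have hinj := hC.inj_win i
  have hin : ∀ s t, s < t → g s ∈ arc g s t := fun s t h => (mem_arc _ _ _ _).2 ⟨s, le_rfl, h, rfl⟩
  have hlast : ∃ p ∈ arc g l (i + m), ∃ q ∈ arc g i j, G.Adj p q := by
    refine ⟨g (i + m - 1), (mem_arc _ _ _ _).2 ⟨i + m - 1, by omega, by omega, rfl⟩, g i, hin i j hij, ?_⟩
    have := hg (i + m - 1)
    rwa [show i + m - 1 + 1 = i + m by omega, hC.per] at this
  have sw : ∀ A B : Finset V, (∃ p ∈ A, ∃ q ∈ B, G.Adj p q) → ∃ p ∈ B, ∃ q ∈ A, G.Adj p q := by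
    rintro A B ⟨p, hp, q, hq, h⟩; exact ⟨q, hq, p, hp, h.symm⟩
  let S : Fin 3 ⊕ Fin 3 → Finset V := Sum.elim ![{x}, arc g j k, arc g l (i + m)] ![{y}, arc g i j, arc g k l]
  have hlr : ∀ a b : Fin 3, ∃ p ∈ S (Sum.inl a), ∃ q ∈ S (Sum.inr b), G.Adj p q := by
    intro a b
    fin_cases a <;> fin_cases b
    · exact ⟨x, by simp [S], y, by simp [S], hxy⟩
    · exact ⟨x, by simp [S], g i, hin _ _ hij, h1⟩
    · exact ⟨x, by simp [S], g k, hin _ _ hkl, h3⟩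
    · exact ⟨g j, hin _ _ hjk, y, by simp [S], h2.symm⟩
    · exact sw _ _ (arc_adj hg i j k hij hjk)
    · exact arc_adj hg j k l hjk hkl
    · exact ⟨g l, hin _ _ hl, y, by simp [S], h4.symm⟩
    · exact hlast
    · exact sw _ _ (arc_adj hg k l (i + m) hkl hl)
  apply hp.2
  refine WM.hasMinor (⟨S, ?_, ?_, ?_⟩ : WM G _) ?_
  · have hd : ∀ s t s' t' v, t ≤ s' → i ≤ s → t' ≤ i + m → v ∈ arc g s t → v ∈ arc g s' t' → False := by
      intro s t s' t' v k1 k2 k3 hv hv'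
      rw [mem_arc] at hv hv'
      obtain ⟨p, p1, p2, rfl⟩ := hv
      obtain ⟨q, q1, q2, q3⟩ := hv'
      have := hinj p q (by omega) (by omega) (by omega) (by omega) q3.symm
      omega
    have hxa : ∀ s t, x ∉ arc g s t := by
      intro s t h; obtain ⟨p, _, _, h⟩ := (mem_arc _ _ _ _).1 h; exact hx p h.symm
    have hya : ∀ s t, y ∉ arc g s t := by
      intro s t h; obtain ⟨p, _, _, h⟩ := (mem_arc _ _ _ _).1 h; exact hy p h.symm
    have hne := hxy.ne
    have e1 := fun v => hd i j j k v le_rfl le_rfl (by omega)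
    have e2 := fun v => hd i j k l v (by omega) le_rfl (by omega)
    have e3 := fun v => hd i j l (i+m) v (by omega) le_rfl (by omega)
    have e4 := fun v => hd j k k l v (by omega) (by omega) (by omega)
    have e5 := fun v => hd j k l (i+m) v (by omega) (by omega) (by omega)
    have e6 := fun v => hd k l l (i+m) v (by omega) (by omega) (by omega)
    rintro (a | a) (b | b) v hva hvb <;> fin_cases a <;> fin_cases b <;> simp [S] at hva hvb ⊢ <;> grind
  · rintro (a | a) <;> fin_cases a
    · exact conn_singleton _ _
    · exact arc_conn hg _ _ hjk
    · exact arc_conn hg _ _ hl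
    · exact conn_singleton _ _
    · exact arc_conn hg _ _ hij
    · exact arc_conn hg _ _ hkl
  · rintro (a | a) (b | b) hab
    · simp at hab
    · exact hlr a b
    · exact sw _ _ (hlr b a)
    · simp at hab
  · rintro (w | w)
    · exact ⟨Sum.inr 0, by simp⟩
    · exact ⟨Sum.inl 0, by simp⟩

lemma no_triple {G : SimpleGraph V} (hp : IsPlanar G) {c : Ch V} {m : ℕ} {g : ℕ → V} (hC : Cyc c m g)
    (hg : ∀ j, G.Adj (g j) (g (j + 1))) {x y : V} (hx : ∀ j, x ≠ g j) (hy : ∀ j, y ≠ g j)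
    (hxy : G.Adj x y) (i j k : ℕ) (hij : i < j) (hjk : j < k) (hl : k < i + m)
    (h1 : G.Adj x (g i)) (h2 : G.Adj x (g j)) (h3 : G.Adj x (g k))
    (h1' : G.Adj y (g i)) (h2' : G.Adj y (g j)) (h3' : G.Adj y (g k)) : False := by
  have hinj := hC.inj_win i
  have hin : ∀ s t, s < t → g s ∈ arc g s t := fun s t h => (mem_arc _ _ _ _).2 ⟨s, le_rfl, h, rfl⟩
  have hlast : ∃ p ∈ arc g k (i + m), ∃ q ∈ arc g i j, G.Adj p q := by
    refine ⟨g (i + m - 1), (mem_arc _ _ _ _).2 ⟨i + m - 1, by omega, by omega, rfl⟩, g i, hin i j hij, ?_⟩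
    have := hg (i + m - 1)
    rwa [show i + m - 1 + 1 = i + m by omega, hC.per] at this
  have sw : ∀ A B : Finset V, (∃ p ∈ A, ∃ q ∈ B, G.Adj p q) → ∃ p ∈ B, ∃ q ∈ A, G.Adj p q := by
    rintro A B ⟨p, hp, q, hq, h⟩; exact ⟨q, hq, p, hp, h.symm⟩
  let S : Fin 5 → Finset V := ![{x}, {y}, arc g i j, arc g j k, arc g k (i + m)]
  have hlr : ∀ a b : Fin 5, a < b → ∃ p ∈ S a, ∃ q ∈ S b, G.Adj p q := by
    intro a b hab
    fin_cases a <;> fin_cases b <;> first | (exfalso; revert hab; decide) | skip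
    · exact ⟨x, by simp [S], y, by simp [S], hxy⟩
    · exact ⟨x, by simp [S], g i, hin _ _ hij, h1⟩
    · exact ⟨x, by simp [S], g j, hin _ _ hjk, h2⟩
    · exact ⟨x, by simp [S], g k, hin _ _ hl, h3⟩
    · exact ⟨y, by simp [S], g i, hin _ _ hij, h1'⟩
    · exact ⟨y, by simp [S], g j, hin _ _ hjk, h2'⟩
    · exact ⟨y, by simp [S], g k, hin _ _ hl, h3'⟩
    · exact arc_adj hg i j k hij hjk
    · exact sw _ _ hlast
    · exact arc_adj hg j k (i + m) hjk hl
  apply hp.1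
  refine WM.hasMinor (⟨S, ?_, ?_, ?_⟩ : WM G _) ?_
  · have hd : ∀ s t s' t' v, t ≤ s' → i ≤ s → t' ≤ i + m → v ∈ arc g s t → v ∈ arc g s' t' → False := by
      intro s t s' t' v k1 k2 k3 hv hv'
      rw [mem_arc] at hv hv'
      obtain ⟨p, p1, p2, rfl⟩ := hv
      obtain ⟨q, q1, q2, q3⟩ := hv'
      have := hinj p q (by omega) (by omega) (by omega) (by omega) q3.symm
      omega
    have hxa : ∀ s t, x ∉ arc g s t := by
      intro s t h; obtain ⟨p, _, _, h⟩ := (mem_arc _ _ _ _).1 h; exact hx p h.symm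
    have hya : ∀ s t, y ∉ arc g s t := by
      intro s t h; obtain ⟨p, _, _, h⟩ := (mem_arc _ _ _ _).1 h; exact hy p h.symm
    have hne := hxy.ne
    have e1 := fun v => hd i j j k v le_rfl le_rfl (by omega)
    have e2 := fun v => hd i j k (i+m) v (by omega) le_rfl (by omega)
    have e4 := fun v => hd j k k (i+m) v (by omega) (by omega) (by omega)
    intro a b v hva hvb
    fin_cases a <;> fin_cases b <;> simp [S] at hva hvb ⊢ <;> grind
  · intro a; fin_cases a
    · exact conn_singleton _ _
    · exact conn_singleton _ _
    · exact arc_conn hg _ _ hij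
    · exact arc_conn hg _ _ hjk
    · exact arc_conn hg _ _ hl
  · intro a b hab
    rcases lt_or_gt_of_ne hab with h | h
    · exact hlr a b h
    · exact sw _ _ (hlr b a h)
  · intro w
    exact ⟨w + 1, by revert w; decide⟩

lemma wheel_mac {G D : SimpleGraph V} (hp : IsPlanar G) {c : Ch V} {m : ℕ} {g : ℕ → V} (hC : Cyc c m g)
    {x y : V} (hxy : G.Adj x y) (hSt : St D c ∅)
    (hD : ∀ p q, D.Adj p q ↔ G.Adj p q ∧ p ≠ x ∧ p ≠ y ∧ q ≠ x ∧ q ≠ y)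
    (hx : ∀ u, G.Adj x u → u ≠ y → ∃ j, g j = u) (hy : ∀ u, G.Adj y u → u ≠ x → ∃ j, g j = u)
    (hx2 : ∃ u w, u ≠ w ∧ u ≠ y ∧ w ≠ y ∧ G.Adj x u ∧ G.Adj x w)
    (hy2 : ∃ u w, u ≠ w ∧ u ≠ x ∧ w ≠ x ∧ G.Adj y u ∧ G.Adj y w) : Mac G := by
  have hm : 0 < m := by have := hC.three; omega
  have hgD : ∀ j, D.Adj (g j) (g (j + 1)) := by
    intro j
    obtain ⟨_, _, F, k1, _, _, ⟨i, hi⟩, _⟩ := hSt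
    exact Z_adj (k1 i) (by rw [hi]; exact hC.edge j)
  have hgx : ∀ j, x ≠ g j := fun j => (((hD _ _).1 (hgD j)).2.1).symm
  have hgy : ∀ j, y ≠ g j := fun j => (((hD _ _).1 (hgD j)).2.2.1).symm
  have hgG : ∀ j, G.Adj (g j) (g (j + 1)) := fun j => ((hD _ _).1 (hgD j)).1
  obtain ⟨r, q, hq, hqm, hA, hB⟩ := cyclic_arrange m (fun i => G.Adj x (g i)) (fun i => G.Adj y (g i)) hm
    (fun i => by simp only [hC.per]) (fun i => by simp only [hC.per])
    (fun i => by simp only [hC.mod]) (fun i => by simp only [hC.mod])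
    (by
      obtain ⟨u, w, huw, h1, h2, h3, h4⟩ := hx2
      obtain ⟨i, rfl⟩ := hx u h3 h1
      obtain ⟨j, rfl⟩ := hx w h4 h2
      exact ⟨i, j, fun h => huw ((hC.eq_iff _ _).2 h), h3, h4⟩)
    (by
      obtain ⟨u, w, huw, h1, h2, h3, h4⟩ := hy2
      obtain ⟨i, rfl⟩ := hy u h3 h1
      obtain ⟨j, rfl⟩ := hy w h4 h2
      exact ⟨i, j, fun h => huw ((hC.eq_iff _ _).2 h), h3, h4⟩)
    (fun i j k l h1 h2 h3 h4 h5 h6 h7 h8 =>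
      no_cross hp hC hgG hgx hgy hxy i j k l h1 h2 h3 h4 h5 h6 h7 h8)
    (fun i j k h1 h2 h3 h4 h5 h6 h7 h8 h9 =>
      no_triple hp hC hgG hgx hgy hxy i j k h1 h2 h3 h4 h6 h8 h5 h7 h9)
  have hCr := hC.shift r
  have rep : ∀ i, ∃ j < m, g (j + r) = g i := by
    intro i
    refine ⟨(i + (r * m - r)) % m, Nat.mod_lt _ hm, ?_⟩
    have h1 : r ≤ r * m := Nat.le_mul_of_pos_right r hm
    rw [hC.eq_iff, Nat.mod_add_mod, show i + (r * m - r) + r = i + r * m by omega, Nat.add_mul_mod_self_right]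
  refine fan_mac hCr hxy hSt hD hq hqm ?_ ?_ ?_
  · intro u hu huy
    obtain ⟨i, rfl⟩ := hx u hu huy
    obtain ⟨j, hj, hji⟩ := rep i
    rcases hA j hj (by simp only [hji]; exact hu) with h | h
    · refine ⟨m, hqm.le, le_rfl, ?_⟩
      subst h
      rw [← hji]
      have := hC.per r
      simp only [add_comm m r, this, zero_add]
    · exact ⟨j, h, hj.le, hji.symm⟩
  · intro u hu hux
    obtain ⟨i, rfl⟩ := hy u hu hux
    obtain ⟨j, hj, hji⟩ := rep i
    exact ⟨j, hB j hj (by simp only [hji]; exact hu), hji.symm⟩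
  · obtain ⟨u, w, huw, h1, h2, h3, h4⟩ := hy2
    exact ⟨u, h3, h1⟩

end P5d
end T6

open SimpleGraph

namespace T6
section P5e
set_option linter.unusedSectionVars false
set_option linter.unusedSimpArgs false
open scoped Classical
open Finset
variable {V : Type*} [Fintype V]

lemma Mac.mono {G H : SimpleGraph V} (hG : Mac G) (hle : H ≤ G) : Mac H := by
  obtain ⟨n, hn⟩ : ∃ n, (univ.filter (fun e : V × V => G.Adj e.1 e.2 ∧ ¬ H.Adj e.1 e.2)).card = n := ⟨_, rfl⟩
  induction n using Nat.strong_induction_on generalizing G with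
  | _ n ih =>
  by_cases h : ∃ a b, G.Adj a b ∧ ¬ H.Adj a b
  · obtain ⟨a, b, hab, hnab⟩ := h
    let G1 : SimpleGraph V :=
      { Adj := fun p q => G.Adj p q ∧ s(p, q) ≠ s(a, b)
        symm := ⟨fun p q h => ⟨h.1.symm, by rw [Sym2.eq_swap]; exact h.2⟩⟩
        loopless := ⟨fun p h => G.loopless.irrefl p h.1⟩ }
    have h1 : Mac G1 := hG.delete a b (fun p q => Iff.rfl)
    refine ih _ ?_ h1 ?_ rfl
    · rw [← hn]
      apply Finset.card_lt_card
      refine ⟨?_, ?_⟩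
      · intro e he
        simp only [Finset.mem_filter, Finset.mem_univ, true_and] at he ⊢
        exact ⟨he.1.1, he.2⟩
      · intro hs
        have := @hs (a, b) (by simp [hab, hnab])
        simp [G1] at this
    · intro p q hpq
      refine ⟨hle hpq, ?_⟩
      intro he
      rw [Sym2.eq_iff] at he
      rcases he with ⟨rfl, rfl⟩ | ⟨rfl, rfl⟩
      · exact hnab hpq
      · exact hnab hpq.symm
  · push Not at h
    have : H = G := le_antisymm hle (fun a b hab => h a b hab)
    rw [this]; exact hG

lemma mac_small {G : SimpleGraph V} (h4 : (sp G).card ≤ 4) : Mac G := by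
  by_cases hne : ∃ d, d ∈ sp G
  swap
  · push Not at hne
    refine ⟨Empty, inferInstance, fun i => i.elim, fun i => i.elim, ?_, by simp⟩
    intro c hc
    refine ⟨fun i => i.elim, ?_⟩
    simp only [Finset.univ_eq_empty, Finset.sum_empty]
    ext e
    induction e using Sym2.ind with | _ a b =>
    exact hc.1 a b (fun h => hne a (mem_sp.2 ⟨b, h⟩))
  obtain ⟨d, hd⟩ := hne
  obtain ⟨k, hk⟩ : ∃ k, ((sp G).erase d).card = k := ⟨_, rfl⟩
  have hk3 : k ≤ 3 := by rw [Finset.card_erase_of_mem hd] at hk; omega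
  let eq := ((sp G).erase d).equivFinOfCardEq hk
  let f : Fin k → V := fun i => (eq.symm i).1
  have hfi : ∀ i j, f i = f j ↔ i = j := by
    intro i j
    constructor
    · intro h; exact eq.symm.injective (Subtype.ext h)
    · rintro rfl; rfl
  have hfd : ∀ i, f i ≠ d := fun i => (Finset.mem_erase.1 (eq.symm i).2).1
  have hfd' : ∀ i, d ≠ f i := fun i => (hfd i).symm
  have hfs : ∀ v ∈ sp G, v = d ∨ ∃ i, f i = v := by
    intro v hv
    by_cases h : v = d
    · exact Or.inl h
    · right
      exact ⟨eq ⟨v, Finset.mem_erase.2 ⟨h, hv⟩⟩, by simp [f]⟩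
  let K : SimpleGraph V :=
    { Adj := fun p q => p ≠ q ∧ p ∈ sp G ∧ q ∈ sp G
      symm := ⟨fun p q h => ⟨h.1.symm, h.2.2, h.2.1⟩⟩
      loopless := ⟨fun p h => h.1 rfl⟩ }
  have hGK : G ≤ K := fun p q h => ⟨h.ne, mem_sp.2 ⟨q, h⟩, mem_sp.2 ⟨p, h.symm⟩⟩
  refine Mac.mono (G := K) ?_ hGK
  have hfS : ∀ i, f i ∈ sp G := fun i => (Finset.mem_erase.1 (eq.symm i).2).2
  let F : {p : Fin k × Fin k // p.1 < p.2} → Ch V := fun p => sg d (f p.1.1) + sg d (f p.1.2) + sg (f p.1.1) (f p.1.2)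
  have hFij : ∀ (p : {p : Fin k × Fin k // p.1 < p.2}) (i j : Fin k) (hij : i < j),
      F p s(f i, f j) = if p = ⟨(i, j), hij⟩ then 1 else 0 := by
    rintro ⟨⟨a, b⟩, hab⟩ i j hij
    simp only [F, Pi.add_apply, sg_apply, hfi, hfd, hfd', false_and, and_false, or_false, false_or, if_false, zero_add, Subtype.mk.injEq, Prod.mk.injEq]
    congr 1
    apply propext
    simp only at hab
    constructor
    · rintro (h | h)
      · exact ⟨h.1.symm, h.2.symm⟩
      · rw [h.1, h.2] at hij; exact absurd hab (not_lt.2 hij.le)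
    · rintro ⟨rfl, rfl⟩; simp
  have hFZ : ∀ p, F p ∈ Z K := by
    intro p
    have hpne : f p.1.1 ≠ f p.1.2 := by rw [Ne, hfi]; exact p.2.ne
    have key : ∀ u w, K.Adj u w → ∀ a b, ¬ K.Adj a b → sg u w s(a, b) = 0 := by
      intro u w huw a b hab
      rw [sg_apply, if_neg]
      rintro (⟨rfl, rfl⟩ | ⟨rfl, rfl⟩)
      · exact hab huw
      · exact hab huw.symm
    refine ⟨fun a b hab => ?_, fun v => ?_⟩
    · simp only [F, Pi.add_apply]
      rw [key d (f p.1.1) ⟨hfd' _, hd, hfS _⟩ a b hab, key d (f p.1.2) ⟨hfd' _, hd, hfS _⟩ a b hab,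
        key (f p.1.1) (f p.1.2) ⟨hpne, hfS _, hfS _⟩ a b hab]
      simp
    · simp only [F]
      rw [bd_add, bd_add, bd_sg (hfd' _), bd_sg (hfd' _), bd_sg hpne]
      generalize dl d v = x
      generalize dl (f p.1.1) v = y
      generalize dl (f p.1.2) v = z
      clear * -
      revert x y z; decide
  refine ⟨_, inferInstance, F, hFZ, ?_, ?_⟩
  · intro c hc
    refine ⟨fun p => c s(f p.1.1, f p.1.2), ?_⟩
    set c' := ∑ p : {p : Fin k × Fin k // p.1 < p.2}, c s(f p.1.1, f p.1.2) • F p with hc'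
    have hc'Z : c' ∈ Z K := Submodule.sum_mem _ (fun p _ => Submodule.smul_mem _ _ (hFZ p))
    have hZ : c + c' ∈ Z K := Submodule.add_mem _ hc hc'Z
    have hlt : ∀ i j, i < j → (c + c') s(f i, f j) = 0 := by
      intro i j hij
      have : c' s(f i, f j) = c s(f i, f j) := by
        rw [hc', Finset.sum_apply]
        simp only [Pi.smul_apply, hFij _ i j hij, smul_eq_mul, mul_ite, mul_one, mul_zero,
          Finset.sum_ite_eq', Finset.mem_univ, if_true]
      rw [Pi.add_apply, this, zz]
    have hff : ∀ i j, (c + c') s(f i, f j) = 0 := by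
      intro i j
      rcases lt_trichotomy i j with h | h | h
      · exact hlt i j h
      · rw [h]; exact Z_diag hZ _
      · rw [Sym2.eq_swap]; exact hlt j i h
    have hfd0 : ∀ i, (c + c') s(f i, d) = 0 := by
      intro i
      rw [← hZ.2 (f i)]
      unfold bd
      rw [Finset.sum_eq_single d]
      · intro u _ hu
        by_contra hcon
        have hadj := Z_adj hZ hcon
        rcases hfs u hadj.2.2 with h | ⟨j, rfl⟩
        · exact hu h
        · exact hcon (hff i j)
      · simp
    have h0 : c + c' = 0 := by
      ext e
      induction e using Sym2.ind with | _ a b =>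
      by_contra hcon
      have hadj := Z_adj hZ hcon
      rcases hfs a hadj.2.1 with rfl | ⟨i, rfl⟩ <;> rcases hfs b hadj.2.2 with rfl | ⟨j, rfl⟩
      · exact hadj.1 rfl
      · rw [Sym2.eq_swap] at hcon; exact hcon (hfd0 j)
      · exact hcon (hfd0 i)
      · exact hcon (hff i j)
    ext e
    have := congrFun h0 e
    simp only [Pi.add_apply, Pi.zero_apply] at this
    revert this
    generalize c e = x
    generalize c' e = y
    clear * -
    revert x y; decide
  · intro e
    have hF0 : ∀ p, F p e ≠ 0 → e = s(d, f p.1.1) ∨ e = s(d, f p.1.2) ∨ e = s(f p.1.1, f p.1.2) := by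
      intro p hp
      by_contra hcon
      push Not at hcon
      apply hp
      simp [F, sg_app, hcon]
    by_cases h1 : ∃ i, e = s(d, f i)
    · obtain ⟨i, rfl⟩ := h1
      have hsub : (univ.filter (fun p => F p s(d, f i) ≠ 0)) ⊆ univ.filter (fun p : {p : Fin k × Fin k // p.1 < p.2} => p.1.1 = i ∨ p.1.2 = i) := by
        intro p hp
        have := hF0 p (Finset.mem_filter.1 hp).2
        simp only [Sym2.eq_iff, hfd, hfd', hfi, false_and, and_false, or_false, true_and] at this
        simp only [Finset.mem_filter, Finset.mem_univ, true_and]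
        tauto
      refine (Finset.card_le_card hsub).trans ?_
      clear * - hk3
      interval_cases k
      · exact i.elim0
      · revert i; decide
      · revert i; decide
      · revert i; decide
    · push Not at h1
      refine le_trans (Finset.card_le_one.2 ?_) one_le_two
      intro p hp q hq
      have hp' := hF0 p (Finset.mem_filter.1 hp).2
      have hq' := hF0 q (Finset.mem_filter.1 hq).2
      simp only [h1, false_or] at hp' hq'
      have h2 : F p s(f q.1.1, f q.1.2) ≠ 0 := by rw [← hq']; exact (Finset.mem_filter.1 hp).2
      rw [hFij p q.1.1 q.1.2 q.2] at h2
      by_contra hpq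
      apply h2
      rw [if_neg]
      exact hpq

lemma Conn.nbr {D : SimpleGraph V} {W : Finset V} (hc : Conn D W) {u : V} (hu : u ∈ W) (h2 : 2 ≤ W.card) :
    ∃ w ∈ W, D.Adj u w := by
  have : (W \ {u}).Nonempty := by
    rw [← Finset.card_pos, Finset.card_sdiff_of_subset (by simpa using hu)]; simp; omega
  obtain ⟨a, ha, b, hb, hab⟩ := hc {u} (by simpa using hu) ⟨u, by simp⟩ this
  rw [Finset.mem_singleton] at ha
  exact ⟨b, (Finset.mem_sdiff.1 hb).1, ha ▸ hab⟩

lemma card_erase_ge (S : Finset V) (a : V) : S.card - 1 ≤ (S.erase a).card := by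
  exact Finset.pred_card_le_card_erase

/-- the difficult direction of MacLane's criterion -/
theorem planar_mac (G : SimpleGraph V) (hp : IsPlanar G) : Mac G := by
  obtain ⟨n, hn⟩ : ∃ n, (sp G).card = n := ⟨_, rfl⟩
  induction n using Nat.strong_induction_on generalizing G with
  | _ n ih0 =>
  have ih : ∀ H : SimpleGraph V, IsPlanar H → (sp H).card < (sp G).card → Mac H :=
    fun H h1 h2 => ih0 _ (by omega) H h1 rfl
  by_cases h4 : (sp G).card ≤ 4
  · exact mac_small h4
  by_contra hM
  obtain ⟨S, hS⟩ : ∃ S, S = sp G := ⟨_, rfl⟩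
  have hSa : ∀ a b, G.Adj a b → a ∈ S := fun a b h => hS ▸ mem_sp.2 ⟨b, h⟩
  have h5 : 5 ≤ S.card := by rw [hS]; omega
  have h3' : ∀ a b, a ≠ b → Conn G ((S.erase a).erase b) := by
    intro a b hab
    by_contra hc
    unfold Conn at hc
    push Not at hc
    obtain ⟨P, k1, k2, k3, k4⟩ := hc
    apply hM
    have k1' : ∀ p ∈ P, p ≠ b ∧ p ≠ a ∧ p ∈ S := fun p hp => by simpa using k1 hp
    refine mac_sep hp ih hab k2 k3 ?_ ?_ Finset.disjoint_sdiff ?_ ?_ (by simp) (by simp) ?_ k4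
    · intro p hp; rw [← hS]; exact (k1' p hp).2.2
    · intro p hp; rw [← hS]; simp at hp; tauto
    · intro h; exact (k1' a h).2.1 rfl
    · intro h; exact (k1' b h).1 rfl
    · intro v hv
      rw [← hS] at hv
      simp; tauto
  have h3 : ∀ a b, Conn G ((S.erase a).erase b) := by
    intro a b
    by_cases hab : a = b
    · subst hab
      rw [Finset.erase_eq_of_notMem (Finset.notMem_erase a S)]
      apply conn_of_erase
      · have := card_erase_ge S a; omega
      · intro b hb; exact h3' a b (Finset.mem_erase.1 hb).1.symm
    · exact h3' a b hab
  have h2 : ∀ a, Conn G (S.erase a) := by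
    intro a
    have := h3 a a
    rwa [Finset.erase_eq_of_notMem (Finset.notMem_erase a S)] at this
  have h1 : Conn G S := conn_of_erase (by omega) (fun b _ => h2 b)
  obtain ⟨x, y, hxy, hT⟩ := thomassen hSa h5 h3
  have hxS := hSa x y hxy
  have hyS := hSa y x hxy.symm
  have hne := hxy.ne
  let G' : SimpleGraph V :=
    { Adj := fun a b => a ≠ b ∧ a ≠ y ∧ b ≠ y ∧ (G.Adj a b ∨ (a = x ∧ G.Adj y b) ∨ (b = x ∧ G.Adj y a))
      symm := ⟨fun a b h => ⟨h.1.symm, h.2.2.1, h.2.1, by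
        rcases h.2.2.2 with h | h | h
        · exact Or.inl h.symm
        · exact Or.inr (Or.inr h)
        · exact Or.inr (Or.inl h)⟩⟩
      loopless := ⟨fun a h => h.1 rfl⟩ }
  have hG' : ∀ a b, G'.Adj a b ↔ a ≠ b ∧ a ≠ y ∧ b ≠ y ∧ (G.Adj a b ∨ (a = x ∧ G.Adj y b) ∨ (b = x ∧ G.Adj y a)) :=
    fun a b => Iff.rfl
  let D : SimpleGraph V :=
    { Adj := fun p q => G.Adj p q ∧ p ≠ x ∧ p ≠ y ∧ q ≠ x ∧ q ≠ y
      symm := ⟨fun p q h => ⟨h.1.symm, h.2.2.2.1, h.2.2.2.2, h.2.1, h.2.2.1⟩⟩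
      loopless := ⟨fun p h => G.loopless.irrefl p h.1⟩ }
  have hD : ∀ p q, D.Adj p q ↔ G.Adj p q ∧ p ≠ x ∧ p ≠ y ∧ q ≠ x ∧ q ≠ y := fun p q => Iff.rfl
  have hDG' : ∀ p q, D.Adj p q ↔ G'.Adj p q ∧ p ≠ x ∧ q ≠ x := by
    intro p q
    rw [hD, hG']
    have : G.Adj p q → p ≠ q := fun h => h.ne
    tauto
  have hpl : IsPlanar G' := by
    refine planar_of_wm ⟨fun v => if v = x then {x, y} else if v = y then ∅ else {v}, ?_, ?_, ?_⟩ hp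
    · intro a b v ha hb
      simp only at ha hb
      split_ifs at ha hb <;> simp_all
    · intro a
      simp only
      split_ifs
      · have := (conn_singleton G x).union (conn_singleton G y) ⟨x, by simp, y, by simp, Or.inl hxy⟩
        have e : ({x, y} : Finset V) = {x} ∪ {y} := by ext; simp
        rw [e]; exact this
      · intro P hP hP2; exfalso
        obtain ⟨z, hz⟩ := hP2
        simpa using hP hz
      · exact conn_singleton _ _
    · intro a b hab
      obtain ⟨q1, q2, q3, q4⟩ := (hG' a b).1 hab
      have hself : ∀ v, v ≠ y → v ∈ (if v = x then ({x, y} : Finset V) else if v = y then ∅ else {v}) := by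
        intro v hv
        split_ifs with h
        · simp [h]
        · simp
      rcases q4 with h | ⟨rfl, h⟩ | ⟨rfl, h⟩
      · exact ⟨a, hself a q2, b, hself b q3, h⟩
      · exact ⟨y, by simp, b, hself b q3, h⟩
      · exact ⟨a, hself a q2, y, by simp, h.symm⟩
  have hsub : sp G' ⊆ S.erase y := by
    intro a ha
    obtain ⟨b, hb⟩ := mem_sp.1 ha
    obtain ⟨q1, q2, q3, q4⟩ := (hG' a b).1 hb
    refine Finset.mem_erase.2 ⟨q2, ?_⟩
    rcases q4 with h | ⟨rfl, h⟩ | ⟨rfl, h⟩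
    · exact hSa a b h
    · exact hxS
    · exact hSa a y h.symm
  have hlt : (sp G').card < (sp G).card := by
    rw [← hS]
    exact lt_of_le_of_lt (Finset.card_le_card hsub) (Finset.card_erase_lt_of_mem hyS)
  obtain ⟨ι, _, F, hF⟩ := (ih G' hpl hlt).sys
  -- connectivity transfer
  have cA : ∀ W : Finset V, Conn G W → x ∈ W → y ∈ W → Conn G' (W.erase y) := by
    intro W hW hxW hyW P hP ⟨p, hp⟩ ⟨q, hq⟩
    simp only [Finset.mem_sdiff, Finset.mem_erase] at hq
    have hP' : ∀ p ∈ P, p ≠ y ∧ p ∈ W := fun p hp => by simpa using hP hp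
    by_cases hxP : x ∈ P
    · obtain ⟨a, ha, b, hb, hab⟩ := hW (insert y P) (by
        intro z hz
        rcases Finset.mem_insert.1 hz with rfl | hz
        · exact hyW
        · exact (hP' z hz).2) ⟨y, by simp⟩ ⟨q, by simp; tauto⟩
      simp only [Finset.mem_sdiff, Finset.mem_insert, not_or] at ha hb
      have hbx : b ≠ x := by rintro rfl; exact hb.2.2 hxP
      rcases ha with rfl | ha
      · exact ⟨x, hxP, b, by simp; tauto, (hG' _ _).2 ⟨hbx.symm, hne, hb.2.1, Or.inr (Or.inl ⟨rfl, hab⟩)⟩⟩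
      · exact ⟨a, ha, b, by simp; tauto, (hG' _ _).2 ⟨hab.ne, (hP' a ha).1, hb.2.1, Or.inl hab⟩⟩
    · obtain ⟨a, ha, b, hb, hab⟩ := hW P (fun z hz => (hP' z hz).2) ⟨p, hp⟩ ⟨q, by simp; tauto⟩
      simp only [Finset.mem_sdiff] at hb
      by_cases hby : b = y
      · subst hby
        refine ⟨a, ha, x, by simp; tauto, (hG' _ _).2 ⟨?_, (hP' a ha).1, hne, Or.inr (Or.inr ⟨rfl, hab.symm⟩)⟩⟩
        rintro rfl; exact hxP ha
      · exact ⟨a, ha, b, by simp; tauto, (hG' _ _).2 ⟨hab.ne, (hP' a ha).1, hby, Or.inl hab⟩⟩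
  have cD : ∀ W : Finset V, Conn G W → x ∉ W → y ∉ W → Conn D W := by
    intro W hW hx hy P hP hP1 hP2
    obtain ⟨a, ha, b, hb, hab⟩ := hW P hP hP1 hP2
    have haW := hP ha
    have hbW := (Finset.mem_sdiff.1 hb).1
    refine ⟨a, ha, b, hb, hab, ?_, ?_, ?_, ?_⟩ <;> rintro rfl <;> contradiction
  have hDle : D ≤ G' := fun p q h => ((hDG' p q).1 h).1
  have hTG' : TC G' (S.erase y) := by
    refine ⟨fun a b h => hsub (mem_sp.2 ⟨b, h⟩), cA S h1 hxS hyS, ?_⟩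
    intro v
    by_cases hvy : v = y
    · rw [hvy, Finset.erase_eq_of_notMem (Finset.notMem_erase y S)]
      exact cA S h1 hxS hyS
    · by_cases hvx : v = x
      · rw [hvx]
        exact (cD _ (h3 y x) (by simp) (by simp)).mono hDle
      · rw [Finset.erase_right_comm]
        exact cA _ (h2 v) (by simp [hxS, Ne.symm hvx]) (by simp [hyS, Ne.symm hvy])
  have hTD : TC D ((S.erase y).erase x) := by
    refine ⟨fun a b h => ?_, cD _ (h3 y x) (by simp) (by simp), fun w => ?_⟩
    · simp [h.2.1, h.2.2.1, hSa a b h.1]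
    · rw [Finset.erase_right_comm (a := y)]
      exact cD _ (hT w) (by simp) (by simp)
  have hc3 : 3 ≤ ((S.erase y).erase x).card := by
    have a1 := card_erase_ge S y
    have a2 := card_erase_ge (S.erase y) x
    omega
  have hdeg : ∀ u v, u ∈ S → u ≠ v → ∃ p q, p ≠ q ∧ p ≠ v ∧ q ≠ v ∧ G.Adj u p ∧ G.Adj u q := by
    intro u v hu huv
    obtain ⟨p, hpm, hup⟩ := (h2 v).nbr (u := u) (by simp [hu, huv]) (by have := card_erase_ge S v; omega)
    obtain ⟨q, hqm, huq⟩ := (h3 v p).nbr (u := u) (by simp [hu, huv, hup.ne]) (by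
      have a1 := card_erase_ge S v
      have a2 := card_erase_ge (S.erase v) p
      omega)
    simp only [Finset.mem_erase] at hpm hqm
    exact ⟨p, q, hqm.1.symm, hpm.1, hqm.2.1, hup, huq⟩
  obtain ⟨px, qx, x1, x2, x3, x4, x5⟩ := hdeg x y hxS hne
  obtain ⟨c, m, g, hSt, hC, hon⟩ := star_out hF hTG' hTD hc3 hDG' ⟨px, (hG' _ _).2 ⟨x4.ne, hne, x2, Or.inl x4⟩⟩
  apply hM
  refine wheel_mac hp hC hxy hSt hD ?_ ?_ ⟨px, qx, x1, x2, x3, x4, x5⟩ (hdeg y x hyS hne.symm)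
  · intro u hu huy
    obtain ⟨j, _, hj⟩ := hon u ((hG' _ _).2 ⟨hu.ne, hne, huy, Or.inl hu⟩)
    exact ⟨j, hj⟩
  · intro u hu hux
    obtain ⟨j, _, hj⟩ := hon u ((hG' _ _).2 ⟨hux.symm, hne, hu.ne', Or.inr (Or.inl ⟨rfl, hu⟩)⟩)
    exact ⟨j, hj⟩

end P5e
end T6

open SimpleGraph

namespace T6
section P6a
set_option linter.unusedSectionVars false
set_option linter.unusedSimpArgs false
open scoped Classical
open Finset
variable {V : Type*} [Fintype V]

/-- length of a chain -/
noncomputable def len (c : Ch V) : ℕ := (univ.filter (fun e => c e ≠ 0)).card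

/-- the situation of a minimal counterexample -/
structure Ctx (H : SimpleGraph V) (U : Finset V) {ι : Type} [Fintype ι] (F : ι → Ch V) : Prop where
  sys : Sys H F
  tc : TC H U
  big : 6 ≤ U.card
  free : ¬ HasTheta6 H
  pl : IsPlanar H
  deg : ∀ u ∈ U, ∀ p q, (∀ w, H.Adj u w → w = p ∨ w = q) → False
  pair : ∀ u v, H.Adj u v → ∀ p q r s, (∀ w, H.Adj u w → w = v ∨ w = p ∨ w = q) →
    (∀ w, H.Adj v w → w = u ∨ w = r ∨ w = s) → False

lemma Cyc.len {c : Ch V} {m : ℕ} {g : ℕ → V} (h : Cyc c m g) : len c = m := by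
  unfold T6.len
  have : univ.filter (fun e => c e ≠ 0) = (range m).image (fun j => s(g j, g (j + 1))) := by
    ext e
    simp only [Finset.mem_filter, Finset.mem_univ, true_and, Finset.mem_image, Finset.mem_range, h.apply]
    constructor
    · rintro ⟨j, hj, he⟩; exact ⟨j, hj, he.symm⟩
    · rintro ⟨j, hj, he⟩; exact ⟨j, hj, he.symm⟩
  rw [this, Finset.card_image_of_injOn, Finset.card_range]
  intro i hi j hj hij
  simp only [Finset.coe_range, Set.mem_Iio] at hi hj
  exact h.edge_inj i j hi hj hij

/-- an element of the cycle space with at most two edges vanishes -/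
lemma Z_small {G : SimpleGraph V} {c : Ch V} (hc : c ∈ Z G) (h : len c ≤ 2) : c = 0 := by
  by_contra h0
  obtain ⟨c1, m, g, hC, hs⟩ := exists_cyc hc h0
  have h1 := hC.len
  have h2 := hC.three
  have : len c1 ≤ len c := by
    apply Finset.card_le_card
    intro e he
    simp only [Finset.mem_filter, Finset.mem_univ, true_and] at he ⊢
    exact hs e he
  omega

/-- triangle chains -/
def Tri (c : Ch V) (x y z : V) : Prop := x ≠ y ∧ y ≠ z ∧ x ≠ z ∧ c = sg x y + sg y z + sg x z

lemma sg_comm (x y : V) : sg x y = sg y x := by unfold sg; rw [Sym2.eq_swap]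

lemma Tri.rot {c : Ch V} {x y z : V} (h : Tri c x y z) : Tri c y z x := by
  obtain ⟨h1, h2, h3, rfl⟩ := h
  refine ⟨h2, h3.symm, h1.symm, ?_⟩
  rw [sg_comm z x, sg_comm y x]; abel

lemma Tri.swap {c : Ch V} {x y z : V} (h : Tri c x y z) : Tri c y x z := by
  obtain ⟨h1, h2, h3, rfl⟩ := h
  refine ⟨h1.symm, h3, h2, ?_⟩
  rw [sg_comm x y]; abel

lemma Tri.iff {c : Ch V} {x y z : V} (h : Tri c x y z) (e : Sym2 V) :
    c e ≠ 0 ↔ e = s(x, y) ∨ e = s(y, z) ∨ e = s(x, z) := by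
  obtain ⟨h1, h2, h3, rfl⟩ := h
  have e1 : s(x, y) ≠ s(y, z) := by simp [Sym2.eq_iff]; tauto
  have e2 : s(x, y) ≠ s(x, z) := by simp [Sym2.eq_iff]; tauto
  have e3 : s(y, z) ≠ s(x, z) := by simp [Sym2.eq_iff]; tauto
  simp only [Pi.add_apply, sg_app]
  by_cases a1 : e = s(x, y)
  · subst a1; simp [e1, e2]
  · by_cases a2 : e = s(y, z)
    · subst a2; simp [e1.symm, e3]
    · by_cases a3 : e = s(x, z)
      · subst a3; simp [e2.symm, e3.symm]
      · simp [a1, a2, a3]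

lemma Cyc.tri {c : Ch V} {g : ℕ → V} (h : Cyc c 3 g) : Tri c (g 0) (g 1) (g 2) := by
  refine ⟨?_, ?_, ?_, ?_⟩
  · intro h1; have := h.inj 0 1 (by omega) (by omega) h1; omega
  · intro h1; have := h.inj 1 2 (by omega) (by omega) h1; omega
  · intro h1; have := h.inj 0 2 (by omega) (by omega) h1; omega
  · rw [h.eq]
    simp only [Finset.sum_range_succ, Finset.sum_range_zero, zero_add, Nat.reduceAdd]
    have : g 3 = g 0 := h.per 0
    rw [this, sg_comm (g 2) (g 0)]

/-- normal form: a triangle containing a given edge -/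
lemma Tri.edge {c : Ch V} {x y z a b : V} (h : Tri c x y z) (hab : c s(a, b) ≠ 0) : ∃ d, Tri c a b d := by
  rw [h.iff] at hab
  simp only [Sym2.eq_iff] at hab
  rcases hab with (⟨rfl, rfl⟩ | ⟨rfl, rfl⟩) | (⟨rfl, rfl⟩ | ⟨rfl, rfl⟩) | (⟨rfl, rfl⟩ | ⟨rfl, rfl⟩)
  · exact ⟨_, h⟩
  · exact ⟨_, h.swap⟩
  · exact ⟨_, h.rot⟩
  · exact ⟨_, h.rot.swap⟩
  · exact ⟨_, h.rot.rot.swap⟩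
  · exact ⟨_, h.rot.rot⟩

lemma th6 {H : SimpleGraph V} (hf : ¬ HasTheta6 H) {a b c d e f : V}
    (hnd : [a, b, c, d, e, f].Nodup) (h1 : H.Adj a b) (h2 : H.Adj b c) (h3 : H.Adj c d) (h4 : H.Adj d e)
    (h5 : H.Adj e f) (h6 : H.Adj f a) (hch : H.Adj a c ∨ H.Adj a d ∨ H.Adj a e ∨ H.Adj b d ∨ H.Adj b e ∨ H.Adj b f
      ∨ H.Adj c e ∨ H.Adj c f ∨ H.Adj d f) : False := by
  apply hf
  refine ⟨![a, b, c, d, e, f], ?_, ?_, ?_⟩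
  · have : (![a, b, c, d, e, f] : Fin 6 → V) = fun i => [a, b, c, d, e, f].get i := by
      funext i; fin_cases i <;> rfl
    rw [this]; exact List.nodup_iff_injective_get.1 hnd
  · intro i; fin_cases i
    · exact h1
    · exact h2
    · exact h3
    · exact h4
    · exact h5
    · exact h6
  · rcases hch with h | h | h | h | h | h | h | h | h
    · exact ⟨0, 2, by decide, by decide, by decide, h⟩
    · exact ⟨0, 3, by decide, by decide, by decide, h⟩
    · exact ⟨0, 4, by decide, by decide, by decide, h⟩
    · exact ⟨1, 3, by decide, by decide, by decide, h⟩
    · exact ⟨1, 4, by decide, by decide, by decide, h⟩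
    · exact ⟨1, 5, by decide, by decide, by decide, h⟩
    · exact ⟨2, 4, by decide, by decide, by decide, h⟩
    · exact ⟨2, 5, by decide, by decide, by decide, h⟩
    · exact ⟨3, 5, by decide, by decide, by decide, h⟩

variable {H : SimpleGraph V} {U : Finset V} {ι : Type} [Fintype ι] {F : ι → Ch V}

lemma Ctx.two (C : Ctx H U F) {a b : V} (hab : H.Adj a b) : (univ.filter (fun i => F i s(a, b) ≠ 0)).card = 2 := by
  have : ∃ w, H.Adj a w ∧ b ≠ w := by
    by_contra hcon
    push Not at hcon
    exact C.deg a (C.tc.supp a b hab) b b (fun w hw => Or.inl (hcon w hw).symm)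
  obtain ⟨w, hw, hbw⟩ := this
  exact star_two C.sys (C.tc.pair a) hab hw hbw

lemma Ctx.three (C : Ctx H U F) {i j k : ι} (hij : i ≠ j) (hjk : j ≠ k) (hik : i ≠ k) {e : Sym2 V}
    (h1 : F i e ≠ 0) (h2 : F j e ≠ 0) (h3 : F k e ≠ 0) : False := by
  have h := C.sys.le2 e
  have hs : ({i, j, k} : Finset ι) ⊆ univ.filter (fun i => F i e ≠ 0) := by
    intro x hx
    simp only [Finset.mem_insert, Finset.mem_singleton] at hx
    rcases hx with rfl | rfl | rfl <;> simp [h1, h2, h3]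
  have h2 := Finset.card_le_card hs
  rw [Finset.card_eq_three.2 ⟨i, j, k, hij, hik, hjk, rfl⟩] at h2
  omega

lemma Ctx.star (C : Ctx H U F) (R : Finset ι) {v : V} (hR : ∀ u, (∑ i ∈ R, F i) s(v, u) = 0) {i0 : ι} (h0 : i0 ∈ R)
    {u0 : V} (hu0 : F i0 s(v, u0) ≠ 0) : ∀ i u, F i s(v, u) ≠ 0 → i ∈ R := by
  rcases star_rel C.sys (C.tc.pair v) R (fun u => by simpa [Finset.sum_apply] using hR u) with h | h
  · exact fun i u hi => h i ⟨u, hi⟩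
  · exact absurd h0 (h i0 ⟨u0, hu0⟩)

lemma Ctx.face (C : Ctx H U F) {a b : V} (hab : H.Adj a b) : ∃ i, F i s(a, b) ≠ 0 := by
  have h := C.two hab
  obtain ⟨i, hi⟩ := Finset.card_pos.1 (by omega : 0 < (univ.filter (fun i => F i s(a, b) ≠ 0)).card)
  exact ⟨i, (Finset.mem_filter.1 hi).2⟩

lemma Ctx.star_edge (C : Ctx H U F) (R : Finset ι) {v : V} (hR : ∀ u, (∑ i ∈ R, F i) s(v, u) = 0) {i0 : ι} (h0 : i0 ∈ R)
    {u0 : V} (hu0 : F i0 s(v, u0) ≠ 0) : ∀ w, H.Adj v w → ∃ i ∈ R, F i s(v, w) ≠ 0 := by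
  intro w hw
  obtain ⟨i, hi⟩ := C.face hw
  exact ⟨i, C.star R hR h0 hu0 i w hi, hi⟩

lemma Ctx.all (C : Ctx H U F) (R : Finset ι) (hR : ∑ i ∈ R, F i = 0) {i0 : ι} (h0 : i0 ∈ R) (hi0 : F i0 ≠ 0) :
    ∀ i, F i ≠ 0 → i ∈ R := by
  rcases C.sys.zero_sum C.tc R (by
    intro e i hi j hj hie
    by_contra hje
    have h1 := congrFun hR e
    rw [Finset.sum_apply, sum_eq_card, Pi.zero_apply, ZMod.natCast_eq_zero_iff] at h1
    have h2 := C.sys.le2 e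
    have h3 : insert j (R.filter (fun i => F i e ≠ 0)) ⊆ univ.filter (fun i => F i e ≠ 0) := by
      intro x hx
      rcases Finset.mem_insert.1 hx with rfl | hx
      · simp [hje]
      · simp [(Finset.mem_filter.1 hx).2]
    have h4 := Finset.card_le_card h3
    rw [Finset.card_insert_of_notMem (by simp [hj])] at h4
    have h5 : 0 < (R.filter (fun i => F i e ≠ 0)).card := Finset.card_pos.2 ⟨i, by simp [hi, hie]⟩
    omega) with h | h
  · exact h
  · exact absurd h0 (h i0 hi0)

/-- a family of faces with zero sum touches all of `U` -/
lemma Ctx.all_vert (C : Ctx H U F) (R : Finset ι) (hR : ∑ i ∈ R, F i = 0) {i0 : ι} (h0 : i0 ∈ R) (hi0 : F i0 ≠ 0)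
    (W : Finset V) (hW : ∀ i ∈ R, ∀ a b, F i s(a, b) ≠ 0 → a ∈ W) : U ⊆ W := by
  intro u hu
  have hex : ∃ w, H.Adj u w := by
    by_contra hcon
    push Not at hcon
    exact C.deg u hu u u (fun w hw => absurd hw (hcon w))
  obtain ⟨w, hw⟩ := hex
  obtain ⟨i, hi⟩ := C.face hw
  exact hW i (C.all R hR h0 hi0 i (fun h => hi (by rw [h]; rfl))) u w hi

/-- distinct nonzero faces are different chains -/
lemma Ctx.inj_tri (C : Ctx H U F) {i j : ι} (hij : i ≠ j) {a b c : V} (hi : Tri (F i) a b c) : F i ≠ F j := by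
  intro h
  have := C.all_vert {i, j} (by rw [Finset.sum_pair hij, ← h]; ext e; exact zz _) (i0 := i) (by simp)
    (by intro h0
        have := (hi.iff s(a, b)).2 (Or.inl rfl)
        rw [h0] at this; exact this rfl) {a, b, c} (by
      intro k hk p q hpq
      have hpq : F i s(p, q) ≠ 0 := by
        simp only [Finset.mem_insert, Finset.mem_singleton] at hk
        rcases hk with rfl | rfl
        · exact hpq
        · rw [h]; exact hpq
      rw [hi.iff] at hpq
      simp only [Sym2.eq_iff] at hpq
      simp; tauto)
  have h1 := Finset.card_le_card this
  have h2 := C.big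
  have h3 : ({a, b, c} : Finset V).card ≤ 3 := Finset.card_le_three
  omega

/-- two distinct triangular faces with a common edge have different apexes -/
lemma Ctx.apex (C : Ctx H U F) {i j : ι} (hij : i ≠ j) {a b c d : V} (hi : Tri (F i) a b c) (hj : Tri (F j) a b d) :
    c ≠ d := by
  rintro rfl
  exact C.inj_tri hij hi (by rw [hi.2.2.2, hj.2.2.2])

lemma Ctx.adj (C : Ctx H U F) {i : ι} {a b : V} (h : F i s(a, b) ≠ 0) : H.Adj a b := Z_adj (C.sys.mem i) h

lemma Ctx.tadj (C : Ctx H U F) {i : ι} {a b c : V} (h : Tri (F i) a b c) : H.Adj a b ∧ H.Adj b c ∧ H.Adj a c :=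
  ⟨C.adj ((h.iff _).2 (Or.inl rfl)), C.adj ((h.iff _).2 (Or.inr (Or.inl rfl))), C.adj ((h.iff _).2 (Or.inr (Or.inr rfl)))⟩

/-- graph on triangular faces -/
def TG (F : ι → Ch V) : SimpleGraph ι where
  Adj i j := i ≠ j ∧ len (F i) = 3 ∧ len (F j) = 3 ∧ ∃ e, F i e ≠ 0 ∧ F j e ≠ 0
  symm := ⟨fun i j h => ⟨h.1.symm, h.2.2.1, h.2.1, by obtain ⟨e, h1, h2⟩ := h.2.2.2; exact ⟨e, h2, h1⟩⟩⟩
  loopless := ⟨fun i h => h.1 rfl⟩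

lemma Ctx.cyc (C : Ctx H U F) {i : ι} (h : F i ≠ 0) : ∃ g, Cyc (F i) (len (F i)) g := by
  obtain ⟨m, g, hC⟩ := C.sys.cyc C.tc i h
  exact ⟨g, hC.len ▸ hC⟩

lemma Ctx.tri (C : Ctx H U F) {i : ι} (h : len (F i) = 3) : ∃ a b c, Tri (F i) a b c := by
  obtain ⟨g, hg⟩ := C.cyc (i := i) (by intro h0; rw [h0] at h; simp [len] at h)
  rw [h] at hg
  exact ⟨_, _, _, hg.tri⟩

end P6a
end T6

open SimpleGraph

namespace T6
section P6b
set_option linter.unusedSectionVars false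
set_option linter.unusedSimpArgs false
open scoped Classical
open Finset
variable {V : Type*} [Fintype V]
variable {H : SimpleGraph V} {U : Finset V} {ι : Type} [Fintype ι] {F : ι → Ch V}

/-- a component of the graph of triangular faces -/
structure Comp (F : ι → Ch V) (K : Finset ι) : Prop where
  ne : K.Nonempty
  conn : Conn (TG F) K
  closed : ∀ i ∈ K, ∀ j, (TG F).Adj i j → j ∈ K
  three : ∀ i ∈ K, len (F i) = 3

/-- all faces of `K` live on `W` -/
def Inside (F : ι → Ch V) (K : Finset ι) (W : Finset V) : Prop :=
  ∀ i ∈ K, ∀ a b, F i s(a, b) ≠ 0 → a ∈ W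

lemma Tri.inside {c : Ch V} {x y z : V} (h : Tri c x y z) {W : Finset V} (hx : x ∈ W) (hy : y ∈ W) (hz : z ∈ W) :
    ∀ a b, c s(a, b) ≠ 0 → a ∈ W := by
  intro a b hab
  rw [h.iff] at hab
  simp only [Sym2.eq_iff] at hab
  rcases hab with (⟨rfl, rfl⟩ | ⟨rfl, rfl⟩) | (⟨rfl, rfl⟩ | ⟨rfl, rfl⟩) | (⟨rfl, rfl⟩ | ⟨rfl, rfl⟩) <;> assumption

lemma Tri.outside {c : Ch V} {x y z : V} (h : Tri c x y z) {W : Finset V} (hW : ∀ a b, c s(a, b) ≠ 0 → a ∈ W) :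
    x ∈ W ∧ y ∈ W ∧ z ∈ W :=
  ⟨hW x y ((h.iff _).2 (Or.inl rfl)), hW y z ((h.iff _).2 (Or.inr (Or.inl rfl))),
    hW z y ((h.iff _).2 (Or.inr (Or.inl (by rw [Sym2.eq_swap]))))⟩

lemma Tri.e1 {c : Ch V} {x y z : V} (h : Tri c x y z) : c s(x, y) ≠ 0 := (h.iff _).2 (Or.inl rfl)

lemma Comp.grow (C : Ctx H U F) {K : Finset ι} (hK : Comp F K) {W : Finset V} {i0 : ι} (hi0 : i0 ∈ K)
    (h0 : ∀ a b, F i0 s(a, b) ≠ 0 → a ∈ W) (hW : ¬ Inside F K W) :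
    ∃ i ∈ K, ∃ j ∈ K, i ≠ j ∧ ∃ x y z w, Tri (F i) x y z ∧ Tri (F j) x y w ∧ x ∈ W ∧ y ∈ W ∧ z ∈ W ∧ w ∉ W := by
  have hex : ∃ j0 ∈ K, ¬ ∀ a b, F j0 s(a, b) ≠ 0 → a ∈ W := by
    by_contra hcon
    push Not at hcon
    exact hW (fun i hi a b hab => hcon i hi a b hab)
  obtain ⟨j0, hj0, hj0'⟩ := hex
  obtain ⟨i, hi, j, hj, hij⟩ := hK.conn (K.filter (fun i => ∀ a b, F i s(a, b) ≠ 0 → a ∈ W)) (Finset.filter_subset _ _)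
    ⟨i0, by simp only [Finset.mem_filter]; exact ⟨hi0, h0⟩⟩
    ⟨j0, by simp only [Finset.mem_sdiff, Finset.mem_filter]; exact ⟨hj0, fun h => hj0' h.2⟩⟩
  simp only [Finset.mem_sdiff, Finset.mem_filter, not_and] at hi hj
  have hjW := hj.2 hj.1
  obtain ⟨hne, hl1, hl2, e, he1, he2⟩ := hij
  obtain ⟨a, b, c, ht1⟩ := C.tri hl1
  obtain ⟨a', b', c', ht2⟩ := C.tri hl2
  induction e using Sym2.ind with | _ x y =>
  obtain ⟨z, hz⟩ := ht1.edge he1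
  obtain ⟨w, hw⟩ := ht2.edge he2
  obtain ⟨o1, o2, o3⟩ := hz.outside hi.2
  exact ⟨i, hi.1, j, hj.1, hne, x, y, z, w, hz, hw, o1, o2, o3, fun hwW => hjW (hw.inside o1 o2 hwW)⟩

lemma pent (hf : ¬ HasTheta6 H) {p q r s t w x y : V} (hnd : [p, q, r, s, t].Nodup) (h1 : H.Adj p q) (h2 : H.Adj q r)
    (h3 : H.Adj r s) (h4 : H.Adj s t) (h5 : H.Adj t p) (hw : w ∉ ({p, q, r, s, t} : Finset V))
    (hx : H.Adj x w) (hy : H.Adj y w)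
    (hxy : s(x, y) = s(p, q) ∨ s(x, y) = s(q, r) ∨ s(x, y) = s(r, s) ∨ s(x, y) = s(s, t) ∨ s(x, y) = s(t, p)) : False := by
  have key : ∀ p q r s t : V, [p, q, r, s, t].Nodup → H.Adj p q → H.Adj q r → H.Adj r s → H.Adj s t → H.Adj t p →
      w ∉ ({p, q, r, s, t} : Finset V) → s(x, y) = s(p, q) → False := by
    intro p q r s t hnd h1 h2 h3 h4 h5 hw hxy
    have hpw : H.Adj p w ∧ H.Adj q w := by
      rcases Sym2.eq_iff.1 hxy with ⟨rfl, rfl⟩ | ⟨rfl, rfl⟩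
      · exact ⟨hx, hy⟩
      · exact ⟨hy, hx⟩
    refine th6 hf (a := p) (b := w) (c := q) (d := r) (e := s) (f := t) ?_ hpw.1 hpw.2.symm h2 h3 h4 h5 (Or.inl h1)
    simp only [List.nodup_cons, List.mem_cons, List.not_mem_nil, or_false, not_or, Finset.mem_insert,
      Finset.mem_singleton, not_false_eq_true, List.nodup_nil, and_true] at hnd hw ⊢
    clear * - hnd hw
    grind
  have pr : ∀ {p q r s t : V}, [p, q, r, s, t].Nodup → [q, r, s, t, p].Nodup := by
    intro p q r s t h; simp at h ⊢; clear * - h; grind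
  have pw : ∀ {p q r s t : V}, w ∉ ({p, q, r, s, t} : Finset V) → w ∉ ({q, r, s, t, p} : Finset V) := by
    intro p q r s t h; simp at h ⊢; clear * - h; grind
  rcases hxy with h | h | h | h | h
  · exact key _ _ _ _ _ hnd h1 h2 h3 h4 h5 hw h
  · exact key _ _ _ _ _ (pr hnd) h2 h3 h4 h5 h1 (pw hw) h
  · exact key _ _ _ _ _ (pr (pr hnd)) h3 h4 h5 h1 h2 (pw (pw hw)) h
  · exact key _ _ _ _ _ (pr (pr (pr hnd))) h4 h5 h1 h2 h3 (pw (pw (pw hw))) h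
  · exact key _ _ _ _ _ (pr (pr (pr (pr hnd)))) h5 h1 h2 h3 h4 (pw (pw (pw (pw hw)))) h

lemma growA (C : Ctx H U F) {i j l l' : ι} {a b c d e x y w : V} (hij : i ≠ j)
    (hi : Tri (F i) b c a) (hj : Tri (F j) b c d) (hl : Tri (F l) a b e) (hl' : Tri (F l') x y w)
    (hnd : [a, b, c, d, e].Nodup) (hx : x ∈ ({a, b, c, d, e} : Finset V)) (hy : y ∈ ({a, b, c, d, e} : Finset V))
    (hw : w ∉ ({a, b, c, d, e} : Finset V)) : False := by
  obtain ⟨bc, ca, ba⟩ := C.tadj hi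
  obtain ⟨_, cd, bd⟩ := C.tadj hj
  obtain ⟨_, be, ae⟩ := C.tadj hl
  obtain ⟨xy, yw, xw⟩ := C.tadj hl'
  have hxy := hl'.1
  have ne : ∀ (k : ι) (p q r : V), Tri (F k) p q r → p ∈ ({a, b, c, d, e} : Finset V) →
      q ∈ ({a, b, c, d, e} : Finset V) → r ∈ ({a, b, c, d, e} : Finset V) → k ≠ l' := by
    rintro k p q r hk hp hq hr rfl
    exact hw (hl'.outside (hk.inside hp hq hr)).2.2
  have n1 := ne i b c a hi (by simp) (by simp) (by simp)
  have n2 := ne j b c d hj (by simp) (by simp) (by simp)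
  have n3 := ne l a b e hl (by simp) (by simp) (by simp)
  have nil : i ≠ l := by
    rintro rfl
    have := (hl.outside (hi.inside (W := {b, c, a}) (by simp) (by simp) (by simp))).2.2
    simp at this hnd; clear * - this hnd; grind
  have b1 : s(x, y) ≠ s(b, c) := by
    intro h
    have := hl'.e1; rw [h] at this
    exact C.three hij n2 n1 hi.e1 hj.e1 this
  have b2 : s(x, y) ≠ s(a, b) := by
    intro h
    have := hl'.e1; rw [h] at this
    refine C.three nil n3 n1 (e := s(a, b)) hi.rot.rot.e1 hl.e1 this
  have q1 := pent C.free (p := b) (q := d) (r := c) (s := a) (t := e) (w := w) (x := x) (y := y)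
    (by simp at hnd ⊢; clear * - hnd; grind) bd cd.symm ca ae be.symm (by simp at hw ⊢; clear * - hw; grind) xw yw
  have ae' := ae.symm
  have ba' := ba.symm
  have bd' := bd.symm
  have s1 : ∀ u v : V, s(u, v) = s(v, u) := fun u v => Sym2.eq_swap
  -- remaining pairs give explicit hexagons
  simp only [Finset.mem_insert, Finset.mem_singleton] at hx hy
  have q2 : s(x, y) = s(d, a) → False := fun h => by
    have had : H.Adj d a := by
      rcases Sym2.eq_iff.1 h with ⟨rfl, rfl⟩ | ⟨rfl, rfl⟩
      exacts [xy, xy.symm]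
    exact pent C.free (p := d) (q := a) (r := e) (s := b) (t := c) (w := w) (x := x) (y := y)
      (by simp at hnd ⊢; clear * - hnd; grind) had ae be.symm bc cd (by simp at hw ⊢; clear * - hw; grind) xw yw (Or.inl h)
  have q3 : s(x, y) = s(d, e) → False := fun h => by
    have had : H.Adj d e := by
      rcases Sym2.eq_iff.1 h with ⟨rfl, rfl⟩ | ⟨rfl, rfl⟩
      exacts [xy, xy.symm]
    exact pent C.free (p := d) (q := e) (r := a) (s := c) (t := b) (w := w) (x := x) (y := y)
      (by simp at hnd ⊢; clear * - hnd; grind) had ae.symm ca.symm bc.symm bd (by simp at hw ⊢; clear * - hw; grind) xw yw (Or.inl h)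
  have q4 : s(x, y) = s(c, e) → False := fun h => by
    have had : H.Adj c e := by
      rcases Sym2.eq_iff.1 h with ⟨rfl, rfl⟩ | ⟨rfl, rfl⟩
      exacts [xy, xy.symm]
    exact pent C.free (p := c) (q := e) (r := a) (s := b) (t := d) (w := w) (x := x) (y := y)
      (by simp at hnd ⊢; clear * - hnd; grind) had ae.symm ba.symm bd cd.symm (by simp at hw ⊢; clear * - hw; grind) xw yw (Or.inl h)
  clear * - hx hy hxy b1 b2 q1 q2 q3 q4
  simp only [ne_eq, Sym2.eq_iff] at b1 b2 q1 q2 q3 q4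
  rcases hx with rfl | rfl | rfl | rfl | rfl <;> rcases hy with rfl | rfl | rfl | rfl | rfl <;> simp at *

lemma growB (C : Ctx H U F) {i j k l l' : ι} {a b c d e z x y w : V}
    (hi : Tri (F i) b c a) (hj : Tri (F j) b c d) (hk : Tri (F k) a d z) (hl : Tri (F l) a d e) (hl' : Tri (F l') x y w)
    (hnd : [a, b, c, d, e].Nodup) (hz : z ∈ ({a, b, c, d} : Finset V))
    (hx : x ∈ ({a, b, c, d, e} : Finset V)) (hy : y ∈ ({a, b, c, d, e} : Finset V))
    (hw : w ∉ ({a, b, c, d, e} : Finset V)) : False := by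
  obtain ⟨bc, ca, ba⟩ := C.tadj hi
  obtain ⟨_, cd, bd⟩ := C.tadj hj
  obtain ⟨ad, de, ae⟩ := C.tadj hl
  obtain ⟨xy, yw, xw⟩ := C.tadj hl'
  have hxy := hl'.1
  have ne : ∀ (k : ι) (p q r : V), Tri (F k) p q r → p ∈ ({a, b, c, d, e} : Finset V) →
      q ∈ ({a, b, c, d, e} : Finset V) → r ∈ ({a, b, c, d, e} : Finset V) → k ≠ l' := by
    rintro k p q r hk hp hq hr rfl
    exact hw (hl'.outside (hk.inside hp hq hr)).2.2
  have n1 := ne k a d z hk (by simp) (by simp) (by simp at hz ⊢; tauto)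
  have n3 := ne l a d e hl (by simp) (by simp) (by simp)
  have nil : k ≠ l := by
    rintro rfl
    have := (hl.outside (hk.inside (W := {a, b, c, d}) (by simp) (by simp) hz)).2.2
    simp at this hnd; clear * - this hnd; grind
  have b1 : s(x, y) ≠ s(a, d) := by
    intro h
    have := hl'.e1; rw [h] at this
    exact C.three nil n3 n1 hk.e1 hl.e1 this
  have q1 := pent C.free (p := e) (q := a) (r := b) (s := c) (t := d) (w := w) (x := x) (y := y)
    (by simp at hnd ⊢; clear * - hnd; grind) ae.symm ba.symm bc cd de (by simp at hw ⊢; clear * - hw; grind) xw yw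
  have q2 := pent C.free (p := e) (q := a) (r := c) (s := b) (t := d) (w := w) (x := x) (y := y)
    (by simp at hnd ⊢; clear * - hnd; grind) ae.symm ca.symm bc.symm bd de (by simp at hw ⊢; clear * - hw; grind) xw yw
  simp only [Finset.mem_insert, Finset.mem_singleton] at hx hy
  have q3 : s(x, y) = s(b, e) → False := fun h => by
    have had : H.Adj b e := by
      rcases Sym2.eq_iff.1 h with ⟨rfl, rfl⟩ | ⟨rfl, rfl⟩
      exacts [xy, xy.symm]
    exact pent C.free (p := b) (q := e) (r := a) (s := c) (t := d) (w := w) (x := x) (y := y)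
      (by simp at hnd ⊢; clear * - hnd; grind) had ae.symm ca.symm cd bd.symm (by simp at hw ⊢; clear * - hw; grind) xw yw (Or.inl h)
  have q4 : s(x, y) = s(c, e) → False := fun h => by
    have had : H.Adj c e := by
      rcases Sym2.eq_iff.1 h with ⟨rfl, rfl⟩ | ⟨rfl, rfl⟩
      exacts [xy, xy.symm]
    exact pent C.free (p := c) (q := e) (r := a) (s := b) (t := d) (w := w) (x := x) (y := y)
      (by simp at hnd ⊢; clear * - hnd; grind) had ae.symm ba.symm bd cd.symm (by simp at hw ⊢; clear * - hw; grind) xw yw (Or.inl h)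
  clear * - hx hy hxy b1 q1 q2 q3 q4
  simp only [ne_eq, Sym2.eq_iff] at b1 q1 q2 q3 q4
  rcases hx with rfl | rfl | rfl | rfl | rfl <;> rcases hy with rfl | rfl | rfl | rfl | rfl <;> simp at *


set_option maxHeartbeats 400000 in
lemma five_aux (C : Ctx H U F) {i j k l l' : ι} {a b c d e x y z x' y' w : V} (hij : i ≠ j)
   (hi : Tri (F i) b c a) (hj : Tri (F j) b c d) (hk : Tri (F k) x y z) (hl : Tri (F l) x y e)
   (hx : x ∈ ({a, b, c, d} : Finset V)) (hy : y ∈ ({a, b, c, d} : Finset V)) (hz : z ∈ ({a, b, c, d} : Finset V))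
   (he : e ∉ ({a, b, c, d} : Finset V))
   (hl' : Tri (F l') x' y' w) (hx' : x' ∈ ({a, b, c, d, e} : Finset V)) (hy' : y' ∈ ({a, b, c, d, e} : Finset V))
   (hw : w ∉ ({a, b, c, d, e} : Finset V)) : False := by
  have had := C.apex hij hi hj
  have i1 := hi.1
  have i2 := hi.2.1
  have i3 := hi.2.2.1
  have j1 := hj.1
  have j2 := hj.2.1
  have j3 := hj.2.2.1
  have hnd : [a, b, c, d, e].Nodup := by
    simp at he ⊢; clear * - he had i1 i2 i3 j1 j2 j3; grind
  have hxy := hk.1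
  have A : ∀ {i j l : ι} {a' b' c' d' : V}, i ≠ j → Tri (F i) b' c' a' → Tri (F j) b' c' d' →
      Tri (F l) a' b' e → ({a', b', c', d', e} : Finset V) = {a, b, c, d, e} → [a', b', c', d', e].Nodup → False := by
    intro i j l a' b' c' d' hij hi hj hl hs hn 
    rw [← hs] at hx' hy' hw
    exact growA C hij hi hj hl hl' hn hx' hy' hw
  have B : ∀ {z : V} {k l : ι}, Tri (F k) a d z → Tri (F l) a d e → z ∈ ({a, b, c, d} : Finset V) → False :=
    fun hk hl hz => growB C hi hj hk hl hl' hnd hz hx' hy' hw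
  have nel : ∀ (k : ι) (p q r : V), Tri (F k) p q r → p ∈ ({a, b, c, d} : Finset V) →
      q ∈ ({a, b, c, d} : Finset V) → r ∈ ({a, b, c, d} : Finset V) → k ≠ l := by
    rintro k p q r hk hp hq hr rfl
    exact he (hl.outside (hk.inside hp hq hr)).2.2
  have D : ∀ {l : ι}, Tri (F l) b c e → i ≠ l → j ≠ l → False := fun hl h1 h2 =>
    C.three hij h2 h1 hi.e1 hj.e1 hl.e1
  have ni := nel i b c a hi (by simp) (by simp) (by simp)
  have nj := nel j b c d hj (by simp) (by simp) (by simp)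
  have Aab : Tri (F l) a b e → False := fun h => A hij hi hj h (by ext; simp) hnd
  have Aac : Tri (F l) a c e → False := fun h => A hij hi.swap hj.swap h
    (by clear * -; ext v; simp only [Finset.mem_insert, Finset.mem_singleton]; grind) (by simp at hnd ⊢; clear * - hnd; grind)
  have Adb : Tri (F l) d b e → False := fun h => A hij.symm hj hi h
    (by clear * -; ext v; simp only [Finset.mem_insert, Finset.mem_singleton]; grind) (by simp at hnd ⊢; clear * - hnd; grind)
  have Adc : Tri (F l) d c e → False := fun h => A hij.symm hj.swap hi.swap h
    (by clear * -; ext v; simp only [Finset.mem_insert, Finset.mem_singleton]; grind) (by simp at hnd ⊢; clear * - hnd; grind)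
  clear hnd nel hl' hx' hy' hw A hi hj
  simp only [Finset.mem_insert, Finset.mem_singleton] at hx hy
  rcases hx with h | h | h | h <;> rcases hy with h' | h' | h' | h' <;> rw [h, h'] at hl hk hxy
  · exact hxy rfl
  · exact Aab hl
  · exact Aac hl
  · exact B hk hl hz
  · exact Aab hl.swap
  · exact hxy rfl
  · exact D hl ni nj
  · exact Adb hl.swap
  · exact Aac hl.swap
  · exact D hl.swap ni nj
  · exact hxy rfl
  · exact Adc hl.swap
  · exact B hk.swap hl.swap hz
  · exact Adb hl
  · exact Adc hl
  · exact hxy rfl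

lemma Comp.five (C : Ctx H U F) {K : Finset ι} (hK : Comp F K) : ∃ W : Finset V, W.card ≤ 5 ∧ Inside F K W := by
  by_contra hcon
  push Not at hcon
  obtain ⟨i0, hi0⟩ := hK.ne
  obtain ⟨a0, b0, c0, ht0⟩ := C.tri (hK.three i0 hi0)
  obtain ⟨i, hiK, j, hjK, hij, b, c, a, d, hi, hj, -⟩ := hK.grow C hi0
    (ht0.inside (W := {a0, b0, c0}) (by simp) (by simp) (by simp)) (hcon _ (Finset.card_le_three.trans (by omega)))
  obtain ⟨k, hkK, l, hlK, hkl, x, y, z, e, hk, hl, hx, hy, hz, he⟩ := hK.grow C hiK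
    (hi.inside (W := {a, b, c, d}) (by simp) (by simp) (by simp)) (hcon _ (Finset.card_le_four.trans (by omega)))
  obtain ⟨p, hpK, l', hlK', hkl', x', y', z', w, hp, hl', hx', hy', hz', hw⟩ := hK.grow C hiK
    (hi.inside (W := {a, b, c, d, e}) (by simp) (by simp) (by simp)) (hcon _ Finset.card_le_five)
  exact five_aux C hij hi hj hk hl hx hy hz he hl' hx' hy' hw

end P6b
end T6

open SimpleGraph

namespace T6
section P6c
set_option linter.unusedSectionVars false
set_option linter.unusedSimpArgs false
open scoped Classical
open Finset
variable {V : Type*} [Fintype V]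

/-- edges inside `W` -/
noncomputable def Ed (G : SimpleGraph V) (W : Finset V) : Finset (Sym2 V) := W.sym2.filter (· ∈ G.edgeSet)

lemma mem_Ed {G : SimpleGraph V} {W : Finset V} {a b : V} : s(a, b) ∈ Ed G W ↔ a ∈ W ∧ b ∈ W ∧ G.Adj a b := by
  simp [Ed, and_assoc]

lemma Ed_sub (G : SimpleGraph V) (W : Finset V) : Ed G W ⊆ W.offDiag.image (Function.uncurry Sym2.mk) := by
  intro e he
  induction e using Sym2.ind with | _ a b =>
  rw [mem_Ed] at he
  exact Finset.mem_image.2 ⟨(a, b), by simp [he.1, he.2.1, he.2.2.ne], rfl⟩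

lemma Ed_choose (G : SimpleGraph V) (W : Finset V) : (Ed G W).card ≤ W.card.choose 2 := by
  rw [← Sym2.card_image_offDiag]
  exact Finset.card_le_card (Ed_sub G W)

lemma Ed_five {G : SimpleGraph V} (hp : IsPlanar G) {W : Finset V} (hW : W.card = 5) : (Ed G W).card ≤ 9 := by
  by_contra hcon
  have h1 : (W.offDiag.image (Function.uncurry Sym2.mk)).card = 10 := by rw [Sym2.card_image_offDiag, hW]; rfl
  have h2 : Ed G W = W.offDiag.image (Function.uncurry Sym2.mk) := Finset.eq_of_subset_of_card_le (Ed_sub G W) (by omega)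
  have h3 : ∀ a ∈ W, ∀ b ∈ W, a ≠ b → G.Adj a b := by
    intro a ha b hb hab
    have : s(a, b) ∈ Ed G W := by
      rw [h2]; exact Finset.mem_image.2 ⟨(a, b), by simp [ha, hb, hab], rfl⟩
    exact (mem_Ed.1 this).2.2
  let g : Fin 5 ≃ W := (Fintype.equivFinOfCardEq (by simpa using hW)).symm
  apply hp.1
  apply WM.hasMinor
  · refine ⟨fun i => {(g i : V)}, ?_, ?_, ?_⟩
    · intro a b v h1 h2
      simp only [Finset.mem_singleton] at h1 h2
      exact g.injective (Subtype.ext (h1.symm.trans h2))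
    · intro a; exact conn_singleton _ _
    · intro a b hab
      refine ⟨g a, by simp, g b, by simp, h3 _ (g a).2 _ (g b).2 ?_⟩
      intro h
      exact hab (g.injective (Subtype.ext h))
  · exact fun w => ⟨w + 1, by revert w; decide⟩

lemma Ed_le9 {G : SimpleGraph V} (hp : IsPlanar G) {W : Finset V} (hW : W.card ≤ 5) : (Ed G W).card ≤ 9 := by
  rcases hW.lt_or_eq with h | h
  · have h1 := Ed_choose G W
    have h2 : W.card.choose 2 ≤ Nat.choose 4 2 := Nat.choose_le_choose 2 (by omega)
    have h3 : Nat.choose 4 2 = 6 := rfl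
    omega
  · exact Ed_five hp h

lemma Ed_le6 {G : SimpleGraph V} {W : Finset V} (hW : W.card ≤ 4) : (Ed G W).card ≤ 6 := by
  have h1 := Ed_choose G W
  have h2 : W.card.choose 2 ≤ Nat.choose 4 2 := Nat.choose_le_choose 2 (by omega)
  have h3 : Nat.choose 4 2 = 6 := rfl
  omega

variable {H : SimpleGraph V} {U : Finset V} {ι : Type} [Fintype ι] {F : ι → Ch V}

/-- edges of the faces in `K` -/
noncomputable def EK (F : ι → Ch V) (K : Finset ι) : Finset (Sym2 V) := univ.filter (fun e => ∃ i ∈ K, F i e ≠ 0)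

lemma sum_ne (C : Ctx H U F) (K : Finset ι) (e : Sym2 V) :
    (∑ i ∈ K, F i) e ≠ 0 ↔ (K.filter (fun i => F i e ≠ 0)).card = 1 := by
  rw [Finset.sum_apply, sum_eq_card]
  have h1 := C.sys.le2 e
  have h2 : (K.filter (fun i => F i e ≠ 0)).card ≤ (univ.filter (fun i => F i e ≠ 0)).card :=
    Finset.card_le_card (Finset.filter_subset_filter _ (Finset.subset_univ _))
  generalize (K.filter (fun i => F i e ≠ 0)).card = m at *
  have : m = 0 ∨ m = 1 ∨ m = 2 := by omega
  rcases this with rfl | rfl | rfl <;> decide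

lemma Ctx.count (C : Ctx H U F) (K : Finset ι) (h3 : ∀ i ∈ K, len (F i) = 3) :
    3 * K.card + len (∑ i ∈ K, F i) = 2 * (EK F K).card := by
  have e1 : 3 * K.card = ∑ e ∈ EK F K, (K.filter (fun i => F i e ≠ 0)).card := by
    calc 3 * K.card = ∑ i ∈ K, len (F i) := by rw [Finset.sum_congr rfl h3]; simp [mul_comm]
      _ = ∑ i ∈ K, ∑ e ∈ EK F K, if F i e ≠ 0 then 1 else 0 := by
        apply Finset.sum_congr rfl
        intro i hi
        rw [← Finset.card_filter]
        unfold len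
        congr 1
        ext e
        simp only [Finset.mem_filter, Finset.mem_univ, true_and, EK]
        exact ⟨fun h => ⟨⟨i, hi, h⟩, h⟩, fun h => h.2⟩
      _ = _ := by
        rw [Finset.sum_comm]
        apply Finset.sum_congr rfl
        intro e _
        rw [Finset.card_filter]
  have e2 : len (∑ i ∈ K, F i) = ∑ e ∈ EK F K, if (K.filter (fun i => F i e ≠ 0)).card = 1 then 1 else 0 := by
    rw [← Finset.card_filter]
    unfold len
    congr 1
    ext e
    rw [Finset.mem_filter, sum_ne C]
    simp only [Finset.mem_filter, Finset.mem_univ, true_and, EK]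
    constructor
    · intro h
      obtain ⟨i, hi⟩ := Finset.card_pos.1 (by omega : 0 < (K.filter (fun i => F i e ≠ 0)).card)
      exact ⟨⟨i, (Finset.mem_filter.1 hi).1, (Finset.mem_filter.1 hi).2⟩, h⟩
    · exact fun h => h.2
  rw [e1, e2, ← Finset.sum_add_distrib, Finset.card_eq_sum_ones, Finset.mul_sum]
  apply Finset.sum_congr rfl
  intro e he
  simp only [EK, Finset.mem_filter, Finset.mem_univ, true_and] at he
  obtain ⟨i, hi, hie⟩ := he
  have h5 : 0 < (K.filter (fun i => F i e ≠ 0)).card := Finset.card_pos.2 ⟨i, by simp [hi, hie]⟩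
  have h1 := C.sys.le2 e
  have h2 : (K.filter (fun i => F i e ≠ 0)).card ≤ (univ.filter (fun i => F i e ≠ 0)).card :=
    Finset.card_le_card (Finset.filter_subset_filter _ (Finset.subset_univ _))
  split_ifs with h <;> omega

lemma EK_sub (C : Ctx H U F) {K : Finset ι} {W : Finset V} (hW : Inside F K W) : EK F K ⊆ Ed H W := by
  intro e he
  induction e using Sym2.ind with | _ a b =>
  simp only [EK, Finset.mem_filter, Finset.mem_univ, true_and] at he
  obtain ⟨i, hi, hie⟩ := he
  exact mem_Ed.2 ⟨hW i hi a b hie, hW i hi b a (by rwa [Sym2.eq_swap]), C.adj hie⟩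

lemma sum_mem (C : Ctx H U F) (K : Finset ι) : ∑ i ∈ K, F i ∈ Z H := Submodule.sum_mem _ (fun i _ => C.sys.mem i)

lemma Comp.ne0 (C : Ctx H U F) {K : Finset ι} (hK : Comp F K) : 3 ≤ len (∑ i ∈ K, F i) := by
  by_contra hcon
  have h0 := Z_small (sum_mem C K) (by omega)
  obtain ⟨W, hW, hin⟩ := hK.five C
  obtain ⟨i0, hi0⟩ := hK.ne
  have := C.all_vert K h0 hi0 (by intro h; have := hK.three i0 hi0; rw [h] at this; simp [len] at this) W hin
  have h1 := Finset.card_le_card this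
  have h2 := C.big
  omega

lemma Comp.tri3 (C : Ctx H U F) {K : Finset ι} (hK : Comp F K) :
    3 * K.card ≤ 2 * len (∑ i ∈ K, F i) ∨ (K.card = 3 ∧ len (∑ i ∈ K, F i) = 3) ∨
    (K.card = 4 ∧ len (∑ i ∈ K, F i) = 4) ∨ (K.card = 5 ∧ len (∑ i ∈ K, F i) = 3) := by
  obtain ⟨W, hW, hin⟩ := hK.five C
  have h1 := C.count K hK.three
  have h2 := hK.ne0 C
  have h3 := Finset.card_le_card (EK_sub C hin)
  have h4 := Ed_le9 C.pl hW
  have h5 : K.card ≤ 5 := by omega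
  generalize K.card = t at *
  generalize len (∑ i ∈ K, F i) = b at *
  interval_cases t <;> omega

/-- the face on the other side of a boundary edge -/
lemma Comp.other (C : Ctx H U F) {K : Finset ι} (hK : Comp F K) {e : Sym2 V} (he : (∑ i ∈ K, F i) e ≠ 0) :
    ∃ g, g ∉ K ∧ F g e ≠ 0 ∧ 4 ≤ len (F g) := by
  have h1 := (sum_ne C K e).1 he
  have h2 : (univ.filter (fun i => F i e ≠ 0)).card = 2 := by
    induction e using Sym2.ind with | _ a b =>
    exact C.two (Z_adj (sum_mem C K) he)
  have h3 : ¬ univ.filter (fun i => F i e ≠ 0) ⊆ K.filter (fun i => F i e ≠ 0) := by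
    intro h; have := Finset.card_le_card h; omega
  obtain ⟨g, hg, hg'⟩ := Finset.not_subset.1 h3
  simp only [Finset.mem_filter, Finset.mem_univ, true_and] at hg hg'
  have hgK : g ∉ K := fun h => hg' ⟨h, hg⟩
  refine ⟨g, hgK, hg, ?_⟩
  obtain ⟨i, hi⟩ := Finset.card_pos.1 (by omega : 0 < (K.filter (fun i => F i e ≠ 0)).card)
  simp only [Finset.mem_filter] at hi
  obtain ⟨c, hc⟩ := C.cyc (i := g) (by intro h; rw [h] at hg; exact hg rfl)
  have := hc.three
  by_contra hlt
  exact hgK (hK.closed i hi.1 g ⟨by rintro rfl; exact hgK hi.1, hK.three i hi.1, by omega, e, hi.2, hg⟩)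

end P6c
end T6

open SimpleGraph

namespace T6
section P6d0
set_option synthInstance.maxSize 10000 in
set_option synthInstance.maxHeartbeats 400000 in
lemma ham_bool : ∀ xz xp xq xr zp zq zr pq pr qr : Bool,
    8 ≤ xz.toNat + xp.toNat + xq.toNat + xr.toNat + zp.toNat + zq.toNat + zr.toNat + pq.toNat + pr.toNat + qr.toNat →
    ¬ (xp && pq && qr && zr) → ¬ (xr && qr && pq && zp) → ¬ (xp && pr && qr && zq) → ¬ (xq && qr && pr && zp) →
    ¬ (xq && pq && pr && zr) → ¬ (xr && pr && pq && zq) →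
    (xz && xp && xq && xr && zp && zq && zr) ∧ ((!pq && !pr && qr) ∨ (!pq && !qr && pr) ∨ (!pr && !qr && pq)) := by
  decide +kernel

set_option synthInstance.maxSize 10000 in
set_option synthInstance.maxHeartbeats 400000 in
lemma mid_bool : ∀ xz xp xq xr zp zq zr pq pr qr : Bool,
    8 ≤ xz.toNat + xp.toNat + xq.toNat + xr.toNat + zp.toNat + zq.toNat + zr.toNat + pq.toNat + pr.toNat + qr.toNat →
    ¬ (xp && pq && zq && (xz || xq || zp)) → ¬ (xq && pq && zp && (xz || xp || zq)) →
    ¬ (xp && pr && zr && (xz || xr || zp)) → ¬ (xr && pr && zp && (xz || xp || zr)) →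
    ¬ (xq && qr && zr && (xz || xr || zq)) → ¬ (xr && qr && zq && (xz || xq || zr)) → False := by
  decide +kernel

/-- if the path has enough extra edges there is a chord -/
lemma chord_bool : ∀ xz xp xq xr zp zq zr pq pr qr : Bool,
    8 ≤ xz.toNat + xp.toNat + xq.toNat + xr.toNat + zp.toNat + zq.toNat + zr.toNat + pq.toNat + pr.toNat + qr.toNat →
    (xp && pq && qr && zr) → (xz || xq || xr || zp || zq || pr) := by
  decide +kernel
end P6d0

section P6d
set_option linter.unusedSectionVars false
set_option linter.unusedSimpArgs false
open scoped Classical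
open Finset
variable {V : Type*} [Fintype V]
variable {H : SimpleGraph V}

noncomputable def ad (H : SimpleGraph V) (a b : V) : Bool := decide (H.Adj a b)

lemma ad_iff (a b : V) : ad H a b = true ↔ H.Adj a b := by simp [ad]

lemma ad_not (a b : V) : ad H a b = false ↔ ¬ H.Adj a b := by simp [ad]

lemma Ed_ten {x z p q r : V} {W : Finset V} (hW : W = {x, z, p, q, r}) : (Ed H W).card ≤
    (ad H x z).toNat + (ad H x p).toNat + (ad H x q).toNat + (ad H x r).toNat + (ad H z p).toNat + (ad H z q).toNat
      + (ad H z r).toNat + (ad H p q).toNat + (ad H p r).toNat + (ad H q r).toNat := by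
  have hs : Ed H W ⊆ ([s(x, z), s(x, p), s(x, q), s(x, r), s(z, p), s(z, q), s(z, r), s(p, q), s(p, r), s(q, r)].filter
      (fun e => decide (e ∈ H.edgeSet))).toFinset := by
    intro e he
    induction e using Sym2.ind with | _ a b =>
    obtain ⟨ha, hb, hab⟩ := mem_Ed.1 he
    rw [hW] at ha hb
    rw [List.mem_toFinset, List.mem_filter]
    refine ⟨?_, by simpa using hab⟩
    have hne := hab.ne
    clear he hab hW
    simp only [Finset.mem_insert, Finset.mem_singleton] at ha hb
    simp only [List.mem_cons, Sym2.eq_iff]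
    rcases ha with rfl | rfl | rfl | rfl | rfl <;> rcases hb with rfl | rfl | rfl | rfl | rfl <;> simp at *
  refine (Finset.card_le_card hs).trans ((List.toFinset_card_le _).trans (le_of_eq ?_))
  have key : ∀ (a b : V) (l : List (Sym2 V)), ((s(a, b) :: l).filter (fun e => decide (e ∈ H.edgeSet))).length
      = (ad H a b).toNat + (l.filter (fun e => decide (e ∈ H.edgeSet))).length := by
    intro a b l
    by_cases h : H.Adj a b
    · simp [List.filter_cons, h, ad]; omega
    · simp [List.filter_cons, h, ad]
  simp only [key, List.filter_nil, List.length_nil, add_zero]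
  omega

lemma ham_path (hf : ¬ HasTheta6 H) {x z p q r o : V} {W : Finset V} (hW : W = {x, z, p, q, r})
    (hnd : [x, z, p, q, r].Nodup) (ho : o ∉ W) (hox : H.Adj o x) (hoz : H.Adj o z) (h8 : 8 ≤ (Ed H W).card) :
    ¬ (ad H x p && ad H p q && ad H q r && ad H z r) := by
  intro h
  have h1 := chord_bool _ _ _ _ _ _ _ _ _ _ (h8.trans (Ed_ten hW)) h
  simp only [Bool.and_eq_true, Bool.or_eq_true, ad_iff] at h h1
  obtain ⟨⟨⟨a1, a2⟩, a3⟩, a4⟩ := h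
  refine th6 hf (a := o) (b := x) (c := p) (d := q) (e := r) (f := z) ?_ hox a1 a2 a3 a4.symm hoz.symm ?_
  · rw [hW] at ho
    simp only [List.nodup_cons, List.mem_cons, List.not_mem_nil, or_false, not_or, Finset.mem_insert,
      Finset.mem_singleton, not_false_eq_true, List.nodup_nil, and_true] at hnd ho ⊢
    clear * - hnd ho
    grind
  · have s1 : H.Adj z p → H.Adj p z := fun h => h.symm
    have s2 : H.Adj z q → H.Adj q z := fun h => h.symm
    clear * - h1 s1 s2
    tauto

lemma ham (hf : ¬ HasTheta6 H) {x z p q r o : V} {W : Finset V} (hW : W = {x, z, p, q, r})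
    (hnd : [x, z, p, q, r].Nodup) (ho : o ∉ W) (hox : H.Adj o x) (hoz : H.Adj o z) (h8 : 8 ≤ (Ed H W).card) :
    (Ed H W).card ≤ 8 ∧ H.Adj x p ∧ H.Adj x q ∧ H.Adj x r ∧
    ((¬ H.Adj p q ∧ ¬ H.Adj p r) ∨ (¬ H.Adj p q ∧ ¬ H.Adj q r) ∨ (¬ H.Adj p r ∧ ¬ H.Adj q r)) := by
  have hc : ∀ a b : V, ad H a b = ad H b a := by intro a b; simp [ad, H.adj_comm]
  have hs : ∀ {p' q' r' : V}, ({x, z, p', q', r'} : Finset V) = {x, z, p, q, r} → [x, z, p', q', r'].Nodup →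
      ¬ (ad H x p' && ad H p' q' && ad H q' r' && ad H z r') := fun h1 h2 => ham_path hf (hW.trans h1.symm) h2 ho hox hoz h8
  have := ham_bool _ _ _ _ _ _ _ _ _ _ (h8.trans (Ed_ten hW))
    (hs rfl hnd)
    (by have := hs (p' := r) (q' := q) (r' := p) (by clear * -; ext; simp; grind) (by clear * - hnd; simp at *; grind)
        rwa [hc r q, hc q p] at this)
    (by have := hs (p' := p) (q' := r) (r' := q) (by clear * -; ext; simp; grind) (by clear * - hnd; simp at *; grind)
        rwa [hc r q] at this)
    (by have := hs (p' := q) (q' := r) (r' := p) (by clear * -; ext; simp; grind) (by clear * - hnd; simp at *; grind)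
        rwa [hc r p] at this)
    (by have := hs (p' := q) (q' := p) (r' := r) (by clear * -; ext; simp; grind) (by clear * - hnd; simp at *; grind)
        rwa [hc q p] at this)
    (by have := hs (p' := r) (q' := p) (r' := q) (by clear * -; ext; simp; grind) (by clear * - hnd; simp at *; grind)
        rwa [hc r p] at this)
  obtain ⟨h1, h2⟩ := this
  have h10 := Ed_ten (H := H) hW
  simp only [Bool.and_eq_true] at h1
  refine ⟨?_, (ad_iff _ _).1 h1.1.1.1.1.1.2, (ad_iff _ _).1 h1.1.1.1.1.2, (ad_iff _ _).1 h1.1.1.1.2, ?_⟩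
  · refine h10.trans ?_
    rw [h1.1.1.1.1.1.1, h1.1.1.1.1.1.2, h1.1.1.1.1.2, h1.1.1.1.2, h1.1.1.2, h1.1.2, h1.2]
    revert h2
    generalize ad H p q = a1
    generalize ad H p r = a2
    generalize ad H q r = a3
    clear * -
    revert a1 a2 a3; decide
  · simp only [Bool.and_eq_true, Bool.not_eq_true', ad_not] at h2
    tauto

lemma mid (hf : ¬ HasTheta6 H) {x z p q r o o' : V} {W : Finset V} (hW : W = {x, z, p, q, r})
    (hnd : [x, z, p, q, r].Nodup) (ho : o ∉ W) (ho' : o' ∉ W) (hox : H.Adj o x) (hoo : H.Adj o o') (hoz : H.Adj o' z)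
    (h8 : 8 ≤ (Ed H W).card) : False := by
  have hc : ∀ a b : V, ad H a b = ad H b a := by intro a b; simp [ad, H.adj_comm]
  have hs : ∀ {u v : V}, u ∈ W → v ∈ W → [x, z, u, v].Nodup →
      ¬ (ad H x u && ad H u v && ad H z v && (ad H x z || ad H x v || ad H z u)) := by
    intro u v hu hv hn h
    simp only [Bool.and_eq_true, Bool.or_eq_true, ad_iff] at h
    obtain ⟨⟨⟨a1, a2⟩, a3⟩, a4⟩ := h
    have ox : ∀ v ∈ W, v ≠ o ∧ v ≠ o' := fun v hv => ⟨by rintro rfl; exact ho hv, by rintro rfl; exact ho' hv⟩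
    have m1 := ox x (by rw [hW]; simp)
    have m2 := ox z (by rw [hW]; simp)
    have m3 := ox u hu
    have m4 := ox v hv
    have m5 := hoo.ne
    refine th6 hf (a := x) (b := u) (c := v) (d := z) (e := o') (f := o) ?_ a1 a2 a3.symm hoz.symm hoo.symm hox ?_
    · simp only [List.nodup_cons, List.mem_cons, List.not_mem_nil, or_false, not_or,
        not_false_eq_true, List.nodup_nil, and_true] at hn ⊢
      clear * - hn m1 m2 m3 m4 m5
      grind
    · have s1 : H.Adj z u → H.Adj u z := fun h => h.symm
      clear * - a4 s1
      tauto
  have hp : p ∈ W := by rw [hW]; simp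
  have hq : q ∈ W := by rw [hW]; simp
  have hr : r ∈ W := by rw [hW]; simp
  refine mid_bool _ _ _ _ _ _ _ _ _ _ (h8.trans (Ed_ten hW))
    (hs hp hq (by clear * - hnd; simp at *; grind)) ?_ (hs hp hr (by clear * - hnd; simp at *; grind)) ?_
    (hs hq hr (by clear * - hnd; simp at *; grind)) ?_
  · have := hs hq hp (by clear * - hnd; simp at *; grind)
    rwa [hc q p] at this
  · have := hs hr hp (by clear * - hnd; simp at *; grind)
    rwa [hc r p] at this
  · have := hs hr hq (by clear * - hnd; simp at *; grind)
    rwa [hc r q] at this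

lemma split5 {W : Finset V} (h5 : W.card = 5) {x z : V} (hx : x ∈ W) (hz : z ∈ W) (hxz : x ≠ z) :
    ∃ p q r, W = {x, z, p, q, r} ∧ [x, z, p, q, r].Nodup := by
  have h1 : ((W.erase x).erase z).card = 3 := by
    rw [Finset.card_erase_of_mem (by simp [hz, hxz.symm]), Finset.card_erase_of_mem hx, h5]
  obtain ⟨p, q, r, hpq, hpr, hqr, he⟩ := Finset.card_eq_three.1 h1
  have hW : W = {x, z, p, q, r} := by
    rw [← he, Finset.insert_erase (by simp [hz, hxz.symm]), Finset.insert_erase hx]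
  refine ⟨p, q, r, hW, ?_⟩
  have hn : ∀ v ∈ ({p, q, r} : Finset V), v ≠ x ∧ v ≠ z := by
    intro v hv; rw [← he] at hv; simp at hv; exact ⟨hv.2.1, hv.1⟩
  have n1 := hn p (by simp)
  have n2 := hn q (by simp)
  have n3 := hn r (by simp)
  simp; clear * - hpq hpr hqr hxz n1 n2 n3; grind

lemma split5' {W : Finset V} (h5 : W.card = 5) {x z y : V} (hx : x ∈ W) (hz : z ∈ W) (hy : y ∈ W) (hxz : x ≠ z)
    (hxy : x ≠ y) (hyz : y ≠ z) : ∃ q r, W = {x, z, y, q, r} ∧ [x, z, y, q, r].Nodup := by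
  obtain ⟨p, q, r, hW, hnd⟩ := split5 h5 hx hz hxz
  rw [hW] at hy
  simp only [Finset.mem_insert, Finset.mem_singleton] at hy
  rcases hy with h | h | h | h | h
  · exact absurd h.symm hxy
  · exact absurd h hyz
  · exact ⟨q, r, by rw [hW, h], by rw [h]; exact hnd⟩
  · exact ⟨p, r, by rw [hW, h]; clear * -; ext; simp; grind, by rw [h]; clear * - hnd; simp at *; grind⟩
  · exact ⟨p, q, by rw [hW, h]; clear * -; ext; simp; grind, by rw [h]; clear * - hnd; simp at *; grind⟩

/-- a Hamiltonian detour is impossible with 9 edges -/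
lemma ham9 (hf : ¬ HasTheta6 H) {x z o : V} {W : Finset V} (h5 : W.card = 5) (hx : x ∈ W) (hz : z ∈ W) (hxz : x ≠ z)
    (ho : o ∉ W) (hox : H.Adj o x) (hoz : H.Adj o z) (h9 : 9 ≤ (Ed H W).card) : False := by
  obtain ⟨p, q, r, hW, hnd⟩ := split5 h5 hx hz hxz
  have := (ham hf hW hnd ho hox hoz (by omega)).1
  omega

lemma mid8 (hf : ¬ HasTheta6 H) {x z o o' : V} {W : Finset V} (h5 : W.card = 5) (hx : x ∈ W) (hz : z ∈ W) (hxz : x ≠ z)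
    (ho : o ∉ W) (ho' : o' ∉ W) (hox : H.Adj o x) (hoo : H.Adj o o') (hoz : H.Adj o' z)
    (h8 : 8 ≤ (Ed H W).card) : False := by
  obtain ⟨p, q, r, hW, hnd⟩ := split5 h5 hx hz hxz
  exact mid hf hW hnd ho ho' hox hoo hoz h8

end P6d
end T6

open SimpleGraph

namespace T6
section P6e
set_option linter.unusedSectionVars false
set_option linter.unusedSimpArgs false
open scoped Classical
open Finset
variable {V : Type*} [Fintype V]
variable {H : SimpleGraph V} {U : Finset V} {ι : Type} [Fintype ι] {F : ι → Ch V}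

def Quad (c : Ch V) (x y z w : V) : Prop :=
  [x, y, z, w].Nodup ∧ ∀ e, c e ≠ 0 ↔ e = s(x, y) ∨ e = s(y, z) ∨ e = s(z, w) ∨ e = s(w, x)

def Pentg (c : Ch V) (x y z w s : V) : Prop :=
  [x, y, z, w, s].Nodup ∧ ∀ e, c e ≠ 0 ↔ e = s(x, y) ∨ e = s(y, z) ∨ e = s(z, w) ∨ e = s(w, s) ∨ e = s(s, x)

lemma Quad.refl {c : Ch V} {x y z w : V} (h : Quad c x y z w) : Quad c y x w z := by
  obtain ⟨h1, h2⟩ := h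
  refine ⟨by clear * - h1; simp at *; grind, fun e => ?_⟩
  rw [h2, Sym2.eq_swap (a := x) (b := y), Sym2.eq_swap (a := w) (b := x), Sym2.eq_swap (a := z) (b := w),
    Sym2.eq_swap (a := y) (b := z)]
  tauto

lemma Cyc.at {c : Ch V} {m : ℕ} {g : ℕ → V} (h : Cyc c m g) {e : Sym2 V} (he : c e ≠ 0) :
    ∃ k, Cyc c m k ∧ e = s(k 0, k 1) := by
  obtain ⟨j, hj, rfl⟩ := (h.apply e).1 he
  exact ⟨_, h.shift j, by simp [add_comm]⟩

lemma Cyc.quad {c : Ch V} {g : ℕ → V} (h : Cyc c 4 g) : Quad c (g 0) (g 1) (g 2) (g 3) := by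
  have hi := h.inj
  refine ⟨?_, ?_⟩
  · simp only [List.nodup_cons, List.mem_cons, List.not_mem_nil, or_false, not_or, not_false_eq_true, List.nodup_nil,
      and_true]
    refine ⟨⟨?_, ?_, ?_⟩, ⟨?_, ?_⟩, ?_⟩ <;> intro h' <;> have := hi _ _ (by omega) (by omega) h' <;> omega
  · intro e
    have h4 : g 4 = g 0 := h.per 0
    rw [h.apply]
    constructor
    · rintro ⟨j, hj, rfl⟩
      interval_cases j <;> simp [h4]
    · rintro (rfl | rfl | rfl | rfl)
      exacts [⟨0, by omega, rfl⟩, ⟨1, by omega, rfl⟩, ⟨2, by omega, rfl⟩, ⟨3, by omega, by rw [h4]⟩]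

lemma Cyc.pentg {c : Ch V} {g : ℕ → V} (h : Cyc c 5 g) : Pentg c (g 0) (g 1) (g 2) (g 3) (g 4) := by
  have hi := h.inj
  refine ⟨?_, ?_⟩
  · simp only [List.nodup_cons, List.mem_cons, List.not_mem_nil, or_false, not_or, not_false_eq_true, List.nodup_nil,
      and_true]
    refine ⟨⟨?_, ?_, ?_, ?_⟩, ⟨?_, ?_, ?_⟩, ⟨?_, ?_⟩, ?_⟩ <;> intro h' <;> have := hi _ _ (by omega) (by omega) h' <;> omega
  · intro e
    have h4 : g 5 = g 0 := h.per 0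
    rw [h.apply]
    constructor
    · rintro ⟨j, hj, rfl⟩
      interval_cases j <;> simp [h4]
    · rintro (rfl | rfl | rfl | rfl | rfl)
      exacts [⟨0, by omega, rfl⟩, ⟨1, by omega, rfl⟩, ⟨2, by omega, rfl⟩, ⟨3, by omega, rfl⟩, ⟨4, by omega, by rw [h4]⟩]

lemma Z_three {G : SimpleGraph V} {c : Ch V} (hc : c ∈ Z G) (h : len c = 3) : ∃ x y z, Tri c x y z := by
  obtain ⟨c1, m, g, hC, hs⟩ := exists_cyc hc (by rintro rfl; simp [len] at h)
  have h1 := hC.len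
  have h2 := hC.three
  have hsub : univ.filter (fun e => c1 e ≠ 0) ⊆ univ.filter (fun e => c e ≠ 0) := by
    intro e he
    simp only [Finset.mem_filter, Finset.mem_univ, true_and] at he ⊢
    exact hs e he
  have heq := Finset.eq_of_subset_of_card_le hsub (by unfold len at h h1; omega)
  have h3 : m = 3 := by rw [← h1, ← h]; unfold len; rw [heq]
  have : c1 = c := by
    funext e
    have : c1 e ≠ 0 ↔ c e ≠ 0 := by
      have := Finset.ext_iff.1 heq e
      simpa using this
    rcases z01 (c1 e) with h | h <;> rcases z01 (c e) with h' | h' <;> simp_all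
  subst h3 this
  exact ⟨_, _, _, hC.tri⟩

lemma mem_EK {K : Finset ι} {e : Sym2 V} : e ∈ EK F K ↔ ∃ i ∈ K, F i e ≠ 0 := by simp [EK]

lemma D_EK {K : Finset ι} {e : Sym2 V} (h : (∑ i ∈ K, F i) e ≠ 0) : e ∈ EK F K := by
  by_contra hcon
  apply h
  rw [Finset.sum_apply]
  apply Finset.sum_eq_zero
  intro i hi
  by_contra h'
  exact hcon (mem_EK.2 ⟨i, hi, h'⟩)

lemma close_K (C : Ctx H U F) {K : Finset ι} {v u0 : V} (h : ∀ u, (∑ i ∈ K, F i) s(v, u) = 0) (h0 : s(v, u0) ∈ EK F K) :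
    ∀ w, H.Adj v w → s(v, w) ∈ EK F K := by
  obtain ⟨i, hi, hi'⟩ := mem_EK.1 h0
  intro w hw
  exact mem_EK.2 (C.star_edge K h hi hi' w hw)

lemma close_g (C : Ctx H U F) {K : Finset ι} {g : ι} (hg : g ∉ K) {v u0 : V}
    (h : ∀ u, F g s(v, u) ≠ 0 ↔ (∑ i ∈ K, F i) s(v, u) ≠ 0) (h0 : F g s(v, u0) ≠ 0) :
    ∀ w, H.Adj v w → F g s(v, w) ≠ 0 ∨ s(v, w) ∈ EK F K := by
  intro w hw
  obtain ⟨i, hi, hi'⟩ := C.star_edge (insert g K) (by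
    intro u
    rw [Finset.sum_insert hg, Pi.add_apply]
    have := h u
    rcases z01 (F g s(v, u)) with h1 | h1 <;> rcases z01 ((∑ i ∈ K, F i) s(v, u)) with h2 | h2 <;> rw [h1, h2] at this ⊢
    · rfl
    · simp at this
    · simp at this
    · rfl) (Finset.mem_insert_self g K) h0 w hw
  rcases Finset.mem_insert.1 hi with rfl | hi
  · exact Or.inl hi'
  · exact Or.inr (mem_EK.2 ⟨i, hi, hi'⟩)

lemma on_bd (C : Ctx H U F) {K : Finset ι} {g : ι} (hg : g ∉ K) {e : Sym2 V} (h : F g e ≠ 0) (he : e ∈ EK F K) :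
    (∑ i ∈ K, F i) e ≠ 0 := by
  rw [sum_ne C]
  obtain ⟨i, hi, hie⟩ := mem_EK.1 he
  have h5 : 0 < (K.filter (fun i => F i e ≠ 0)).card := Finset.card_pos.2 ⟨i, by simp [hi, hie]⟩
  have h1 := C.sys.le2 e
  have h3 : insert g (K.filter (fun i => F i e ≠ 0)) ⊆ univ.filter (fun i => F i e ≠ 0) := by
    intro x hx
    rcases Finset.mem_insert.1 hx with rfl | hx
    · simp [h]
    · simp [(Finset.mem_filter.1 hx).2]
  have h4 := Finset.card_le_card h3
  rw [Finset.card_insert_of_notMem (by simp [hg])] at h4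
  omega

lemma Tri.mem {c : Ch V} {x y z a b : V} (h : Tri c x y z) (hab : c s(a, b) ≠ 0) :
    (a = x ∨ a = y ∨ a = z) ∧ (b = x ∨ b = y ∨ b = z) := by
  rw [h.iff] at hab
  simp only [Sym2.eq_iff] at hab
  tauto

/-- the inner structure of the exceptional component with three triangles -/
lemma c33_struct (C : Ctx H U F) {K : Finset ι} (hK : Comp F K) (h3 : K.card = 3) {a b c : V}
    (hD : Tri (∑ i ∈ K, F i) a b c) :
    ∃ p i1 i2 i3, K = {i1, i2, i3} ∧ Tri (F i1) a b p ∧ Tri (F i2) b c p ∧ Tri (F i3) c a p ∧ p ≠ c := by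
  obtain ⟨W, hW5, hW⟩ := hK.five C
  have get : ∀ {x y z : V}, Tri (∑ i ∈ K, F i) x y z → ∃ i ∈ K, ∃ p, Tri (F i) x y p ∧ p ≠ z := by
    intro x y z h
    obtain ⟨i, hi, hi'⟩ := mem_EK.1 (D_EK h.e1)
    obtain ⟨a', b', c', ht⟩ := C.tri (hK.three i hi)
    obtain ⟨p, hp⟩ := ht.edge hi'
    refine ⟨i, hi, p, hp, ?_⟩
    rintro rfl
    have e1 : F i = ∑ i ∈ K, F i := by rw [hp.2.2.2, h.2.2.2]
    have e2 : ∑ j ∈ K.erase i, F j = 0 := by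
      have := Finset.add_sum_erase K F hi
      rw [← e1] at this
      simpa using this
    have hne : (K.erase i).Nonempty := by
      rw [← Finset.card_pos, Finset.card_erase_of_mem hi]; omega
    obtain ⟨j, hj⟩ := hne
    have hjK := Finset.mem_of_mem_erase hj
    have := C.all_vert (K.erase i) e2 hj (by intro h; have := hK.three j hjK; rw [h] at this; simp [len] at this) W
      (fun k hk => hW k (Finset.mem_of_mem_erase hk))
    have h1 := Finset.card_le_card this
    have h2 := C.big
    omega
  obtain ⟨i1, hi1, p, hp, hpc⟩ := get hD
  obtain ⟨i2, hi2, q, hq, hqa⟩ := get hD.rot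
  obtain ⟨i3, hi3, r, hr, hrb⟩ := get hD.rot.rot
  have ab := hD.1
  have bc := hD.2.1
  have ac := hD.2.2.1
  have n12 : i1 ≠ i2 := by
    rintro rfl
    have := (hp.mem hq.e1).2
    clear * - this ac bc hpc; grind
  have n23 : i2 ≠ i3 := by
    rintro rfl
    have := (hq.mem hr.e1).2
    clear * - this ab ac hqa; grind
  have n13 : i1 ≠ i3 := by
    rintro rfl
    have := (hp.mem hr.e1).1
    clear * - this ac bc hpc; grind
  have hKe : K = {i1, i2, i3} := by
    symm
    apply Finset.eq_of_subset_of_card_le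
    · intro x hx; simp at hx; rcases hx with rfl | rfl | rfl <;> assumption
    · rw [h3, Finset.card_eq_three.2 ⟨i1, i2, i3, n12, n13, n23, rfl⟩]
  have hpa := hp.2.2.1.symm
  have hpb := hp.2.1.symm
  have hD0 : ∀ x, ¬ (∑ i ∈ K, F i) s(x, p) ≠ 0 := by
    intro x h
    have := (hD.mem h).2
    clear * - this hpa hpb hpc; grind
  have oth : ∀ x, F i1 s(x, p) ≠ 0 → F i2 s(x, p) ≠ 0 ∨ F i3 s(x, p) ≠ 0 := by
    intro x hx
    by_contra hcon
    push Not at hcon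
    apply hD0 x
    rw [sum_ne C]
    rw [Finset.card_eq_one]
    refine ⟨i1, ?_⟩
    ext k
    simp only [Finset.mem_filter, Finset.mem_singleton, hKe, Finset.mem_insert]
    constructor
    · rintro ⟨rfl | rfl | rfl, h⟩
      · rfl
      · exact absurd hcon.1 h
      · exact absurd hcon.2 h
    · rintro rfl; exact ⟨Or.inl rfl, hx⟩
  have pq : p = q := by
    rcases oth b hp.rot.e1 with h | h
    · have := (hq.mem h).2
      clear * - this hpb hpc; grind
    · have := (hr.mem h).1
      clear * - this bc ab hrb; grind
  have pr : p = r := by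
    rcases oth a hp.rot.rot.swap.e1 with h | h
    · have := (hq.mem h).1
      clear * - this ac ab hqa; grind
    · have := (hr.mem h).2
      clear * - this hpa hpc; grind
  subst pq pr
  exact ⟨p, i1, i2, i3, hKe, hp, hq, hr, hpc⟩

lemma c33_aux (C : Ctx H U F) {K : Finset ι} (hK : Comp F K) (h3 : K.card = 3) {a b c : V}
    (hD : Tri (∑ i ∈ K, F i) a b c) {g : ι} (hg : g ∉ K) {w : V} (hQ : Quad (F g) a b c w) : False := by
  obtain ⟨p, i1, i2, i3, hKe, t1, t2, t3, hpc⟩ := c33_struct C hK h3 hD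
  have ab := hD.1
  have bc := hD.2.1
  have ac := hD.2.2.1
  have hEK : ∀ u v, s(u, v) ∈ EK F K → v = a ∨ v = b ∨ v = c ∨ v = p := by
    intro u v h
    obtain ⟨i, hi, hi'⟩ := mem_EK.1 h
    rw [hKe] at hi; simp at hi
    rcases hi with rfl | rfl | rfl
    · have := (t1.mem hi').2; tauto
    · have := (t2.mem hi').2; tauto
    · have := (t3.mem hi').2; tauto
  have hpa := t1.2.2.1.symm
  have hpb := t1.2.1.symm
  have Np : ∀ w, H.Adj p w → w = b ∨ w = a ∨ w = c := by
    intro w hw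
    have h1 := close_K C (K := K) (v := p) (u0 := a) (by
      intro u
      by_contra h
      have := (hD.mem h).1
      clear * - this hpa hpb hpc; grind) (mem_EK.2 ⟨i1, by simp [hKe], t1.rot.rot.e1⟩) w hw
    have := hEK _ _ h1
    have h2 := hw.ne
    clear * - this h2; grind
  have Nb : ∀ w, H.Adj b w → w = p ∨ w = a ∨ w = c := by
    intro w' hw
    have h1 := close_g C (K := K) hg (v := b) (u0 := a) (by
      intro u
      have hn := hQ.1
      rw [hQ.2, hD.iff]
      simp only [Sym2.eq_iff]
      clear * - hn ab bc ac
      simp at hn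
      grind) ((hQ.2 _).2 (Or.inl Sym2.eq_swap)) w' hw
    have h2 := hw.ne
    rcases h1 with h1 | h1
    · have hn := hQ.1
      rw [hQ.2] at h1
      simp only [Sym2.eq_iff] at h1
      clear * - h1 h2 hn
      simp at hn
      grind
    · have := hEK _ _ h1
      clear * - this h2; grind
  exact C.pair b p (C.tadj t1).2.1 a c a c Nb Np

lemma Comp.c33 (C : Ctx H U F) {K : Finset ι} (hK : Comp F K) (h3 : K.card = 3) (hl : len (∑ i ∈ K, F i) = 3) {g : ι}
    (hg : g ∉ K) {e : Sym2 V} (he : (∑ i ∈ K, F i) e ≠ 0) (hge : F g e ≠ 0) (h4 : len (F g) = 4) : False := by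
  obtain ⟨k0, hk0⟩ := C.cyc (i := g) (by intro h; rw [h] at hge; exact hge rfl)
  rw [h4] at hk0
  obtain ⟨k, hk, rfl⟩ := hk0.at hge
  have hQ := hk.quad
  generalize k 0 = a at *
  generalize k 1 = b at *
  generalize k 2 = z at *
  generalize k 3 = w at *
  obtain ⟨a', b', c', hD'⟩ := Z_three (sum_mem C K) hl
  obtain ⟨c, hD⟩ := hD'.edge he
  by_cases hzc : z = c
  · subst hzc; exact c33_aux C hK h3 hD hg hQ
  by_cases hwc : w = c
  · subst hwc; exact c33_aux C hK h3 hD.swap hg hQ.refl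
  obtain ⟨p, i1, i2, i3, hKe, t1, t2, t3, hpc⟩ := c33_struct C hK h3 hD
  have hpa := t1.2.2.1.symm
  have hpb := t1.2.1.symm
  have pout : ∀ u, F g s(p, u) = 0 := by
    intro u
    by_contra hu
    exact hg (C.star K (v := p) (by
      intro u
      by_contra h
      have := (hD.mem h).1
      clear * - this hpa hpb hpc; grind) (i0 := i1) (by simp [hKe]) t1.rot.rot.e1 g u hu)
  have hpz : p ≠ z := by
    rintro rfl; exact (hQ.2 _).2 (Or.inr (Or.inr (Or.inl rfl))) (pout w)
  have hpw : p ≠ w := by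
    rintro rfl; exact (hQ.2 _).2 (Or.inr (Or.inr (Or.inr rfl))) (pout a)
  have bz : H.Adj b z := C.adj ((hQ.2 _).2 (Or.inr (Or.inl rfl)))
  have zw : H.Adj z w := C.adj ((hQ.2 _).2 (Or.inr (Or.inr (Or.inl rfl))))
  have wa : H.Adj w a := C.adj ((hQ.2 _).2 (Or.inr (Or.inr (Or.inr rfl))))
  have hn := hQ.1
  have ab := hD.1
  have bc := hD.2.1
  have ac := hD.2.2.1
  refine th6 C.free (a := a) (b := p) (c := c) (d := b) (e := z) (f := w) ?_ (C.tadj t1).2.2 (C.tadj t2).2.1.symm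
    (C.tadj t2).1.symm bz zw wa (Or.inr (Or.inl (C.tadj t1).1))
  clear * - hn ab bc ac hpz hpw hpa hpb hpc hzc hwc
  simp at *
  grind

end P6e
end T6

open SimpleGraph

namespace T6
section P6f
set_option linter.unusedSectionVars false
set_option linter.unusedSimpArgs false
open scoped Classical
open Finset
variable {V : Type*} [Fintype V]
variable {H : SimpleGraph V} {U : Finset V} {ι : Type} [Fintype ι] {F : ι → Ch V}

lemma Comp.inW (C : Ctx H U F) {K : Finset ι} (hK : Comp F K) {W : Finset V} (hW5 : W.card = 5) (hW : Inside F K W)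
    (hcase : ((EK F K).card = 8 ∧ len (∑ i ∈ K, F i) = 4) ∨ ((EK F K).card = 9 ∧ len (∑ i ∈ K, F i) = 3))
    {g : ι} (hg : g ∉ K) (hl : 4 ≤ len (F g)) (hgW : ∀ a b, F g s(a, b) ≠ 0 → a ∈ W) : False := by
  set D := ∑ i ∈ K, F i with hD
  set A := univ.filter (fun e => F g e ≠ 0) with hA
  set B := univ.filter (fun e => D e ≠ 0) with hB
  have h9 := Ed_five C.pl hW5
  have hAE : A ⊆ Ed H W := by
    intro e he
    induction e using Sym2.ind with | _ a b =>
    have he : F g s(a, b) ≠ 0 := (Finset.mem_filter.1 he).2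
    exact mem_Ed.2 ⟨hgW a b he, hgW b a (by rwa [Sym2.eq_swap]), C.adj he⟩
  have hAB : A \ B ⊆ Ed H W \ EK F K := by
    intro e he
    obtain ⟨h1, h2⟩ := Finset.mem_sdiff.1 he
    refine Finset.mem_sdiff.2 ⟨hAE h1, fun h => h2 ?_⟩
    exact Finset.mem_filter.2 ⟨Finset.mem_univ _, on_bd C hg (Finset.mem_filter.1 h1).2 h⟩
  have c1 := Finset.card_le_card hAB
  have c2 := Finset.card_sdiff_add_card_eq_card (EK_sub C hW)
  have c3 := Finset.card_sdiff_add_card_inter A B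
  have c4 := Finset.card_sdiff_add_card_inter B A
  have c5 : (B ∩ A).card = (A ∩ B).card := by rw [Finset.inter_comm]
  have lA : A.card = len (F g) := rfl
  have lB : B.card = len D := rfl
  have lsum : len (F g + D) ≤ (A \ B).card + (B \ A).card := by
    rw [← Finset.card_union_of_disjoint (by
      rw [Finset.disjoint_left]; intro e h1 h2
      exact (Finset.mem_sdiff.1 h1).2 (Finset.mem_sdiff.1 h2).1)]
    apply Finset.card_le_card
    intro e he
    simp only [Finset.mem_filter, Finset.mem_univ, true_and, Pi.add_apply, Finset.mem_union, Finset.mem_sdiff, hA, hB] at he ⊢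
    rcases z01 (F g e) with h1 | h1 <;> rcases z01 (D e) with h2 | h2 <;> rw [h1, h2] at he ⊢
    · simp at he
    · simp
    · simp
    · exact absurd rfl he
  have h0 : F g + D = 0 := Z_small (Submodule.add_mem _ (C.sys.mem g) (sum_mem C K)) (by omega)
  have := C.all_vert (insert g K) (by rw [Finset.sum_insert hg]; exact h0) (Finset.mem_insert_self g K)
    (by intro h; rw [h] at hl; simp [len] at hl) W (by
      intro i hi
      rcases Finset.mem_insert.1 hi with rfl | hi
      · exact hgW
      · exact hW i hi)
  have h1 := Finset.card_le_card this
  have h2 := C.big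
  omega

lemma Quad.inside {c : Ch V} {x y z w : V} (h : Quad c x y z w) {W : Finset V} (hx : x ∈ W) (hy : y ∈ W) (hz : z ∈ W)
    (hw : w ∈ W) : ∀ a b, c s(a, b) ≠ 0 → a ∈ W := by
  intro a b hab
  rw [h.2] at hab
  simp only [Sym2.eq_iff] at hab
  rcases hab with (⟨rfl, rfl⟩ | ⟨rfl, rfl⟩) | (⟨rfl, rfl⟩ | ⟨rfl, rfl⟩) | (⟨rfl, rfl⟩ | ⟨rfl, rfl⟩) |
    (⟨rfl, rfl⟩ | ⟨rfl, rfl⟩) <;> assumption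

lemma Pentg.inside {c : Ch V} {x y z w s : V} (h : Pentg c x y z w s) {W : Finset V} (hx : x ∈ W) (hy : y ∈ W) (hz : z ∈ W)
    (hw : w ∈ W) (hs : s ∈ W) : ∀ a b, c s(a, b) ≠ 0 → a ∈ W := by
  intro a b hab
  rw [h.2] at hab
  simp only [Sym2.eq_iff] at hab
  rcases hab with (⟨rfl, rfl⟩ | ⟨rfl, rfl⟩) | (⟨rfl, rfl⟩ | ⟨rfl, rfl⟩) | (⟨rfl, rfl⟩ | ⟨rfl, rfl⟩) |
    (⟨rfl, rfl⟩ | ⟨rfl, rfl⟩) | (⟨rfl, rfl⟩ | ⟨rfl, rfl⟩) <;> assumption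

/-- parity at a vertex where the boundary only can use three neighbours -/
lemma par3 {G : SimpleGraph V} {c : Ch V} (hc : c ∈ Z G) {v p q r : V} (hpq : p ≠ q) (hpr : p ≠ r) (hqr : q ≠ r)
    (h : ∀ u, c s(v, u) ≠ 0 → u = p ∨ u = q ∨ u = r) : c s(v, p) + c s(v, q) + c s(v, r) = 0 := by
  have h1 := hc.2 v
  unfold bd at h1
  rw [← Finset.sum_subset (Finset.subset_univ ({p, q, r} : Finset V)) (by
    intro u _ hu
    by_contra h'
    have := h u h'
    simp at hu; tauto), Finset.sum_insert (by simp [hpq, hpr]), Finset.sum_pair hqr, ← add_assoc] at h1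
  exact h1

lemma c44_y (C : Ctx H U F) {K : Finset ι} {W : Finset V} (hW : Inside F K W) {g : ι} (hg : g ∉ K)
    {x y z w q r : V} (hWe : W = {x, z, y, q, r}) (hnd : [x, z, y, q, r].Nodup)
    (he : (∑ i ∈ K, F i) s(x, y) ≠ 0) (hQ : Quad (F g) x y z w)
    (hE : Ed H W ⊆ EK F K) (h1 : ¬ H.Adj y q) : ∀ v, H.Adj y v → v = r ∨ v = x ∨ v = z := by
  have hn := hQ.1
  have hE' := EK_sub C hW
  have hy : y ∈ W := by rw [hWe]; simp
  have hz : z ∈ W := by rw [hWe]; simp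
  have cl : ∀ v, s(y, v) ∈ EK F K → v = x ∨ v = z ∨ v = r := by
    intro v hv
    obtain ⟨_, h2, h3⟩ := mem_Ed.1 (hE' hv)
    rw [hWe] at h2
    simp only [Finset.mem_insert, Finset.mem_singleton] at h2
    rcases h2 with h2 | h2 | h2 | h2 | h2
    · exact Or.inl h2
    · exact Or.inr (Or.inl h2)
    · exact absurd h2.symm h3.ne
    · exact absurd (h2 ▸ h3) h1
    · exact Or.inr (Or.inr h2)
  have gyz : F g s(y, z) ≠ 0 := (hQ.2 _).2 (Or.inr (Or.inl rfl))
  have gyx : F g s(y, x) ≠ 0 := (hQ.2 _).2 (Or.inl Sym2.eq_swap)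
  have dyz : (∑ i ∈ K, F i) s(y, z) ≠ 0 := on_bd C hg gyz (hE (mem_Ed.2 ⟨hy, hz, C.adj gyz⟩))
  have dyx : (∑ i ∈ K, F i) s(y, x) ≠ 0 := by rwa [Sym2.eq_swap]
  have nxz : x ≠ z := by intro h; simp [h] at hnd
  have nxr : x ≠ r := by intro h; simp [h] at hnd
  have nzr : z ≠ r := by intro h; simp [h] at hnd
  have dyr : (∑ i ∈ K, F i) s(y, r) = 0 := by
    have := par3 (sum_mem C K) nxz nxr nzr (fun u hu => cl u (D_EK hu))
    rw [z1 dyz, z1 dyx] at this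
    generalize (∑ i ∈ K, F i) s(y, r) = t at this
    clear * - this
    revert t; decide
  have gy : ∀ u, F g s(y, u) ≠ 0 ↔ u = x ∨ u = z := by
    intro u
    constructor
    · intro h
      rw [hQ.2] at h
      simp only [Sym2.eq_iff] at h
      clear * - h hn; simp at hn; grind
    · rintro (rfl | rfl) <;> assumption
  intro v hv
  rcases close_g C hg (v := y) (u0 := z) (by
    intro u
    rw [gy]
    constructor
    · rintro (rfl | rfl) <;> assumption
    · intro h
      rcases cl u (D_EK h) with h' | h' | h'
      · exact Or.inl h'
      · exact Or.inr h'
      · rw [h'] at h; exact absurd dyr h) gyz v hv with h | h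
  · have := (gy v).1 h; tauto
  · have := cl v h; tauto

/-- `u` is the exceptional middle vertex, different from `y` -/
lemma c44_u (C : Ctx H U F) {K : Finset ι} {W : Finset V} (hW : Inside F K W)
    (hl : len (∑ i ∈ K, F i) = 4) {g : ι} (hg : g ∉ K)
    {x y z w u t : V} (hWe : W = {x, z, y, u, t}) (hnd : [x, z, y, u, t].Nodup)
    (he : (∑ i ∈ K, F i) s(x, y) ≠ 0) (hQ : Quad (F g) x y z w)
    (hE : Ed H W ⊆ EK F K) (h1 : ¬ H.Adj y u) (h2 : ¬ H.Adj u t) (hxu : H.Adj x u) (hxt : H.Adj x t) (hyt : H.Adj y t) : False := by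
  have Ny := c44_y C hW hg hWe hnd he hQ hE h1
  have hE' := EK_sub C hW
  have hx : x ∈ W := by rw [hWe]; simp
  have hy : y ∈ W := by rw [hWe]; simp
  have hz : z ∈ W := by rw [hWe]; simp
  have hu : u ∈ W := by rw [hWe]; simp
  have ht : t ∈ W := by rw [hWe]; simp
  have clu : ∀ v, s(u, v) ∈ EK F K → v = x ∨ v = z := by
    intro v hv
    obtain ⟨_, h2', h3⟩ := mem_Ed.1 (hE' hv)
    rw [hWe] at h2'
    simp only [Finset.mem_insert, Finset.mem_singleton] at h2'
    rcases h2' with h | h | h | h | h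
    · exact Or.inl h
    · exact Or.inr h
    · exact absurd (h ▸ h3.symm) h1
    · exact absurd h.symm h3.ne
    · exact absurd (h ▸ h3) h2
  have clt : ∀ v, s(t, v) ∈ EK F K → v = x ∨ v = y ∨ v = z := by
    intro v hv
    obtain ⟨_, h2', h3⟩ := mem_Ed.1 (hE' hv)
    rw [hWe] at h2'
    simp only [Finset.mem_insert, Finset.mem_singleton] at h2'
    rcases h2' with h | h | h | h | h
    · exact Or.inl h
    · exact Or.inr (Or.inr h)
    · exact Or.inr (Or.inl h)
    · exact absurd (h ▸ h3.symm) h2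
    · exact absurd h.symm h3.ne
  have gyz : F g s(y, z) ≠ 0 := (hQ.2 _).2 (Or.inr (Or.inl rfl))
  have dyz : (∑ i ∈ K, F i) s(y, z) ≠ 0 := on_bd C hg gyz (hE (mem_Ed.2 ⟨hy, hz, C.adj gyz⟩))
  have nxz : x ≠ z := by intro h; simp [h] at hnd
  have nxt : x ≠ t := by intro h; simp [h] at hnd
  have nzt : z ≠ t := by intro h; simp [h] at hnd
  have par := par3 (sum_mem C K) nxz nxt nzt (v := u) (fun v hv => by have := clu v (D_EK hv); tauto)
  have dut : (∑ i ∈ K, F i) s(u, t) = 0 := by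
    by_contra h
    rcases clu t (D_EK h) with h | h
    exacts [nxt h.symm, nzt h.symm]
  rw [dut, add_zero] at par
  by_cases hux : (∑ i ∈ K, F i) s(u, x) = 0
  · have huz : (∑ i ∈ K, F i) s(u, z) = 0 := by rw [hux, zero_add] at par; exact par
    refine C.deg u (C.tc.supp u x hxu.symm) x z (fun v hv => clu v (close_K C (u0 := x) ?_ (hE (mem_Ed.2 ⟨hu, hx, hxu.symm⟩)) v hv))
    intro v
    by_contra h
    rcases clu v (D_EK h) with h' | h' <;> rw [h'] at h
    exacts [h hux, h huz]
  · have huz : (∑ i ∈ K, F i) s(u, z) ≠ 0 := by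
      rw [z1 hux] at par
      intro h; rw [h] at par; revert par; decide
    have hDt : ∀ v, (∑ i ∈ K, F i) s(t, v) = 0 := by
      intro v
      by_contra h
      have hs : ({s(x, y), s(y, z), s(u, x), s(u, z), s(t, v)} : Finset (Sym2 V)) ⊆ univ.filter (fun e => (∑ i ∈ K, F i) e ≠ 0) := by
        intro e h'
        simp only [Finset.mem_insert, Finset.mem_singleton] at h'
        simp only [Finset.mem_filter, Finset.mem_univ, true_and]
        rcases h' with rfl | rfl | rfl | rfl | rfl <;> assumption
      have hc := Finset.card_le_card hs
      have hc' : (univ.filter (fun e => (∑ i ∈ K, F i) e ≠ 0)).card = 4 := hl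
      rw [hc', Finset.card_insert_of_notMem, Finset.card_insert_of_notMem, Finset.card_insert_of_notMem,
        Finset.card_insert_of_notMem, Finset.card_singleton] at hc
      · omega
      all_goals
        simp only [Finset.mem_insert, Finset.mem_singleton, Sym2.eq_iff]
        clear * - hnd
        simp at hnd
        grind
    have Nt : ∀ v, H.Adj t v → v = y ∨ v = x ∨ v = z := by
      intro v hv
      have := clt v (close_K C (u0 := x) hDt (hE (mem_Ed.2 ⟨ht, hx, hxt.symm⟩)) v hv)
      tauto
    exact C.pair y t hyt x z x z Ny Nt

lemma c44_aux (C : Ctx H U F) {K : Finset ι} (hl : len (∑ i ∈ K, F i) = 4) {W : Finset V}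
    (hW5 : W.card = 5) (hW : Inside F K W) (h8 : (EK F K).card = 8) {g : ι} (hg : g ∉ K)
    {x y z w : V} (hx : x ∈ W) (hy : y ∈ W)
    (he : (∑ i ∈ K, F i) s(x, y) ≠ 0) (hQ : Quad (F g) x y z w) (hw : w ∉ W) (hz : z ∈ W) : False := by
  have hn := hQ.1
  have hE' := EK_sub C hW
  have nxz : x ≠ z := by clear * - hn; simp at hn; tauto
  have nxy : x ≠ y := by clear * - hn; simp at hn; tauto
  have nyz : y ≠ z := by clear * - hn; simp at hn; tauto
  have zw : H.Adj z w := C.adj ((hQ.2 _).2 (Or.inr (Or.inr (Or.inl rfl))))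
  have wx : H.Adj w x := C.adj ((hQ.2 _).2 (Or.inr (Or.inr (Or.inr rfl))))
  obtain ⟨q, r, hWe, hnd⟩ := split5' hW5 hx hz hy nxz nxy nyz
  have hc := Finset.card_le_card hE'
  obtain ⟨h8', a1, a2, a3, a4⟩ := ham C.free hWe hnd hw wx zw.symm (by omega)
  have hE : Ed H W ⊆ EK F K := by
    rw [Finset.eq_of_subset_of_card_le hE' (by omega)]
  have yU : y ∈ U := C.tc.supp y x a1.symm
  have hWe' : W = {x, z, y, r, q} := by rw [hWe]; clear * -; ext; simp; grind
  have hnd' : [x, z, y, r, q].Nodup := by clear * - hnd; simp at *; grind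
  have degy : ¬ H.Adj y q → ¬ H.Adj y r → False := by
    intro b1 b2
    have Ny := c44_y C hW hg hWe hnd he hQ hE b1
    refine C.deg y yU x z (fun v hv => ?_)
    rcases Ny v hv with h | h | h
    · rw [h] at hv; exact absurd hv b2
    · exact Or.inl h
    · exact Or.inr h
  rcases a4 with ⟨b1, b2⟩ | ⟨b1, b2⟩ | ⟨b1, b2⟩
  · exact degy b1 b2
  · by_cases b3 : H.Adj y r
    · exact c44_u C hW hl hg hWe hnd he hQ hE b1 b2 a2 a3 b3
    · exact degy b1 b3
  · by_cases b3 : H.Adj y q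
    · exact c44_u C hW hl hg hWe' hnd' he hQ hE b1 (fun h => b2 h.symm) a3 a2 b3
    · exact degy b3 b1

lemma Comp.W5 (C : Ctx H U F) {K : Finset ι} (hK : Comp F K) (h8 : 8 ≤ (EK F K).card) :
    ∃ W : Finset V, W.card = 5 ∧ Inside F K W := by
  obtain ⟨W, hW5, hW⟩ := hK.five C
  refine ⟨W, ?_, hW⟩
  by_contra hne
  have h1 := Ed_le6 (G := H) (W := W) (by omega)
  have h2 := Finset.card_le_card (EK_sub C hW)
  omega

lemma Comp.quads (C : Ctx H U F) {K : Finset ι} (hK : Comp F K)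
    (hcase : ((EK F K).card = 8 ∧ len (∑ i ∈ K, F i) = 4) ∨ ((EK F K).card = 9 ∧ len (∑ i ∈ K, F i) = 3)) {g : ι}
    (hg : g ∉ K) {e : Sym2 V} (he : (∑ i ∈ K, F i) e ≠ 0) (hge : F g e ≠ 0) (h4 : len (F g) = 4) : False := by
  obtain ⟨k0, hk0⟩ := C.cyc (i := g) (by intro h; rw [h] at hge; exact hge rfl)
  rw [h4] at hk0
  obtain ⟨k, hk, rfl⟩ := hk0.at hge
  have hQ := hk.quad
  generalize k 0 = x at *
  generalize k 1 = y at *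
  generalize k 2 = z at *
  generalize k 3 = w at *
  obtain ⟨W, hW5, hW⟩ := hK.W5 C (by omega)
  have hE' := EK_sub C hW
  have hc := Finset.card_le_card hE'
  obtain ⟨hx, hy, -⟩ := mem_Ed.1 (hE' (D_EK he))
  have hn := hQ.1
  have nxy : x ≠ y := by clear * - hn; simp at hn; tauto
  have nxz : x ≠ z := by clear * - hn; simp at hn; tauto
  have nyw : y ≠ w := by clear * - hn; simp at hn; tauto
  have yz : H.Adj y z := C.adj ((hQ.2 _).2 (Or.inr (Or.inl rfl)))
  have zw : H.Adj z w := C.adj ((hQ.2 _).2 (Or.inr (Or.inr (Or.inl rfl))))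
  have wx : H.Adj w x := C.adj ((hQ.2 _).2 (Or.inr (Or.inr (Or.inr rfl))))
  by_cases hz : z ∈ W <;> by_cases hw : w ∈ W
  · exact hK.inW C hW5 hW hcase hg (by omega) (hQ.inside hx hy hz hw)
  · rcases hcase with ⟨h8, hl⟩ | ⟨h9, hl⟩
    · exact c44_aux C hl hW5 hW h8 hg hx hy he hQ hw hz
    · exact ham9 C.free hW5 hx hz nxz hw wx zw.symm (by omega)
  · rcases hcase with ⟨h8, hl⟩ | ⟨h9, hl⟩
    · exact c44_aux C hl hW5 hW h8 hg hy hx (by rwa [Sym2.eq_swap]) hQ.refl hz hw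
    · exact ham9 C.free hW5 hy hw nyw hz yz.symm zw (by omega)
  · exact mid8 C.free hW5 hx hy nxy hw hz wx zw.symm yz.symm (by omega)

lemma Comp.pents (C : Ctx H U F) {K : Finset ι} (hK : Comp F K)
    (h9 : (EK F K).card = 9) (hl : len (∑ i ∈ K, F i) = 3) {g : ι}
    (hg : g ∉ K) {e : Sym2 V} (he : (∑ i ∈ K, F i) e ≠ 0) (hge : F g e ≠ 0) (h5 : len (F g) = 5) : False := by
  obtain ⟨k0, hk0⟩ := C.cyc (i := g) (by intro h; rw [h] at hge; exact hge rfl)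
  rw [h5] at hk0
  obtain ⟨k, hk, rfl⟩ := hk0.at hge
  have hQ := hk.pentg
  generalize k 0 = x at *
  generalize k 1 = y at *
  generalize k 2 = z at *
  generalize k 3 = w at *
  generalize k 4 = s at *
  obtain ⟨W, hW5, hW⟩ := hK.W5 C (by omega)
  have hE' := EK_sub C hW
  have hc := Finset.card_le_card hE'
  obtain ⟨hx, hy, xy⟩ := mem_Ed.1 (hE' (D_EK he))
  have hn := hQ.1
  have nxz : x ≠ z := by clear * - hn; simp at hn; tauto
  have nyw : y ≠ w := by clear * - hn; simp at hn; tauto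
  have nxw : x ≠ w := by clear * - hn; simp at hn; tauto
  have nzs : z ≠ s := by clear * - hn; simp at hn; tauto
  have nys : y ≠ s := by clear * - hn; simp at hn; tauto
  have yz : H.Adj y z := C.adj ((hQ.2 _).2 (Or.inr (Or.inl rfl)))
  have zw : H.Adj z w := C.adj ((hQ.2 _).2 (Or.inr (Or.inr (Or.inl rfl))))
  have ws : H.Adj w s := C.adj ((hQ.2 _).2 (Or.inr (Or.inr (Or.inr (Or.inl rfl)))))
  have sx : H.Adj s x := C.adj ((hQ.2 _).2 (Or.inr (Or.inr (Or.inr (Or.inr rfl)))))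
  by_cases hw : w ∈ W
  · by_cases hz : z ∈ W
    · by_cases hs : s ∈ W
      · exact hK.inW C hW5 hW (Or.inr ⟨h9, hl⟩) hg (by omega) (hQ.inside hx hy hz hw hs)
      · exact ham9 C.free hW5 hx hw nxw hs sx ws.symm (by omega)
    · exact ham9 C.free hW5 hy hw nyw hz yz.symm zw (by omega)
  · by_cases hz : z ∈ W <;> by_cases hs : s ∈ W
    · exact ham9 C.free hW5 hz hs nzs hw zw.symm ws (by omega)
    · exact mid8 C.free hW5 hx hz nxz hs hw sx ws.symm zw.symm (by omega)
    · exact mid8 C.free hW5 hy hs nys hz hw yz.symm zw ws (by omega)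
    · obtain ⟨i, hi, hi'⟩ := mem_EK.1 (D_EK he)
      obtain ⟨a', b', c', ht⟩ := C.tri (hK.three i hi)
      obtain ⟨u, hu⟩ := ht.edge hi'
      have huW := (hu.outside (hW i hi)).2.2
      have u1 : u ≠ z := by rintro rfl; exact hz huW
      have u2 : u ≠ w := by rintro rfl; exact hw huW
      have u3 : u ≠ s := by rintro rfl; exact hs huW
      have u4 := hu.2.1
      have u5 := hu.2.2.1
      refine th6 C.free (a := x) (b := u) (c := y) (d := z) (e := w) (f := s) ?_ (C.tadj hu).2.2 (C.tadj hu).2.1.symm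
        yz zw ws sx (Or.inl xy)
      clear * - hn u1 u2 u3 u4 u5
      simp at *
      grind

/-- summary: weight of the face across a boundary edge -/
def wt (n : ℕ) : ℕ := if n ≤ 3 then 0 else if n = 4 then 2 else if n = 5 then 3 else 5

lemma Comp.summary (C : Ctx H U F) {K : Finset ι} (hK : Comp F K) : ∃ w0, 3 * K.card ≤ w0 * len (∑ i ∈ K, F i) ∧
    ∀ e, (∑ i ∈ K, F i) e ≠ 0 → ∃ g, F g e ≠ 0 ∧ w0 ≤ wt (len (F g)) := by
  have hcount := C.count K hK.three
  rcases hK.tri3 C with h | ⟨h1, h2⟩ | ⟨h1, h2⟩ | ⟨h1, h2⟩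
  · refine ⟨2, h, fun e he => ?_⟩
    obtain ⟨g, hg, hge, h4⟩ := hK.other C he
    refine ⟨g, hge, ?_⟩
    unfold wt; split_ifs <;> omega
  · refine ⟨3, by omega, fun e he => ?_⟩
    obtain ⟨g, hg, hge, h4⟩ := hK.other C he
    refine ⟨g, hge, ?_⟩
    have := hK.c33 C h1 h2 hg he hge
    unfold wt; split_ifs <;> omega
  · refine ⟨3, by omega, fun e he => ?_⟩
    obtain ⟨g, hg, hge, h4⟩ := hK.other C he
    refine ⟨g, hge, ?_⟩
    have := hK.quads C (Or.inl ⟨by omega, h2⟩) hg he hge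
    unfold wt; split_ifs <;> omega
  · refine ⟨5, by omega, fun e he => ?_⟩
    obtain ⟨g, hg, hge, h4⟩ := hK.other C he
    refine ⟨g, hge, ?_⟩
    have := hK.quads C (Or.inr ⟨by omega, h2⟩) hg he hge
    have := hK.pents C (by omega) h2 hg he hge
    unfold wt; split_ifs <;> omega

end P6f
end T6

open SimpleGraph

namespace T6
section P6g
set_option linter.unusedSectionVars false
set_option linter.unusedSimpArgs false
open scoped Classical
open Finset
variable {V : Type*} [Fintype V]
variable {H : SimpleGraph V} {U : Finset V} {ι : Type} [Fintype ι] {F : ι → Ch V}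

/-- charge available at an edge -/
noncomputable def om (F : ι → Ch V) (e : Sym2 V) : ℕ := ∑ j, if F j e ≠ 0 then wt (len (F j)) else 0

/-- triangular faces -/
noncomputable def TT (F : ι → Ch V) : Finset ι := univ.filter (fun i => len (F i) = 3)

lemma Comp.charge (C : Ctx H U F) {K : Finset ι} (hK : Comp F K) :
    3 * K.card ≤ ∑ i ∈ K, ∑ e, if F i e ≠ 0 then om F e else 0 := by
  obtain ⟨w0, h1, h2⟩ := hK.summary C
  refine h1.trans ?_
  rw [Finset.sum_comm]
  unfold len
  rw [mul_comm, ← smul_eq_mul, ← Finset.sum_const]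
  refine le_trans ?_ (Finset.sum_le_sum_of_subset (Finset.filter_subset (fun e => (∑ i ∈ K, F i) e ≠ 0) univ))
  apply Finset.sum_le_sum
  intro e he
  have he := (Finset.mem_filter.1 he).2
  obtain ⟨g, hg, hw⟩ := h2 e he
  obtain ⟨i, hi, hie⟩ := mem_EK.1 (D_EK he)
  have a1 : (if F i e ≠ 0 then om F e else 0) ≤ ∑ i ∈ K, if F i e ≠ 0 then om F e else 0 :=
    Finset.single_le_sum (f := fun i => if F i e ≠ 0 then om F e else 0) (fun _ _ => Nat.zero_le _) hi
  have a2 : (if F g e ≠ 0 then wt (len (F g)) else 0) ≤ om F e :=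
    Finset.single_le_sum (f := fun j => if F j e ≠ 0 then wt (len (F j)) else 0) (fun _ _ => Nat.zero_le _)
      (Finset.mem_univ g)
  rw [if_pos hie] at a1
  rw [if_pos hg] at a2
  omega

lemma comp_fiber (i0 : ι) (h0 : i0 ∈ TT F) :
    Comp F ((TT F).filter (fun i => (TG F).connectedComponentMk i = (TG F).connectedComponentMk i0)) := by
  have hc : ∀ i ∈ (TT F).filter (fun i => (TG F).connectedComponentMk i = (TG F).connectedComponentMk i0),
      ∀ j, (TG F).Adj i j →
      j ∈ (TT F).filter (fun i => (TG F).connectedComponentMk i = (TG F).connectedComponentMk i0) := by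
    intro i hi j hij
    simp only [Finset.mem_filter, TT, Finset.mem_univ, true_and] at hi ⊢
    refine ⟨hij.2.2.1, ?_⟩
    rw [← hi.2]
    exact ConnectedComponent.sound hij.symm.reachable
  refine ⟨⟨i0, by simp [h0]⟩, ?_, hc, ?_⟩
  · intro P hP hne hne2
    by_contra hcon
    push Not at hcon
    obtain ⟨a, ha⟩ := hne
    obtain ⟨b, hb⟩ := hne2
    have hab : (TG F).Reachable a b := by
      apply ConnectedComponent.exact
      rw [(Finset.mem_filter.1 (hP ha)).2, (Finset.mem_filter.1 (Finset.mem_sdiff.1 hb).1).2]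
    rw [reachable_iff_reflTransGen] at hab
    have : b ∈ P := by
      clear hb
      induction hab with
      | refl => exact ha
      | tail _ h ih =>
        by_contra hn
        exact hcon _ ih _ (Finset.mem_sdiff.2 ⟨hc _ (hP ih) _ h, hn⟩) h
    exact (Finset.mem_sdiff.1 hb).2 this
  · intro i hi
    exact (Finset.mem_filter.1 (Finset.mem_filter.1 hi).1).2

lemma Ctx.charge1 (C : Ctx H U F) : 3 * (TT F).card ≤ ∑ i ∈ TT F, ∑ e, if F i e ≠ 0 then om F e else 0 := by
  have hm : ∀ i ∈ TT F, (TG F).connectedComponentMk i ∈ (TT F).image (TG F).connectedComponentMk :=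
    fun i hi => Finset.mem_image_of_mem _ hi
  rw [← Finset.sum_fiberwise_of_maps_to hm, Finset.card_eq_sum_card_fiberwise hm, Finset.mul_sum]
  apply Finset.sum_le_sum
  intro k hk
  obtain ⟨i0, h0, rfl⟩ := Finset.mem_image.1 hk
  exact (comp_fiber i0 h0).charge C

lemma Ctx.charge2 (C : Ctx H U F) : 3 * (TT F).card ≤ ∑ j, wt (len (F j)) * len (F j) := by
  have e2 : ∑ j, wt (len (F j)) * len (F j) = ∑ e, om F e := by
    unfold om
    rw [Finset.sum_comm]
    apply Finset.sum_congr rfl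
    intro j _
    rw [← Finset.sum_filter, Finset.sum_const, smul_eq_mul, mul_comm]
    rfl
  rw [e2]
  refine C.charge1.trans ?_
  rw [Finset.sum_comm]
  apply Finset.sum_le_sum
  intro e _
  rw [← Finset.sum_filter, Finset.sum_const, smul_eq_mul]
  by_cases h0 : om F e = 0
  · rw [h0]; simp
  · unfold om at h0
    obtain ⟨j, _, hj⟩ := Finset.exists_ne_zero_of_sum_ne_zero h0
    have hje : F j e ≠ 0 := by by_contra h; simp [h] at hj
    rw [if_pos hje] at hj
    have hsub : insert j ((TT F).filter (fun i => F i e ≠ 0)) ⊆ univ.filter (fun i => F i e ≠ 0) := by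
      intro x hx
      rcases Finset.mem_insert.1 hx with rfl | hx
      · simp [hje]
      · simp [(Finset.mem_filter.1 hx).2]
    have h4 := Finset.card_le_card hsub
    have h5 := C.sys.le2 e
    rw [Finset.card_insert_of_notMem (by
      intro hmem
      have := (Finset.mem_filter.1 (Finset.mem_filter.1 hmem).1).2
      rw [this] at hj
      exact hj rfl)] at h4
    calc _ ≤ 1 * om F e := Nat.mul_le_mul_right _ (by omega)
      _ = _ := one_mul _

lemma Ctx.len_sum (C : Ctx H U F) : ∑ j, len (F j) = 2 * (Ed H U).card := by
  have e1 : ∀ j, len (F j) = ∑ e ∈ Ed H U, if F j e ≠ 0 then 1 else 0 := by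
    intro j
    rw [← Finset.card_filter]
    unfold len
    congr 1
    ext e
    induction e using Sym2.ind with | _ a b =>
    simp only [Finset.mem_filter, Finset.mem_univ, true_and, mem_Ed]
    constructor
    · intro h
      have := C.adj h
      exact ⟨⟨C.tc.supp _ _ this, C.tc.supp _ _ this.symm, this⟩, h⟩
    · exact fun h => h.2
  simp only [e1]
  rw [Finset.sum_comm, Finset.card_eq_sum_ones, Finset.mul_sum]
  apply Finset.sum_congr rfl
  intro e he
  rw [← Finset.card_filter]
  induction e using Sym2.ind with | _ a b =>
  exact C.two (mem_Ed.1 he).2.2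

/-- nonzero faces -/
noncomputable def NF (F : ι → Ch V) : Finset ι := univ.filter (fun i => F i ≠ 0)

lemma Ctx.faces (C : Ctx H U F) : 36 * (NF F).card ≤ 22 * (Ed H U).card := by
  have h1 : ∀ j, 36 * (if F j ≠ 0 then 1 else 0) + wt (len (F j)) * len (F j) ≤
      11 * len (F j) + 3 * (if len (F j) = 3 then 1 else 0) := by
    intro j
    by_cases h0 : F j = 0
    · simp [h0, len]
    · obtain ⟨g, hg⟩ := C.cyc h0
      have := hg.three
      rw [if_pos h0]
      generalize len (F j) = m at *
      unfold wt
      split_ifs <;> omega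
  have h2 := Finset.sum_le_sum (fun j (_ : j ∈ (univ : Finset ι)) => h1 j)
  rw [Finset.sum_add_distrib, Finset.sum_add_distrib, ← Finset.mul_sum, ← Finset.mul_sum, ← Finset.mul_sum,
    ← Finset.card_filter, ← Finset.card_filter, C.len_sum] at h2
  have h3 := C.charge2
  unfold NF
  unfold TT at h3
  omega

end P6g
end T6

open SimpleGraph

namespace T6
section P6h
set_option linter.unusedSectionVars false
set_option linter.unusedSimpArgs false
open scoped Classical
open Finset
variable {V : Type*} [Fintype V]
variable {H : SimpleGraph V} {U : Finset V} {ι : Type} [Fintype ι] {F : ι → Ch V}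

/-- extension of functions on the edge set by zero -/
noncomputable def JJ (E : Finset (Sym2 V)) : (E → ZMod 2) →ₗ[ZMod 2] Ch V where
  toFun φ := fun e => if h : e ∈ E then φ ⟨e, h⟩ else 0
  map_add' φ ψ := by
    funext e
    by_cases h : e ∈ E <;> simp [h]
  map_smul' a φ := by
    funext e
    by_cases h : e ∈ E <;> simp [h]

lemma JJ_inj (E : Finset (Sym2 V)) : Function.Injective (JJ E) := by
  intro φ ψ h
  funext ⟨e, he⟩
  have := congrFun h e
  simpa [JJ, he] using this

/-- boundary map -/
noncomputable def BB (W : Finset V) : Ch V →ₗ[ZMod 2] (W → ZMod 2) where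
  toFun c := fun u => bd c u
  map_add' c d := by funext u; simp [bd_add]
  map_smul' a c := by funext u; simp [bd_smul]

lemma Z_rank (hs : ∀ a b, H.Adj a b → a ∈ U) {r : V} (hr : r ∈ U) :
    (Ed H U).card + 1 ≤ Module.finrank (ZMod 2) (Z H) + U.card := by
  let L := (BB (U.erase r)).comp (JJ (Ed H U))
  have h1 := LinearMap.finrank_range_add_finrank_ker L
  rw [Module.finrank_fintype_fun_eq_card, Fintype.card_coe] at h1
  have h2 : Module.finrank (ZMod 2) (LinearMap.range L) ≤ U.card - 1 := by
    refine (Submodule.finrank_le _).trans ?_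
    rw [Module.finrank_fintype_fun_eq_card, Fintype.card_coe, Finset.card_erase_of_mem hr]
  have h3 : Module.finrank (ZMod 2) (LinearMap.ker L) ≤ Module.finrank (ZMod 2) (Z H) := by
    rw [(Submodule.equivMapOfInjective _ (JJ_inj (Ed H U)) (LinearMap.ker L)).finrank_eq]
    apply Submodule.finrank_mono
    rintro c ⟨φ, hφ, rfl⟩
    have hA : ∀ a b, ¬ H.Adj a b → JJ (Ed H U) φ s(a, b) = 0 := by
      intro a b hab
      have : s(a, b) ∉ Ed H U := fun h => hab (mem_Ed.1 h).2.2
      simp [JJ, this]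
    have hB : ∀ v ∈ univ, v ≠ r → bd (JJ (Ed H U) φ) v = 0 := by
      intro v _ hv
      by_cases hvU : v ∈ U
      · have h5 : L φ = 0 := hφ
        have := congrFun h5 ⟨v, Finset.mem_erase.2 ⟨hv, hvU⟩⟩
        exact this
      · unfold bd
        apply Finset.sum_eq_zero
        intro u _
        exact hA v u (fun h => hvU (hs v u h))
    refine ⟨hA, fun v => ?_⟩
    by_cases hv : v = r
    · subst hv
      have h6 := hand (JJ (Ed H U) φ) (fun a => hA a a (H.loopless.irrefl a)) univ
      rw [Finset.sum_eq_single_of_mem v (Finset.mem_univ v) hB] at h6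
      rw [h6]; simp
    · exact hB v (Finset.mem_univ v) hv
  have h4 : 0 < U.card := Finset.card_pos.2 ⟨r, hr⟩
  omega

lemma Ctx.euler (C : Ctx H U F) : (Ed H U).card + 2 ≤ (NF F).card + U.card := by
  have hb := C.big
  obtain ⟨r, hr⟩ := Finset.card_pos.1 (by omega : 0 < U.card)
  have h1 := Z_rank C.tc.supp hr
  have hex : ∃ w, H.Adj r w := by
    by_contra hcon
    push Not at hcon
    exact C.deg r hr r r (fun w hw => absurd hw (hcon w))
  obtain ⟨w, hw⟩ := hex
  obtain ⟨i, hi⟩ := C.face hw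
  have hiN : i ∈ NF F := by simp only [NF, Finset.mem_filter, Finset.mem_univ, true_and]; intro h; rw [h] at hi; exact hi rfl
  have h2 : Module.finrank (ZMod 2) (Z H) ≤ (NF F).card - 1 := by
    have hle : Z H ≤ Submodule.span (ZMod 2) ((((NF F).erase i).image F : Finset (Ch V)) : Set (Ch V)) := by
      intro c hc
      obtain ⟨a, ha, rfl⟩ := C.sys.drop i c hc
      apply Submodule.sum_mem
      intro j _
      by_cases hj : j = i
      · rw [hj, ha, zero_smul]; exact Submodule.zero_mem _
      · by_cases hF : F j = 0
        · rw [hF, smul_zero]; exact Submodule.zero_mem _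
        · apply Submodule.smul_mem
          apply Submodule.subset_span
          simp only [Finset.mem_coe, Finset.mem_image]
          exact ⟨j, by simp [NF, hj, hF], rfl⟩
    refine (Submodule.finrank_mono hle).trans ?_
    refine (finrank_span_finset_le_card _).trans ?_
    refine Finset.card_image_le.trans ?_
    rw [Finset.card_erase_of_mem hiN]
  have h3 : 0 < (NF F).card := Finset.card_pos.2 ⟨i, hiN⟩
  omega

lemma Ctx.bound (C : Ctx H U F) : 7 * (Ed H U).card + 36 ≤ 18 * U.card := by
  have h1 := C.euler
  have h2 := C.faces
  omega

end P6h
end T6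

open SimpleGraph

namespace T6
section P6i
set_option linter.unusedSectionVars false
set_option linter.unusedSimpArgs false
open scoped Classical
open Finset
variable {V : Type*} [Fintype V]

/-- the part of `G` inside `U` -/
def RG (G : SimpleGraph V) (U : Finset V) : SimpleGraph V where
  Adj a b := G.Adj a b ∧ a ∈ U ∧ b ∈ U
  symm := ⟨fun _ _ h => ⟨h.1.symm, h.2.2, h.2.1⟩⟩
  loopless := ⟨fun p h => G.loopless.irrefl p h.1⟩

lemma RG_le (G : SimpleGraph V) (U : Finset V) : RG G U ≤ G := fun _ _ h => h.1

lemma Conn.RG {G : SimpleGraph V} {U A : Finset V} (h : Conn G A) (hA : A ⊆ U) : Conn (RG G U) A := by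
  intro P hP h1 h2
  obtain ⟨a, ha, b, hb, hab⟩ := h P hP h1 h2
  exact ⟨a, ha, b, hb, hab, hA (hP ha), hA (Finset.mem_sdiff.1 hb).1⟩

lemma Ed_RG (G : SimpleGraph V) (U : Finset V) : Ed (RG G U) U = Ed G U := by
  ext e
  induction e using Sym2.ind with | _ a b =>
  simp only [mem_Ed, T6.RG]
  tauto

/-- connected and without cut vertex -/
def TwoC (G : SimpleGraph V) (U : Finset V) : Prop := Conn G U ∧ ∀ v ∈ U, Conn G (U.erase v)

/-- a separation of order at most one -/
structure Sep (G : SimpleGraph V) (U A B : Finset V) : Prop where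
  un : A ∪ B = U
  ab : (A \ B).Nonempty
  ba : (B \ A).Nonempty
  int : (A ∩ B).card ≤ 1
  no : ∀ a ∈ A \ B, ∀ b ∈ B \ A, ¬ G.Adj a b

lemma Sep.symm {G : SimpleGraph V} {U A B : Finset V} (h : Sep G U A B) : Sep G U B A :=
  ⟨by rw [Finset.union_comm]; exact h.un, h.ba, h.ab, by rw [Finset.inter_comm]; exact h.int,
    fun a ha b hb hab => h.no b hb a ha hab.symm⟩

lemma exists_sep {G : SimpleGraph V} {U : Finset V} (h : ¬ TwoC G U) : ∃ A B, Sep G U A B := by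
  by_cases h1 : Conn G U
  · have : ∃ v ∈ U, ¬ Conn G (U.erase v) := by
      by_contra hcon
      push Not at hcon
      exact h ⟨h1, hcon⟩
    obtain ⟨v, hv, hn⟩ := this
    unfold Conn at hn
    push Not at hn
    obtain ⟨P, hP, hP1, hP2, hno⟩ := hn
    have hvP : v ∉ P := fun h => by simpa using hP h
    have e1 : insert v P \ (U \ P) = P := by
      clear * - hvP hv
      ext x; simp; grind
    have e2 : (U \ P) \ insert v P = U.erase v \ P := by
      clear * - hvP hv
      ext x; simp; grind
    refine ⟨insert v P, U \ P, ?_, ?_, ?_, ?_, ?_⟩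
    · ext x
      have := @hP x
      simp at this ⊢
      grind
    · rw [e1]; exact hP1
    · rw [e2]; exact hP2
    · rw [Finset.card_le_one]
      intro a ha b hb
      simp at ha hb
      grind
    · rw [e1, e2]; exact hno
  · unfold Conn at h1
    push Not at h1
    obtain ⟨P, hP, hP1, hP2, hno⟩ := h1
    have e1 : P \ (U \ P) = P := by ext x; simp; tauto
    have e2 : (U \ P) \ P = U \ P := by ext x; simp
    refine ⟨P, U \ P, ?_, ?_, ?_, ?_, ?_⟩
    · exact Finset.union_sdiff_of_subset hP
    · rw [e1]; exact hP1
    · rw [e2]; exact hP2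
    · simp
    · rw [e1, e2]; exact hno

lemma Sep.edges {G : SimpleGraph V} {U A B : Finset V} (h : Sep G U A B) :
    (Ed G U).card ≤ (Ed G A).card + (Ed G B).card := by
  refine le_trans (Finset.card_le_card ?_) (Finset.card_union_le _ _)
  intro e he
  induction e using Sym2.ind with | _ a b =>
  rw [Finset.mem_union, mem_Ed, mem_Ed]
  rw [mem_Ed, ← h.un, Finset.mem_union, Finset.mem_union] at he
  have h1 := h.no a
  have h2 := h.no b
  simp only [Finset.mem_sdiff] at h1 h2
  by_contra hcon
  have h3 := h1 (by tauto) b (by tauto)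
  have h4 := fun x y => h2 x a y he.2.2.symm
  tauto

lemma Sep.card {G : SimpleGraph V} {U A B : Finset V} (h : Sep G U A B) :
    A.card + B.card = U.card + (A ∩ B).card ∧ A.card < U.card ∧ B.card < U.card ∧
    1 + (A ∩ B).card ≤ A.card ∧ 1 + (A ∩ B).card ≤ B.card := by
  have h1 := Finset.card_union_add_card_inter A B
  rw [h.un] at h1
  have h2 := Finset.card_sdiff_add_card_inter A B
  have h3 := Finset.card_sdiff_add_card_inter B A
  rw [Finset.inter_comm B A] at h3
  have h4 := Finset.card_pos.2 h.ab
  have h5 := Finset.card_pos.2 h.ba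
  omega

/-- main bound below a given size -/
def Bd (G : SimpleGraph V) (m : ℕ) : Prop := ∀ U : Finset V, U.card < m → 2 ≤ U.card → 7 * (Ed G U).card + 27 ≤ 18 * U.card

lemma Ed_one {G : SimpleGraph V} {U : Finset V} (h : U.card ≤ 1) : (Ed G U).card = 0 := by
  have h1 := Ed_choose G U
  have h2 : U.card.choose 2 = 0 := Nat.choose_eq_zero_of_lt (by omega)
  omega

lemma Bd.weak {G : SimpleGraph V} {m : ℕ} (h : Bd G m) {U : Finset V} (hU : U.card < m) (h1 : 1 ≤ U.card) :
    7 * (Ed G U).card + 18 ≤ 18 * U.card := by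
  by_cases h2 : 2 ≤ U.card
  · have := h U hU h2; omega
  · have := Ed_one (G := G) (U := U) (by omega); omega

lemma Bd.sep {G : SimpleGraph V} {U A B : Finset V} (h : Bd G U.card) (hs : Sep G U A B) :
    7 * (Ed G U).card + 36 ≤ 18 * U.card := by
  obtain ⟨c1, c2, c3, c4, c5⟩ := hs.card
  have c6 := hs.int
  have c7 := hs.edges
  by_cases h0 : (A ∩ B).card = 0
  · have := h.weak c2 (by omega)
    have := h.weak c3 (by omega)
    omega
  · have := h A c2 (by omega)
    have := h B c3 (by omega)
    omega

lemma Ed_del {G : SimpleGraph V} {U : Finset V} (S : Finset V) (D : Finset (Sym2 V))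
    (h : ∀ a ∈ S, ∀ b ∈ U, G.Adj a b → s(a, b) ∈ D) : (Ed G U).card ≤ (Ed G (U \ S)).card + D.card := by
  refine le_trans (Finset.card_le_card ?_) (Finset.card_union_le _ _)
  intro e he
  induction e using Sym2.ind with | _ a b =>
  rw [mem_Ed] at he
  rw [Finset.mem_union, mem_Ed, Finset.mem_sdiff, Finset.mem_sdiff]
  by_cases ha : a ∈ S
  · exact Or.inr (h a ha b he.2.1 he.2.2)
  by_cases hb : b ∈ S
  · right; rw [Sym2.eq_swap]; exact h b hb a he.1 he.2.2.symm
  tauto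

lemma Bd.tc {G : SimpleGraph V} (hp : IsPlanar G) (hf : ¬ HasTheta6 G) {U : Finset V} (h : Bd G U.card)
    (hT : TwoC G U) (h6 : 6 ≤ U.card) : 7 * (Ed G U).card + 27 ≤ 18 * U.card := by
  by_contra hcon
  obtain ⟨ι, _, F, hF⟩ := (planar_mac (RG G U) (planar_mono (RG_le G U) hp)).sys
  have C : Ctx (RG G U) U F := by
    refine ⟨hF, ⟨fun a b h => h.2.1, hT.1.RG (Finset.Subset.refl _), ?_⟩, h6, ?_, planar_mono (RG_le G U) hp, ?_, ?_⟩
    · intro v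
      by_cases hv : v ∈ U
      · exact (hT.2 v hv).RG (Finset.erase_subset _ _)
      · rw [Finset.erase_eq_of_notMem hv]; exact hT.1.RG (Finset.Subset.refl _)
    · rintro ⟨v, h1, h2, i, j, h3, h4, h5, h6⟩
      exact hf ⟨v, h1, fun i => (h2 i).1, i, j, h3, h4, h5, h6.1⟩
    · intro u hu p q hpq
      have h1 := Ed_del (G := G) (U := U) {u} {s(u, p), s(u, q)} (by
        intro a ha b hb hab
        rw [Finset.mem_singleton] at ha
        subst ha
        rcases hpq b ⟨hab, hu, hb⟩ with rfl | rfl <;> simp)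
      have h2 : ({s(u, p), s(u, q)} : Finset (Sym2 V)).card ≤ 2 := Finset.card_le_two
      have h3 : (U \ {u}).card + 1 = U.card := by
        rw [← Finset.erase_eq, Finset.card_erase_add_one hu]
      have h4 := h (U \ {u}) (by omega) (by omega)
      omega
    · intro u v huv p q r s hu hv
      have h1 := Ed_del (G := G) (U := U) {u, v} {s(u, v), s(u, p), s(u, q), s(v, r), s(v, s)} (by
        intro a ha b hb hab
        rw [Finset.mem_insert, Finset.mem_singleton] at ha
        rcases ha with rfl | rfl
        · rcases hu b ⟨hab, huv.2.1, hb⟩ with rfl | rfl | rfl <;> simp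
        · rcases hv b ⟨hab, huv.2.2, hb⟩ with rfl | rfl | rfl
          · rw [Sym2.eq_swap]; simp
          · simp
          · simp)
      have h2 : ({s(u, v), s(u, p), s(u, q), s(v, r), s(v, s)} : Finset (Sym2 V)).card ≤ 5 := Finset.card_le_five
      have h3 : (U \ {u, v}).card + 2 = U.card := by
        rw [← Finset.card_pair huv.1.ne, Finset.card_sdiff_add_card_eq_card]
        intro x hx
        rw [Finset.mem_insert, Finset.mem_singleton] at hx
        rcases hx with rfl | rfl
        · exact huv.2.1
        · exact huv.2.2
      have h4 := h (U \ {u, v}) (by omega) (by omega)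
      omega
  have h7 := C.bound
  rw [Ed_RG] at h7
  omega

lemma all_bd {G : SimpleGraph V} (hp : IsPlanar G) (hf : ¬ HasTheta6 G) : ∀ m, Bd G m := by
  intro m
  induction m with
  | zero => intro U hU; omega
  | succ m ih =>
    intro U hU h2
    rcases Nat.lt_succ_iff_lt_or_eq.1 hU with h | h
    · exact ih U h h2
    subst h
    by_cases hT : TwoC G U
    · by_cases h6 : 6 ≤ U.card
      · exact ih.tc hp hf hT h6
      · have h5 : U.card = 5 ∨ U.card = 4 ∨ U.card = 3 ∨ U.card = 2 := by omega
        have h7 := Ed_choose G U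
        rcases h5 with h5 | h5 | h5 | h5
        · have := Ed_five hp h5; omega
        all_goals
          rw [h5] at h7 ⊢
          simp [Nat.choose] at h7
          omega
    · obtain ⟨A, B, hs⟩ := exists_sep hT
      have := ih.sep hs
      omega

end P6i
end T6

open SimpleGraph

namespace T6
section P7
set_option linter.unusedSectionVars false
set_option linter.unusedSimpArgs false
open scoped Classical
open Finset
variable {V : Type*} [Fintype V]

lemma twoC_of_set {G : SimpleGraph V} {B : Set V} (h : IsTwoConnSet G B) : TwoC G B.toFinset :=
  ⟨conn_of_pre h.2.1 (by simp), fun v hv => conn_of_pre (h.2.2 v (by simpa using hv)) (by simp; tauto)⟩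

lemma set_of_twoC {G : SimpleGraph V} {U : Finset V} (h : TwoC G U) (hne : U.Nonempty) :
    IsTwoConnSet G (U : Set V) :=
  ⟨by simpa using hne, pre_of_conn h.1 (by simp), fun v hv => pre_of_conn (h.2 v (by simpa using hv)) (by simp; tauto)⟩

lemma Sep.side {G : SimpleGraph V} {A B D : Finset V} (h : Sep G univ A B) (hD : TwoC G D) : D ⊆ A ∨ D ⊆ B := by
  by_contra hcon
  push Not at hcon
  obtain ⟨x, hx, hxA⟩ := Finset.not_subset.1 hcon.1
  obtain ⟨y, hy, hyB⟩ := Finset.not_subset.1 hcon.2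
  have hcov : ∀ z, z ∈ A ∨ z ∈ B := fun z => by
    have : z ∈ A ∪ B := by rw [h.un]; simp
    simpa using this
  have hC : Conn G (D \ (A ∩ B)) := by
    by_cases h0 : ∃ c ∈ D, c ∈ A ∩ B
    · obtain ⟨c, hcD, hc⟩ := h0
      have : D \ (A ∩ B) = D.erase c := by
        have h1 := Finset.card_le_one.1 h.int
        ext z
        rw [Finset.mem_sdiff, Finset.mem_erase]
        constructor
        · rintro ⟨h2, h3⟩; exact ⟨by rintro rfl; exact h3 hc, h2⟩
        · rintro ⟨h2, h3⟩; exact ⟨h3, fun h4 => h2 (h1 z h4 c hc)⟩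
      rw [this]; exact hD.2 c hcD
    · push Not at h0
      have : D \ (A ∩ B) = D := by
        ext z
        rw [Finset.mem_sdiff]
        exact ⟨fun h => h.1, fun h => ⟨h, h0 z h⟩⟩
      rw [this]; exact hD.1
  obtain ⟨a, ha, b, hb, hab⟩ := hC (D \ B) (by intro z; simp; tauto) ⟨y, by simp [hy, hyB]⟩
    ⟨x, by simp [hx, hxA]; exact (hcov x).resolve_left hxA⟩
  simp only [Finset.mem_sdiff, Finset.mem_inter, not_and, not_not] at ha hb
  refine h.no a ?_ b ?_ hab
  · rw [Finset.mem_sdiff]; exact ⟨(hcov a).resolve_right ha.2, ha.2⟩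
  · rw [Finset.mem_sdiff]
    have := hb.2 hb.1.1
    exact ⟨this, fun h => hb.1.2 h this⟩

lemma Sep.final {G : SimpleGraph V} (hp : IsPlanar G) (hf : ¬ HasTheta6 G) {U A B : Finset V} (hs : Sep G U A B)
    (hA : ¬ TwoC G A) : 7 * (Ed G U).card + 45 ≤ 18 * U.card := by
  obtain ⟨A1, A2, hs'⟩ := exists_sep hA
  have h1 := (all_bd hp hf A.card).sep hs'
  obtain ⟨c1, c2, c3, c4, c5⟩ := hs.card
  have c6 := hs.int
  have c7 := hs.edges
  have hb := all_bd hp hf U.card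
  by_cases h0 : (A ∩ B).card = 0
  · have := hb.weak c3 (by omega)
    omega
  · have := hb B c3 (by omega)
    omega

lemma three_blocks {G : SimpleGraph V} (hp : IsPlanar G) (hf : ¬ HasTheta6 G) (hb : 3 ≤ {B | IsBlock G B}.ncard) :
    7 * (Ed G univ).card + 45 ≤ 18 * Fintype.card V := by
  by_cases hT : TwoC G univ
  · exfalso
    have hsub : {B | IsBlock G B} ⊆ {Set.univ} := by
      intro B hB
      have hne : (univ : Finset V).Nonempty := by
        obtain ⟨x, _⟩ := hB.1.1
        exact ⟨x, Finset.mem_univ x⟩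
      have := hB.2 _ (set_of_twoC hT hne) (by simp)
      simpa using this
    have h1 := Set.ncard_le_ncard hsub (Set.toFinite _)
    rw [Set.ncard_singleton] at h1
    omega
  · obtain ⟨A, B, hs⟩ := exists_sep hT
    by_cases hA : TwoC G A
    · by_cases hB : TwoC G B
      · exfalso
        have hsub : {B | IsBlock G B} ⊆ {(A : Set V), (B : Set V)} := by
          intro D hD
          have hAn : A.Nonempty := hs.ab.mono Finset.sdiff_subset
          have hBn : B.Nonempty := hs.ba.mono Finset.sdiff_subset
          rcases hs.side (twoC_of_set hD.1) with h | h
          · left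
            exact hD.2 _ (set_of_twoC hA hAn) (fun x hx => by simpa using h (by simpa using hx))
          · right
            exact hD.2 _ (set_of_twoC hB hBn) (fun x hx => by simpa using h (by simpa using hx))
        have h1 := Set.ncard_le_ncard hsub (Set.toFinite _)
        have h2 := Set.ncard_insert_le (A : Set V) {(B : Set V)}
        rw [Set.ncard_singleton] at h2
        omega
      · exact hs.symm.final hp hf hB
    · exact hs.final hp hf hA

lemma del_planar {G : SimpleGraph V} (hp : IsPlanar G) (v : V) : IsPlanar (G.induce {u : V | u ≠ v}) := by
  refine planar_of_wm ⟨fun u => {u.1}, ?_, fun u => conn_singleton G u.1, ?_⟩ hp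
  · intro a b w h1 h2
    simp at h1 h2
    exact Subtype.ext (by rw [← h1, ← h2])
  · intro a b hab
    exact ⟨a.1, by simp, b.1, by simp, hab⟩

lemma del_free {G : SimpleGraph V} (hf : ¬ HasTheta6 G) (v : V) : ¬ HasTheta6 (G.induce {u : V | u ≠ v}) := by
  rintro ⟨w, h1, h2, i, j, h3, h4, h5, h6⟩
  exact hf ⟨fun i => (w i).1, fun a b h => h1 (Subtype.ext h), h2, i, j, h3, h4, h5, h6⟩

lemma del_edges (G : SimpleGraph V) (v : V) :
    G.edgeSet.ncard ≤ (Ed (G.induce {u : V | u ≠ v}) univ).card + (G.neighborSet v).ncard := by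
  have hsub : G.edgeSet ⊆ (Set.image (Sym2.map Subtype.val) (Ed (G.induce {u : V | u ≠ v}) univ : Set (Sym2 {u : V | u ≠ v}))) ∪
      (Set.image (fun u => s(v, u)) (G.neighborSet v)) := by
    intro e he
    induction e using Sym2.ind with | _ a b =>
    rw [mem_edgeSet] at he
    by_cases ha : a = v
    · subst ha; right; exact ⟨b, he, rfl⟩
    by_cases hb : b = v
    · subst hb; right; exact ⟨a, he.symm, Sym2.eq_swap⟩
    left
    refine ⟨s(⟨a, ha⟩, ⟨b, hb⟩), ?_, rfl⟩
    rw [Finset.mem_coe, mem_Ed]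
    exact ⟨Finset.mem_univ _, Finset.mem_univ _, he⟩
  refine (Set.ncard_le_ncard hsub (Set.toFinite _)).trans ?_
  refine (Set.ncard_union_le _ _).trans ?_
  have h1 := Set.ncard_image_le (f := Sym2.map (Subtype.val : {u : V | u ≠ v} → V))
    (Set.toFinite (Ed (G.induce {u : V | u ≠ v}) univ : Set (Sym2 {u : V | u ≠ v})))
  rw [Set.ncard_coe_finset] at h1
  have h2 := Set.ncard_image_le (f := fun u => s(v, u)) (Set.toFinite (G.neighborSet v))
  omega

end P7
end T6

/-- If a planar graph `G` with no Theta graph on 6 vertices has a degree-2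
vertex `v` such that `G - v` has at least 3 blocks, then
`e(G) < 18n/7 - 48/7`. -/
theorem theta6_degree_two_three_blocks {V : Type*} [Fintype V] (n : ℕ)
    (G : SimpleGraph V) (hcard : Fintype.card V = n)
    (hplanar : IsPlanar G) (hfree : ¬ HasTheta6 G)
    (v : V) (hdeg : (G.neighborSet v).ncard = 2)
    (hblocks : 3 ≤ {B : Set {u : V // u ≠ v} |
      IsBlock (G.induce {u : V | u ≠ v}) B}.ncard) :
    (G.edgeSet.ncard : ℚ) < 18 / 7 * n - 48 / 7 := by
  classical
  have h1 := T6.three_blocks (T6.del_planar hplanar v) (T6.del_free hfree v) hblocks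
  have h2 := T6.del_edges G v
  rw [hdeg] at h2
  have h3 : Fintype.card {u : V | u ≠ v} + 1 = n := by
    have h4 : Fintype.card {u : V | u ≠ v} = Fintype.card V - 1 := by
      have := Fintype.card_subtype_compl (fun u => u = v)
      rw [Fintype.card_subtype_eq] at this
      rw [← this]
      exact Fintype.card_congr (Equiv.refl _)
    have h5 : 0 < Fintype.card V := Fintype.card_pos_iff.2 ⟨v⟩
    omega
  have h6 : 7 * G.edgeSet.ncard + 49 ≤ 18 * n := by
    have h7 : 7 * (T6.Ed (G.induce {u : V | u ≠ v}) Finset.univ).card + 45 ≤ 18 * Fintype.card {u : V | u ≠ v} := by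
      convert h1
    have h8 : G.edgeSet.ncard ≤ (T6.Ed (G.induce {u : V | u ≠ v}) Finset.univ).card + 2 := by
      convert h2
    omega
  have h9 : (7 * G.edgeSet.ncard + 49 : ℚ) ≤ 18 * n := by exact_mod_cast h6
  linarith
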